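/- For every fixed A > 0 there is a constant C = C(A) such that for all real x ≥ 2, E(x) ≤ C·x·(log x)^{−A}, where E(x) is the number of even integers n with 4 ≤ n ≤ x that cannot be written as the sum of two primes. In particular, almost all even integers are sums of two primes. -/

import Mathlib

/-- The number of even integers `4 ≤ n ≤ x` that are not the sum of two primes. -/
noncomputable def goldbachExceptions (x : ℝ) : ℕ :=
  {n : ℕ | 4 ≤ n ∧ (n : ℝ) ≤ x ∧ Even n ∧
    ¬ ∃ p₁ p₂ : ℕ, p₁.Prime ∧ p₂.Prime ∧ p₁ + p₂ = n}.ncard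

namespace GoldbachExceptional

open Complex Set Filter Topology MeasureTheory Asymptotics

/-- The discrepancy between the summatory function of `f`, supported beyond `N`, and `ρ (t - N)`. -/
noncomputable def discrepancy (f : ℕ → ℂ) (N : ℕ) (ρ : ℂ) (t : ℝ) : ℂ :=
  if (N : ℝ) ≤ t then (∑ k ∈ Finset.Icc 1 ⌊t⌋₊, f k) - ρ * (t - N) else 0

section discrepancy

variable {f : ℕ → ℂ} {N : ℕ} {ρ : ℂ} {D : ℝ}

lemma norm_discrepancy_le (hN : 1 ≤ N) (hD0 : 0 ≤ D)
    (hD : ∀ M : ℕ, N ≤ M → ‖(∑ k ∈ Finset.Icc 1 M, f k) - ρ * ((M : ℂ) - N)‖ ≤ D) (t : ℝ) :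
    ‖discrepancy f N ρ t‖ ≤ D + ‖ρ‖ := by
  unfold discrepancy
  split_ifs with h
  · have ht : (0 : ℝ) ≤ t := le_trans (by positivity) h
    have h1 := hD ⌊t⌋₊ (Nat.le_floor h)
    have h2 : ‖ρ * ((⌊t⌋₊ : ℂ) - t)‖ ≤ ‖ρ‖ := by
      rw [norm_mul]
      have : ‖((⌊t⌋₊ : ℂ) - t)‖ ≤ 1 := by
        rw [← ofReal_natCast, ← ofReal_sub, norm_real, Real.norm_eq_abs, abs_le]
        constructor <;> linarith [Nat.floor_le ht, Nat.lt_floor_add_one t]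
      exact mul_le_of_le_one_right (norm_nonneg _) this
    calc _ = ‖((∑ k ∈ Finset.Icc 1 ⌊t⌋₊, f k) - ρ * ((⌊t⌋₊ : ℂ) - N))
        + ρ * ((⌊t⌋₊ : ℂ) - t)‖ := by congr 1; ring
      _ ≤ _ := (norm_add_le _ _).trans (add_le_add h1 h2)
  · simpa using by positivity

lemma measurable_discrepancy : Measurable (discrepancy f N ρ) := by
  unfold discrepancy
  refine Measurable.ite (measurableSet_Ici) ?_ measurable_const
  refine Measurable.sub ?_ (by fun_prop)
  exact (measurable_from_nat (f := fun n : ℕ => ∑ k ∈ Finset.Icc 1 n, f k)).comp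
    Nat.measurable_floor

lemma differentiableAt_mellin_discrepancy (hN : 1 ≤ N) (hD0 : 0 ≤ D)
    (hD : ∀ M : ℕ, N ≤ M → ‖(∑ k ∈ Finset.Icc 1 M, f k) - ρ * ((M : ℂ) - N)‖ ≤ D)
    {w : ℂ} (hw : w.re < 0) : DifferentiableAt ℂ (mellin (discrepancy f N ρ)) w := by
  have hb := norm_discrepancy_le hN hD0 hD
  refine mellin_differentiableAt_of_isBigO_rpow (a := 0) (b := w.re - 1) ?_ ?_ hw ?_ (by linarith)
  · refine LocallyIntegrable.locallyIntegrableOn ?_ _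
    have : LocallyIntegrable (fun _ : ℝ => D + ‖ρ‖) volume := locallyIntegrable_const _
    exact this.mono measurable_discrepancy.aestronglyMeasurable
      (Eventually.of_forall fun t => (hb t).trans (le_abs_self _))
  · simp only [neg_zero, Real.rpow_zero]
    exact IsBigO.of_bound (D + ‖ρ‖) (Eventually.of_forall fun t => by simpa using hb t)
  · refine IsBigO.of_bound 1 ?_
    have : Set.Iio (1 : ℝ) ∈ 𝓝[>] (0 : ℝ) :=
      mem_nhdsWithin_of_mem_nhds (Iio_mem_nhds one_pos)
    filter_upwards [this] with t ht
    have : ¬ ((N : ℝ) ≤ t) := by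
      have : (1 : ℝ) ≤ N := by exact_mod_cast hN
      simp only [Set.mem_Iio] at ht
      linarith
    simp [discrepancy, this]

lemma mellin_discrepancy_eq (hN : 1 ≤ N) (w : ℂ) :
    mellin (discrepancy f N ρ) w = ∫ t in Set.Ioi (N : ℝ), (t : ℂ) ^ (w - 1) * discrepancy f N ρ t := by
  unfold mellin
  have hN' : (0 : ℝ) ≤ N := by positivity
  rw [← integral_Ici_eq_integral_Ioi (x := (N : ℝ))]
  simp only [smul_eq_mul]
  apply setIntegral_eq_of_subset_of_forall_sdiff_eq_zero measurableSet_Ioi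
  · intro t ht
    have : (1 : ℝ) ≤ N := by exact_mod_cast hN
    simp only [Set.mem_Ici, Set.mem_Ioi] at *
    linarith
  · intro t ht
    have : ¬ ((N : ℝ) ≤ t) := by simpa using ht.2
    simp [discrepancy, this]

lemma norm_mellin_discrepancy_le (hN : 1 ≤ N) (hD0 : 0 ≤ D)
    (hD : ∀ M : ℕ, N ≤ M → ‖(∑ k ∈ Finset.Icc 1 M, f k) - ρ * ((M : ℂ) - N)‖ ≤ D)
    {s : ℂ} (hs : 0 < s.re) :
    ‖mellin (discrepancy f N ρ) (-s)‖ ≤ (D + ‖ρ‖) * ((N : ℝ) ^ (-s.re) / s.re) := by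
  have hN' : (0 : ℝ) < N := by exact_mod_cast hN
  rw [mellin_discrepancy_eq hN]
  have hInt : IntegrableOn (fun t : ℝ => t ^ (-s.re - 1)) (Set.Ioi (N : ℝ)) :=
    integrableOn_Ioi_rpow_of_lt (by linarith) hN'
  calc _ ≤ ∫ t in Set.Ioi (N : ℝ), (D + ‖ρ‖) * t ^ (-s.re - 1) := by
        refine norm_integral_le_of_norm_le (hInt.const_mul _) ?_
        refine (ae_restrict_iff' measurableSet_Ioi).2 (Eventually.of_forall fun t ht => ?_)
        have ht0 : 0 < t := hN'.trans ht
        rw [norm_mul, norm_cpow_eq_rpow_re_of_pos ht0, mul_comm]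
        simp only [sub_re, neg_re, one_re]
        exact mul_le_mul_of_nonneg_right (norm_discrepancy_le hN hD0 hD t) (by positivity)
    _ = _ := by
        rw [integral_const_mul, integral_Ioi_rpow_of_lt (by linarith) hN']
        congr 1
        rw [show -s.re - 1 + 1 = -s.re by ring, neg_div_neg_eq]

lemma LSeries_eq_add_mellin_discrepancy (hN : 1 ≤ N) (hD0 : 0 ≤ D) (hf : ∀ n, ‖f n‖ ≤ 1)
    (h0 : ∀ n ≤ N, f n = 0)
    (hD : ∀ M : ℕ, N ≤ M → ‖(∑ k ∈ Finset.Icc 1 M, f k) - ρ * ((M : ℂ) - N)‖ ≤ D)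
    {s : ℂ} (hs : 1 < s.re) :
    LSeries f s = ρ * (N : ℂ) ^ (1 - s) / (s - 1) + s * mellin (discrepancy f N ρ) (-s) := by
  have hN' : (0 : ℝ) < N := by exact_mod_cast hN
  have hN1 : (1 : ℝ) ≤ N := by exact_mod_cast hN
  have hs0 : s ≠ 0 := by rintro rfl; simp at hs; linarith
  have hs1 : s - 1 ≠ 0 := by
    intro h; have := congrArg re h; simp at this; linarith
  have hsum : LSeriesSummable f s := LSeriesSummable_of_bounded_of_one_lt_re (m := 1)
    (fun n _ => hf n) hs
  rw [LSeries_eq_mul_integral f zero_le_one hs hsum]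
  swap
  · refine IsBigO.of_bound 1 (Eventually.of_forall fun n => ?_)
    simp only [Real.rpow_one, one_mul, Real.norm_natCast]
    refine (norm_sum_le_of_le _ fun k _ => hf k).trans ?_
    simp
  have hz : ∀ t : ℝ, t ≤ N → ∑ k ∈ Finset.Icc 1 ⌊t⌋₊, f k = 0 := fun t ht =>
    Finset.sum_eq_zero fun k hk => h0 k <| by
      have := (Finset.mem_Icc.1 hk).2.trans (Nat.floor_le_floor ht)
      simpa using this
  have e1 : ∫ t in Set.Ioi (1 : ℝ), (∑ k ∈ Finset.Icc 1 ⌊t⌋₊, f k) * (t : ℂ) ^ (-(s + 1))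
      = ∫ t in Set.Ioi (N : ℝ), (∑ k ∈ Finset.Icc 1 ⌊t⌋₊, f k) * (t : ℂ) ^ (-(s + 1)) := by
    apply setIntegral_eq_of_subset_of_forall_sdiff_eq_zero measurableSet_Ioi
    · exact Set.Ioi_subset_Ioi hN1
    · intro t ht
      rw [hz t (by simpa using ht.2), zero_mul]
  rw [e1, mellin_discrepancy_eq hN]
  have hi1 : IntegrableOn (fun t : ℝ => (t : ℂ) ^ (-s)) (Set.Ioi (N : ℝ)) :=
    integrableOn_Ioi_cpow_of_lt (by simpa using hs) hN'
  have hi2 : IntegrableOn (fun t : ℝ => (t : ℂ) ^ (-s - 1)) (Set.Ioi (N : ℝ)) :=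
    integrableOn_Ioi_cpow_of_lt (by simp; linarith) hN'
  have hi3 : IntegrableOn (fun t : ℝ => (t : ℂ) ^ (-s - 1) * discrepancy f N ρ t)
      (Set.Ioi (N : ℝ)) := by
    refine Integrable.mul_bdd (c := D + ‖ρ‖) hi2 measurable_discrepancy.aestronglyMeasurable
      (Eventually.of_forall fun t => norm_discrepancy_le hN hD0 hD t)
  have e2 : ∫ t in Set.Ioi (N : ℝ), (∑ k ∈ Finset.Icc 1 ⌊t⌋₊, f k) * (t : ℂ) ^ (-(s + 1))
      = ∫ t in Set.Ioi (N : ℝ), ((ρ * (t : ℂ) ^ (-s) - ρ * N * (t : ℂ) ^ (-s - 1))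
        + (t : ℂ) ^ (-s - 1) * discrepancy f N ρ t) := by
    refine setIntegral_congr_fun measurableSet_Ioi fun t ht => ?_
    have ht' : (N : ℝ) ≤ t := le_of_lt ht
    have ht0 : (t : ℂ) ≠ 0 := ofReal_ne_zero.2 (hN'.trans ht).ne'
    have : (t : ℂ) ^ (-s) = t * (t : ℂ) ^ (-s - 1) := by
      rw [cpow_sub _ _ ht0, cpow_one]; field_simp
    simp only [discrepancy, ht', if_true, this]
    rw [show -(s + 1) = -s - 1 by ring]
    ring
  have hi4 := hi1.const_mul ρ
  have hi5 := hi2.const_mul (ρ * N)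
  rw [e2, integral_add (f := fun t : ℝ => ρ * (t : ℂ) ^ (-s) - ρ * N * (t : ℂ) ^ (-s - 1))
    (hi4.sub hi5) hi3, integral_sub hi4 hi5, integral_const_mul, integral_const_mul,
    integral_Ioi_cpow_of_lt (by simpa using hs) hN',
    integral_Ioi_cpow_of_lt (by simp; linarith) hN']
  have hNc : ((N : ℝ) : ℂ) ≠ 0 := ofReal_ne_zero.2 hN'.ne'
  have e3 : ((N : ℝ) : ℂ) ^ (-s - 1 + 1) = (N : ℂ) ^ (1 - s) / N := by
    rw [show -s - 1 + 1 = (1 - s) - 1 by ring, cpow_sub _ _ hNc, cpow_one]; simp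
  have e4 : ((N : ℝ) : ℂ) ^ (-s + 1) = (N : ℂ) ^ (1 - s) := by
    rw [show -s + 1 = 1 - s by ring]; simp
  rw [e3, e4, mul_add]
  congr 1
  have h1s : -s + 1 ≠ 0 := by intro h; apply hs1; linear_combination -h
  rw [show -s - 1 + 1 = -s by ring]
  have : (N : ℂ) ≠ 0 := by exact_mod_cast hNc
  field_simp
  ring
end discrepancy

lemma sum_range_natCast_zmod {q : ℕ} [NeZero q] (g : ZMod q → ℂ) (a : ℕ) :
    ∑ i ∈ Finset.range q, g ((a + i : ℕ) : ZMod q) = ∑ x, g x := by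
  have h : ∀ x : ZMod q, ((x.val : ℕ) : ZMod q) = x := ZMod.natCast_zmod_val
  rw [← Equiv.sum_comp (Equiv.addLeft (a : ZMod q)) g]
  refine Finset.sum_bij (fun i _ => (i : ZMod q)) (fun _ _ => Finset.mem_univ _) ?_ ?_ ?_
  · intro i hi j hj hij
    have := congrArg ZMod.val hij
    rwa [ZMod.val_cast_of_lt (Finset.mem_range.1 hi), ZMod.val_cast_of_lt (Finset.mem_range.1 hj)]
      at this
  · exact fun x _ => ⟨x.val, Finset.mem_range.2 (ZMod.val_lt x), h x⟩
  · intro i _; simp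

lemma norm_sum_range_periodic_le {q : ℕ} [NeZero q] {g : ZMod q → ℂ} {B : ℝ} (hB : ∀ x, ‖g x‖ ≤ B)
    (hg : ∑ x, g x = 0) (a m : ℕ) :
    ‖∑ i ∈ Finset.range m, g ((a + i : ℕ) : ZMod q)‖ ≤ B * q := by
  have hB0 : 0 ≤ B := (norm_nonneg _).trans (hB 0)
  induction m using Nat.strong_induction_on generalizing a with
  | _ m ih =>
    rcases lt_or_ge m q with h | h
    · refine (norm_sum_le_of_le _ fun i _ => hB _).trans ?_
      simp only [Finset.sum_const, Finset.card_range, nsmul_eq_mul]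
      rw [mul_comm]
      gcongr
    · obtain ⟨k, rfl⟩ := Nat.exists_eq_add_of_le h
      rw [Finset.sum_range_add, sum_range_natCast_zmod, hg, zero_add]
      simpa only [add_assoc] using ih k (by have := NeZero.pos q; omega) (a + q)

/-- The mean value of a Dirichlet character. -/
noncomputable def charMean {q : ℕ} [NeZero q] (χ : DirichletCharacter ℂ q) : ℂ := (∑ x, χ x) / q

lemma norm_charMean_le {q : ℕ} [NeZero q] (χ : DirichletCharacter ℂ q) : ‖charMean χ‖ ≤ 1 := by
  have hq : (0 : ℝ) < q := by exact_mod_cast NeZero.pos q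
  rw [charMean, norm_div, norm_natCast, div_le_one hq]
  refine (norm_sum_le_of_le _ fun x _ => χ.norm_le_one x).trans ?_
  simp [ZMod.card]

lemma charMean_eq_zero {q : ℕ} [NeZero q] {χ : DirichletCharacter ℂ q} (hχ : χ ≠ 1) :
    charMean χ = 0 := by
  rw [charMean, MulChar.sum_eq_zero_of_ne_one hχ, zero_div]

section tail

variable {q : ℕ} (χ : DirichletCharacter ℂ q) (N : ℕ)

/-- A Dirichlet character restricted to the integers exceeding `N`. -/
noncomputable def charTail (n : ℕ) : ℂ := if n ≤ N then 0 else χ n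

lemma norm_charTail_le (n : ℕ) : ‖charTail χ N n‖ ≤ 1 := by
  unfold charTail; split_ifs <;> simp [χ.norm_le_one]

lemma norm_sum_charTail_sub_le [NeZero q] {M : ℕ} (hM : N ≤ M) :
    ‖(∑ k ∈ Finset.Icc 1 M, charTail χ N k) - charMean χ * ((M : ℂ) - N)‖ ≤ 2 * q := by
  obtain ⟨m, rfl⟩ := Nat.exists_eq_add_of_le hM
  have h1 : ∑ k ∈ Finset.Icc 1 (N + m), charTail χ N k
      = ∑ i ∈ Finset.range m, χ ((N + 1 + i : ℕ) : ZMod q) := by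
    have : ∑ k ∈ Finset.Icc 1 (N + m), charTail χ N k = ∑ k ∈ Finset.Ico (N + 1) (N + 1 + m), χ k := by
      symm
      refine Finset.sum_subset_zero_on_sdiff (fun k hk => ?_) (fun k hk => ?_) (fun k hk => ?_)
      · simp only [Finset.mem_Ico, Finset.mem_Icc] at *; omega
      · simp only [Finset.mem_sdiff, Finset.mem_Ico, Finset.mem_Icc] at hk
        exact if_pos (by omega)
      · simp only [Finset.mem_Ico] at hk
        exact (if_neg (by omega)).symm
    rw [this, Finset.sum_Ico_eq_sum_range]; simp
  have h2 := norm_sum_range_periodic_le (q := q) (g := fun x => χ x - charMean χ) (B := 2)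
    (fun x => (norm_sub_le _ _).trans (by linarith [χ.norm_le_one x, norm_charMean_le χ]))
    (by
      have : (q : ℂ) ≠ 0 := by exact_mod_cast NeZero.ne q
      rw [Finset.sum_sub_distrib, Finset.sum_const, charMean]; simp [ZMod.card]; field_simp; simp)
    (N + 1) m
  rw [h1]
  convert h2 using 2
  simp [Finset.sum_sub_distrib, mul_comm]

lemma LSeries_charTail {s : ℂ} (hs : 1 < s.re) :
    LSeries (fun n => χ n) s
      = ∑ n ∈ Finset.Icc 1 N, χ n * (n : ℂ) ^ (-s) + LSeries (charTail χ N) s := by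
  have hsum : LSeriesSummable (charTail χ N) s := LSeriesSummable_of_bounded_of_one_lt_re (m := 1)
    (fun n _ => norm_charTail_le χ N n) hs
  have hfin : LSeriesSummable (fun n => if n ≤ N then χ n else 0) s :=
    LSeriesSummable_of_bounded_of_one_lt_re (m := 1)
    (fun n _ => by split_ifs <;> simp [χ.norm_le_one]) hs
  have e : (fun n : ℕ => χ n) = (fun n : ℕ => if n ≤ N then χ n else 0) + charTail χ N := by
    ext n; simp only [charTail, Pi.add_apply]; split_ifs <;> simp
  rw [e, LSeries_add hfin hsum]
  congr 1
  rw [LSeries, tsum_eq_sum (s := Finset.Icc 1 N)]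
  · refine Finset.sum_congr rfl fun n hn => ?_
    obtain ⟨h1, h2⟩ := Finset.mem_Icc.1 hn
    rw [LSeries.term_of_ne_zero (by omega), if_pos h2, cpow_neg, div_eq_mul_inv]
  · intro n hn
    rcases Nat.eq_zero_or_pos n with rfl | h
    · simp
    · rw [LSeries.term_of_ne_zero (by omega), if_neg (by simp at hn; omega), zero_div]

variable [NeZero q] {N}

theorem LFunction_eq_sum_add (hN : 1 ≤ N) {s : ℂ} (hs : 0 < s.re) (hsχ : s ≠ 1 ∨ χ ≠ 1) :
    DirichletCharacter.LFunction χ s = ∑ n ∈ Finset.Icc 1 N, χ n * (n : ℂ) ^ (-s)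
      + charMean χ * (N : ℂ) ^ (1 - s) / (s - 1)
      + s * mellin (discrepancy (charTail χ N) N (charMean χ)) (-s) := by
  have hNc : (N : ℂ) ≠ 0 := by exact_mod_cast (by omega : N ≠ 0)
  have hdm : ∀ s : ℂ, 0 < s.re → DifferentiableAt ℂ
      (fun s => mellin (discrepancy (charTail χ N) N (charMean χ)) (-s)) s := fun s hs => by
    have h := differentiableAt_mellin_discrepancy (w := -s) hN (D := 2 * q) (by positivity)
      (fun M hM => norm_sum_charTail_sub_le χ N hM) (by simpa using hs)
    exact DifferentiableAt.comp (g := mellin (discrepancy (charTail χ N) N (charMean χ)))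
      (f := fun s => -s) s h (by fun_prop)
  have hcp : ∀ c : ℂ, c ≠ 0 → ∀ g : ℂ → ℂ, Differentiable ℂ g → Differentiable ℂ (fun s => c ^ g s) :=
    fun c hc g hg s => (hg s).const_cpow (Or.inl hc)
  have hds : Differentiable ℂ (fun s : ℂ => ∑ n ∈ Finset.Icc 1 N, χ n * (n : ℂ) ^ (-s)) := by
    refine Differentiable.fun_sum fun n hn => ?_
    refine Differentiable.const_mul (hcp n ?_ _ (by fun_prop)) _
    have := (Finset.mem_Icc.1 hn).1
    exact_mod_cast (by omega : n ≠ 0)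
  have hdp : Differentiable ℂ (fun s : ℂ => (N : ℂ) ^ (1 - s)) := hcp _ hNc _ (by fun_prop)
  have heq : ∀ s : ℂ, 1 < s.re → DirichletCharacter.LFunction χ s
      = ∑ n ∈ Finset.Icc 1 N, χ n * (n : ℂ) ^ (-s)
      + charMean χ * (N : ℂ) ^ (1 - s) / (s - 1)
      + s * mellin (discrepancy (charTail χ N) N (charMean χ)) (-s) := fun s hs => by
    rw [DirichletCharacter.LFunction_eq_LSeries χ hs, LSeries_charTail χ N hs, add_assoc]
    congr 1
    exact LSeries_eq_add_mellin_discrepancy hN (D := 2 * q) (by positivity)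
      (fun n => norm_charTail_le χ N n)
      (fun n hn => if_pos hn) (fun M hM => norm_sum_charTail_sub_le χ N hM) hs
  have hU : IsOpen {s : ℂ | 0 < s.re} := isOpen_lt continuous_const continuous_re
  have hUc : IsPreconnected {s : ℂ | 0 < s.re} := (convex_halfSpace_re_gt 0).isPreconnected
  have hnear : {s : ℂ | 1 < s.re} ∈ 𝓝 (2 : ℂ) :=
    (isOpen_lt continuous_const continuous_re).mem_nhds (by simp)
  by_cases hχ : χ = 1
  · have hs1 : s ≠ 1 := hsχ.resolve_right (not_not.2 hχ)
    subst hχ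
    set m := charMean (1 : DirichletCharacter ℂ q)
    set F : ℂ → ℂ := DirichletCharacter.LFunctionTrivChar₁ q
    set G : ℂ → ℂ := fun s => (s - 1) * (∑ n ∈ Finset.Icc 1 N,
      (1 : DirichletCharacter ℂ q) n * (n : ℂ) ^ (-s)) + m * (N : ℂ) ^ (1 - s)
      + (s - 1) * (s * mellin (discrepancy (charTail 1 N) N m) (-s))
    have hF : ∀ s : ℂ, s ≠ 1 → F s = (s - 1) * DirichletCharacter.LFunction 1 s := fun s hs =>
      Function.update_of_ne hs _ _
    have hFG : EqOn F G {s : ℂ | 0 < s.re} := by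
      refine AnalyticOnNhd.eqOn_of_preconnected_of_eventuallyEq (𝕜 := ℂ) (z₀ := 2) ?_ ?_ hUc
        (by simp) ?_
      · exact ((DirichletCharacter.differentiable_LFunctionTrivChar₁ q).differentiableOn).analyticOnNhd hU
      · refine DifferentiableOn.analyticOnNhd (fun s hs => DifferentiableAt.differentiableWithinAt ?_) hU
        have hid : DifferentiableAt ℂ (fun s : ℂ => s - 1) s := differentiableAt_id.sub_const 1
        exact ((hid.fun_mul (hds s)).fun_add ((hdp s).const_mul m)).fun_add
          (hid.fun_mul (differentiableAt_id.fun_mul (hdm s hs)))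
      · filter_upwards [hnear] with s hs
        have h1 : s ≠ 1 := by rintro rfl; simp at hs
        have : s - 1 ≠ 0 := sub_ne_zero.2 h1
        rw [hF s h1, heq s hs]
        simp only [G, m]
        field_simp
    have h := hFG hs
    rw [hF s hs1] at h
    have : s - 1 ≠ 0 := sub_ne_zero.2 hs1
    refine mul_left_cancel₀ this ?_
    rw [h]
    simp only [G, m]
    field_simp
  · have h0 := charMean_eq_zero hχ
    have := AnalyticOnNhd.eqOn_of_preconnected_of_eventuallyEq (𝕜 := ℂ) (z₀ := 2)
      (f := DirichletCharacter.LFunction χ) (g := fun s => ∑ n ∈ Finset.Icc 1 N, χ n * (n : ℂ) ^ (-s)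
      + charMean χ * (N : ℂ) ^ (1 - s) / (s - 1)
      + s * mellin (discrepancy (charTail χ N) N (charMean χ)) (-s))
      (((DirichletCharacter.differentiable_LFunction hχ).differentiableOn).analyticOnNhd hU) ?_ hUc
        (by simp) ?_
    · exact this hs
    · refine DifferentiableOn.analyticOnNhd (fun s hs => DifferentiableAt.differentiableWithinAt ?_) hU
      have h1 := (hds s).fun_add (differentiableAt_id.fun_mul (hdm s hs))
      simp only [h0, zero_mul, zero_div, add_zero] at h1 ⊢
      exact h1
    · filter_upwards [hnear] with s hs using heq s hs

theorem norm_LFunction_le_sum_add (hN : 1 ≤ N) {s : ℂ} (hs : 0 < s.re) (hs1 : s ≠ 1 ∨ χ ≠ 1) :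
    ‖DirichletCharacter.LFunction χ s‖ ≤ ∑ n ∈ Finset.Icc 1 N, (n : ℝ) ^ (-s.re)
      + ‖charMean χ‖ * (N : ℝ) ^ (1 - s.re) / ‖s - 1‖
      + ‖s‖ * (3 * q * ((N : ℝ) ^ (-s.re) / s.re)) := by
  have hq : (1 : ℝ) ≤ q := by exact_mod_cast NeZero.one_le
  have hN0 : 0 < N := hN
  rw [LFunction_eq_sum_add χ hN hs hs1]
  refine (norm_add₃_le).trans ?_
  gcongr
  · refine norm_sum_le_of_le _ fun n hn => ?_
    have hn : 0 < n := (Finset.mem_Icc.1 hn).1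
    rw [norm_mul, norm_natCast_cpow_of_pos hn]
    exact mul_le_of_le_one_left (by positivity) (χ.norm_le_one _)
  · rw [norm_div, norm_mul, norm_natCast_cpow_of_pos hN0]
    simp
  · rw [norm_mul]
    gcongr
    refine (norm_mellin_discrepancy_le hN (D := 2 * q) (by positivity)
      (fun M hM => norm_sum_charTail_sub_le χ N hM) hs).trans ?_
    gcongr
    linarith [norm_charMean_le χ]

end tail

/-- The analytic conductor of a Dirichlet `L`-function modulo `q` at the point `s`. -/
noncomputable def conductor (q : ℕ) (s : ℂ) : ℝ := q * (|s.im| + 2)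

lemma two_le_conductor (q : ℕ) [NeZero q] (s : ℂ) : 2 ≤ conductor q s := by
  have hq : (1 : ℝ) ≤ q := by exact_mod_cast NeZero.one_le
  unfold conductor
  nlinarith [abs_nonneg s.im]

lemma conductor_pos (q : ℕ) [NeZero q] (s : ℂ) : 0 < conductor q s := by
  linarith [two_le_conductor q s]

lemma conductor_le_two_mul {q : ℕ} {s w : ℂ} (h : ‖w - s‖ ≤ 1) :
    conductor q w ≤ 2 * conductor q s := by
  have h1 := (abs_im_le_norm (w - s)).trans h
  rw [sub_im] at h1
  have h2 : |w.im| ≤ |s.im| + 1 := by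
    have := abs_sub_abs_le_abs_sub w.im s.im
    linarith
  unfold conductor
  have hq : (0 : ℝ) ≤ q := by positivity
  nlinarith [abs_nonneg s.im]

theorem exists_norm_LFunction_le {ε : ℝ} (hε : 0 < ε) (hε' : ε ≤ 1 / 4) :
    ∃ C : ℝ, 0 < C ∧ ∀ (q : ℕ) [NeZero q] (χ : DirichletCharacter ℂ q) (s : ℂ), s ≠ 1 ∨ χ ≠ 1 →
      1 - ε ≤ s.re → s.re ≤ 3 → ‖DirichletCharacter.LFunction χ s‖
        ≤ C * conductor q s ^ (2 * ε) * (1 + ‖charMean χ‖ / ‖s - 1‖) := by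
  have hsum : Summable (fun n : ℕ => (n : ℝ) ^ (-(1 + ε))) := by
    rw [Real.summable_nat_rpow]; linarith
  set Z := ∑' n : ℕ, (n : ℝ) ^ (-(1 + ε)) with hZ
  have hZ0 : 0 ≤ Z := tsum_nonneg fun n => by positivity
  refine ⟨2 * (Z + 20), by positivity, fun q _ χ s hs1 hre hre3 => ?_⟩
  have hq : (1 : ℝ) ≤ q := by exact_mod_cast NeZero.one_le
  have hQ := two_le_conductor q s
  set Q := conductor q s with hQdef
  set N := ⌈Q⌉₊ with hNdef
  have hNQ : Q ≤ N := Nat.le_ceil _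
  have hN2 : (N : ℝ) ≤ 2 * Q := by linarith [Nat.ceil_lt_add_one (a := Q) (by linarith)]
  have hN1r : (1 : ℝ) ≤ N := by linarith
  have hN1 : 1 ≤ N := by exact_mod_cast hN1r
  have hN0 : (0 : ℝ) < N := by linarith
  have hs0 : 0 < s.re := by linarith
  have hpow1 : (N : ℝ) ^ ε ≤ (N : ℝ) ^ (2 * ε) := Real.rpow_le_rpow_of_exponent_le hN1r (by linarith)
  have hpow : (N : ℝ) ^ (2 * ε) ≤ 2 * Q ^ (2 * ε) := by
    calc (N : ℝ) ^ (2 * ε) ≤ (2 * Q) ^ (2 * ε) := by gcongr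
      _ = 2 ^ (2 * ε) * Q ^ (2 * ε) := Real.mul_rpow (by norm_num) (by linarith)
      _ ≤ 2 ^ (1 : ℝ) * Q ^ (2 * ε) := by gcongr <;> linarith
      _ = _ := by simp
  have h1 : ∑ n ∈ Finset.Icc 1 N, (n : ℝ) ^ (-s.re) ≤ N ^ (2 * ε) * Z := by
    calc ∑ n ∈ Finset.Icc 1 N, (n : ℝ) ^ (-s.re)
        ≤ ∑ n ∈ Finset.Icc 1 N, (N : ℝ) ^ (2 * ε) * (n : ℝ) ^ (-(1 + ε)) := by
          refine Finset.sum_le_sum fun n hn => ?_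
          obtain ⟨hn1, hn2⟩ := Finset.mem_Icc.1 hn
          have hn1r : (1 : ℝ) ≤ n := by exact_mod_cast hn1
          calc (n : ℝ) ^ (-s.re) ≤ (n : ℝ) ^ (2 * ε + (-(1 + ε))) :=
                Real.rpow_le_rpow_of_exponent_le hn1r (by linarith)
            _ = (n : ℝ) ^ (2 * ε) * (n : ℝ) ^ (-(1 + ε)) := Real.rpow_add (by linarith) _ _
            _ ≤ _ := by gcongr
      _ = N ^ (2 * ε) * ∑ n ∈ Finset.Icc 1 N, (n : ℝ) ^ (-(1 + ε)) := by rw [Finset.mul_sum]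
      _ ≤ _ := by
          gcongr
          exact hsum.sum_le_tsum _ (fun n _ => by positivity)
  have h2 : ‖charMean χ‖ * (N : ℝ) ^ (1 - s.re) / ‖s - 1‖
      ≤ N ^ (2 * ε) * (‖charMean χ‖ / ‖s - 1‖) := by
    rw [mul_comm ‖charMean χ‖, mul_div_assoc]
    gcongr
    linarith
  have h3 : ‖s‖ * (3 * q * ((N : ℝ) ^ (-s.re) / s.re)) ≤ 8 * N ^ (2 * ε) := by
    have hsn : ‖s‖ ≤ 2 * (|s.im| + 2) := by
      have := norm_le_abs_re_add_abs_im s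
      rw [abs_of_pos hs0] at this
      linarith [abs_nonneg s.im]
    have hd : (N : ℝ) ^ (-s.re) / s.re ≤ (N : ℝ) ^ (-1 + ε) * (4 / 3) := by
      rw [div_eq_mul_inv]
      gcongr
      · linarith
      · rw [inv_le_comm₀ hs0 (by norm_num)]; linarith
    calc ‖s‖ * (3 * q * ((N : ℝ) ^ (-s.re) / s.re))
        ≤ (2 * (|s.im| + 2)) * (3 * q * ((N : ℝ) ^ (-1 + ε) * (4 / 3))) := by gcongr
      _ = 8 * Q * ((N : ℝ) ^ (-1 + ε)) := by rw [hQdef, conductor]; ring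
      _ ≤ 8 * N * ((N : ℝ) ^ (-1 + ε)) := by gcongr
      _ = 8 * N ^ ε := by
          rw [Real.rpow_add hN0, Real.rpow_neg_one]; field_simp
      _ ≤ _ := by gcongr
  refine (norm_LFunction_le_sum_add χ hN1 hs0 hs1).trans ?_
  have hm : 0 ≤ ‖charMean χ‖ / ‖s - 1‖ := by positivity
  have hP : (0 : ℝ) ≤ N ^ (2 * ε) := by positivity
  calc _ ≤ N ^ (2 * ε) * Z + N ^ (2 * ε) * (‖charMean χ‖ / ‖s - 1‖) + 8 * N ^ (2 * ε) := by gcongr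
    _ ≤ N ^ (2 * ε) * ((Z + 20) * (1 + ‖charMean χ‖ / ‖s - 1‖)) := by
        have : 0 ≤ N ^ (2 * ε) * (Z * (‖charMean χ‖ / ‖s - 1‖)) := by positivity
        have : 0 ≤ N ^ (2 * ε) * (‖charMean χ‖ / ‖s - 1‖) := by positivity
        nlinarith
    _ ≤ (2 * Q ^ (2 * ε)) * ((Z + 20) * (1 + ‖charMean χ‖ / ‖s - 1‖)) := by gcongr
    _ = _ := by ring

/-- The points at which `L(s, χ)` is kept away from a possible pole. -/
def AwayFromPole {q : ℕ} (χ : DirichletCharacter ℂ q) (s : ℂ) : Prop := χ ≠ 1 ∨ 1 ≤ |s.im|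

lemma AwayFromPole.ne_one {q : ℕ} {χ : DirichletCharacter ℂ q} {s w : ℂ} (h : AwayFromPole χ s)
    (hw : ‖w - s‖ ≤ 1 / 2) : w ≠ 1 ∨ χ ≠ 1 := by
  rcases h with h | h
  · exact Or.inr h
  · left
    rintro rfl
    have := (abs_im_le_norm (1 - s)).trans hw
    simp at this
    linarith

lemma AwayFromPole.norm_charMean_div_le {q : ℕ} [NeZero q] {χ : DirichletCharacter ℂ q} {s w : ℂ}
    (h : AwayFromPole χ s) (hw : ‖w - s‖ ≤ 1 / 2) : ‖charMean χ‖ / ‖w - 1‖ ≤ 2 := by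
  rcases h with h | h
  · simp [charMean_eq_zero h]
  · have h1 := (abs_im_le_norm (w - s)).trans hw
    have h2 := abs_im_le_norm (w - 1)
    simp only [sub_im, one_im, sub_zero] at h1 h2
    have h3 := abs_sub_abs_le_abs_sub s.im w.im
    rw [abs_sub_comm] at h3
    rw [div_le_iff₀ (by linarith)]
    linarith [norm_charMean_le χ]

theorem exists_norm_LFunction_le_of_awayFromPole {ε : ℝ} (hε : 0 < ε) (hε' : ε ≤ 1 / 4) :
    ∃ C : ℝ, 0 < C ∧ ∀ (q : ℕ) [NeZero q] (χ : DirichletCharacter ℂ q) (s w : ℂ),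
      AwayFromPole χ s → ‖w - s‖ ≤ 1 / 2 → 1 - ε ≤ w.re → w.re ≤ 3 →
      ‖DirichletCharacter.LFunction χ w‖ ≤ C * conductor q s ^ (2 * ε) := by
  obtain ⟨C, hC, h⟩ := exists_norm_LFunction_le hε hε'
  refine ⟨C * 2 * 3, by positivity, fun q _ χ s w hs hw h1 h2 => ?_⟩
  refine (h q χ w (hs.ne_one hw) h1 h2).trans ?_
  have hQ := two_le_conductor q s
  have hQw := two_le_conductor q w
  have hpow : conductor q w ^ (2 * ε) ≤ 2 * conductor q s ^ (2 * ε) := by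
    calc conductor q w ^ (2 * ε) ≤ (2 * conductor q s) ^ (2 * ε) := by
          gcongr
          exact conductor_le_two_mul (by linarith)
      _ = 2 ^ (2 * ε) * conductor q s ^ (2 * ε) := Real.mul_rpow (by norm_num) (by linarith)
      _ ≤ 2 ^ (1 : ℝ) * conductor q s ^ (2 * ε) := by gcongr <;> linarith
      _ = _ := by simp
  have h3 : 1 + ‖charMean χ‖ / ‖w - 1‖ ≤ 3 := by linarith [hs.norm_charMean_div_le hw]
  calc C * conductor q w ^ (2 * ε) * (1 + ‖charMean χ‖ / ‖w - 1‖)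
      ≤ C * (2 * conductor q s ^ (2 * ε)) * 3 := by gcongr
    _ = _ := by ring

theorem exists_norm_deriv_LFunction_le {ε : ℝ} (hε : 0 < ε) (hε' : ε ≤ 1 / 4) :
    ∃ C : ℝ, 0 < C ∧ ∀ (q : ℕ) [NeZero q] (χ : DirichletCharacter ℂ q) (s w : ℂ),
      AwayFromPole χ s → ‖w - s‖ ≤ 1 / 4 → 1 - ε / 2 ≤ w.re → w.re ≤ 5 / 2 →
      ‖deriv (DirichletCharacter.LFunction χ) w‖ ≤ C * conductor q s ^ (2 * ε) := by
  obtain ⟨C, hC, h⟩ := exists_norm_LFunction_le_of_awayFromPole hε hε'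
  refine ⟨C / (ε / 2), by positivity, fun q _ χ s w hs hw h1 h2 => ?_⟩
  have hnear : ∀ z : ℂ, ‖z - w‖ ≤ ε / 2 → ‖z - s‖ ≤ 1 / 2 := fun z hz => by
    have := norm_add_le (z - w) (w - s)
    rw [sub_add_sub_cancel] at this
    linarith
  have key := norm_deriv_le_of_forall_mem_sphere_norm_le (f := DirichletCharacter.LFunction χ)
    (c := w) (R := ε / 2) (C := C * conductor q s ^ (2 * ε)) (by positivity) ?_ ?_
  · refine key.trans (le_of_eq (by ring))
  · refine DifferentiableOn.diffContOnCl fun z hz => ?_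
    rw [closure_ball _ (by positivity), Metric.mem_closedBall, dist_eq_norm] at hz
    exact (DirichletCharacter.differentiableAt_LFunction χ z
      (hs.ne_one (hnear z hz))).differentiableWithinAt
  · intro z hz
    rw [mem_sphere_iff_norm] at hz
    have hre := abs_re_le_norm (z - w)
    rw [hz, sub_re, abs_le] at hre
    exact h q χ s z hs (hnear z hz.le) (by linarith) (by linarith)

theorem exists_norm_LFunction_sub_le {ε : ℝ} (hε : 0 < ε) (hε' : ε ≤ 1 / 4) :
    ∃ C : ℝ, 0 < C ∧ ∀ (q : ℕ) [NeZero q] (χ : DirichletCharacter ℂ q) (s w : ℂ),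
      AwayFromPole χ s → ‖w - s‖ ≤ 1 / 4 → 1 - ε / 2 ≤ w.re → w.re ≤ 5 / 2 →
      1 - ε / 2 ≤ s.re → s.re ≤ 5 / 2 →
      ‖DirichletCharacter.LFunction χ w - DirichletCharacter.LFunction χ s‖
        ≤ C * conductor q s ^ (2 * ε) * ‖w - s‖ := by
  obtain ⟨C, hC, h⟩ := exists_norm_deriv_LFunction_le hε hε'
  refine ⟨C, hC, fun q _ χ s w hs hw h1 h2 h3 h4 => ?_⟩
  have hconv : Convex ℝ (Metric.closedBall s (1 / 4) ∩ ({z : ℂ | 1 - ε / 2 ≤ z.re} ∩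
      {z : ℂ | z.re ≤ 5 / 2})) := (convex_closedBall _ _).inter
    ((convex_halfSpace_re_ge _).inter (convex_halfSpace_re_le _))
  refine hconv.norm_image_sub_le_of_norm_deriv_le (𝕜 := ℂ) (fun z hz => ?_) (fun z hz => ?_)
    ⟨by simp, h3, h4⟩ ⟨by simpa [dist_eq_norm] using hw, h1, h2⟩
  · have hz1 := hz.1
    rw [Metric.mem_closedBall, dist_eq_norm] at hz1
    exact DirichletCharacter.differentiableAt_LFunction χ z (hs.ne_one (by linarith))
  · have hz1 := hz.1
    rw [Metric.mem_closedBall, dist_eq_norm] at hz1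
    exact h q χ s z hs hz1 hz.2.1 hz.2.2

theorem exists_norm_LFunction_pow_four_ge {ε : ℝ} (hε : 0 < ε) (hε' : ε ≤ 1 / 4) :
    ∃ C : ℝ, 0 < C ∧ ∀ (q : ℕ) [NeZero q] (χ : DirichletCharacter ℂ q) (t x τ : ℝ),
      0 < x → x ≤ 1 → 0 < τ → τ ≤ 1 → (χ ^ 2 ≠ 1 ∨ τ ≤ ‖(x + t * I : ℂ)‖) →
      x ^ 3 * τ ≤ (C * (q * (|t| + 2)) ^ (2 * ε) * ‖DirichletCharacter.LFunction χ (1 + x + t * I)‖) ^ 4 := by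
  obtain ⟨C, hC, h⟩ := exists_norm_LFunction_le hε hε'
  refine ⟨3 * C, by positivity, fun q _ χ t x τ hx hx1 hτ hτ1 hχ => ?_⟩
  have hq : (1 : ℝ) ≤ q := by exact_mod_cast NeZero.one_le
  set Q : ℝ := q * (|t| + 2) with hQ
  have hQ1 : 1 ≤ Q := by nlinarith [abs_nonneg t]
  have key := DirichletCharacter.norm_LFunction_product_ge_one χ hx t
  rw [norm_mul, norm_mul, norm_pow, norm_pow] at key
  have hx0 : (1 + x : ℂ) ≠ 1 := by
    intro h; apply hx.ne'; simpa using h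
  have h1 := h q (1 : DirichletCharacter ℂ q) (1 + x) (Or.inl hx0) (by simp; linarith)
    (by simp; linarith)
  have hc1 : conductor q (1 + x) ≤ Q := by
    simp only [conductor, add_im, one_im, ofReal_im, add_zero, abs_zero, hQ]
    gcongr
    exact abs_nonneg t
  have hn1 : ‖(1 + x : ℂ) - 1‖ = x := by simp [abs_of_pos hx]
  have e1 : 0 ≤ conductor q (1 + x) := (conductor_pos _ _).le
  have h1' : ‖DirichletCharacter.LFunction (1 : DirichletCharacter ℂ q) (1 + x)‖
      ≤ C * Q ^ (2 * ε) * (2 / x) := by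
    refine h1.trans ?_
    rw [hn1]
    gcongr
    have : ‖charMean (1 : DirichletCharacter ℂ q)‖ / x ≤ 1 / x := by
      gcongr; exact norm_charMean_le _
    have h' : 1 ≤ 1 / x := by rwa [le_div_iff₀ hx, one_mul]
    calc _ ≤ 1 / x + 1 / x := by linarith
      _ = _ := by ring
  have hre : (1 + x + 2 * (I * t) : ℂ).re = 1 + x := by simp
  have him : (1 + x + 2 * (I * t) : ℂ).im = 2 * t := by simp
  have hx2 : (1 + x + I * t * 2 : ℂ) ≠ 1 := by
    intro h; have := congrArg re h; simp at this; linarith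
  have h2 : ‖DirichletCharacter.LFunction (χ ^ 2) (1 + x + 2 * (I * t))‖
      ≤ C * (2 * Q ^ (2 * ε)) * (2 / τ) := by
    refine (h q (χ ^ 2) (1 + x + 2 * (I * t)) (Or.inl ?_) ?_ ?_).trans ?_
    · intro h; have := congrArg re h; rw [hre] at this; simp at this; linarith
    · rw [hre]; linarith
    · rw [hre]; linarith
    have hc : conductor q (1 + x + 2 * (I * t)) ^ (2 * ε) ≤ 2 * Q ^ (2 * ε) := by
      calc conductor q (1 + x + 2 * (I * t)) ^ (2 * ε) ≤ (2 * Q) ^ (2 * ε) := by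
            gcongr
            · exact (conductor_pos _ _).le
            · rw [conductor, him, abs_mul, abs_two, hQ]
              nlinarith [abs_nonneg t]
        _ = 2 ^ (2 * ε) * Q ^ (2 * ε) := Real.mul_rpow (by norm_num) (by linarith)
        _ ≤ 2 ^ (1 : ℝ) * Q ^ (2 * ε) := by gcongr <;> linarith
        _ = _ := by simp
    have h1τ : 1 ≤ 1 / τ := by rwa [le_div_iff₀ hτ, one_mul]
    have hpole : ‖charMean (χ ^ 2)‖ / ‖(1 + x + 2 * (I * t) : ℂ) - 1‖ ≤ 1 / τ := by
      rcases hχ with hχ | hχ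
      · rw [charMean_eq_zero hχ]; simp; positivity
      · gcongr
        · exact norm_charMean_le _
        · refine hχ.trans ?_
          have e : (1 + x + 2 * (I * t) : ℂ) - 1 = (x : ℂ) + ((2 * t : ℝ) : ℂ) * I := by push_cast; ring
          rw [e, norm_add_mul_I, norm_add_mul_I]
          apply Real.sqrt_le_sqrt
          nlinarith [sq_nonneg t]
    gcongr
    calc _ ≤ 1 / τ + 1 / τ := by linarith
      _ = _ := by ring
  have harg : (1 + x + t * I : ℂ) = 1 + x + I * t := by ring
  rw [harg]
  set L := ‖DirichletCharacter.LFunction χ (1 + x + I * t)‖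
  have hP : 0 < Q ^ (2 * ε) := by positivity
  set P := Q ^ (2 * ε)
  have h3 : 1 ≤ (C * P * (2 / x)) ^ 3 * L ^ 4 * (C * (2 * P) * (2 / τ)) := by
    refine key.trans ?_
    have : (1 + x + 2 * I * t : ℂ) = 1 + x + 2 * (I * t) := by ring
    rw [this]
    gcongr
  have h4 : (C * P * (2 / x)) ^ 3 * L ^ 4 * (C * (2 * P) * (2 / τ)) * (x ^ 3 * τ) = 32 * (C * P * L) ^ 4 := by
    field_simp; ring
  have h5 : x ^ 3 * τ ≤ 32 * (C * P * L) ^ 4 := by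
    rw [← h4]; exact le_mul_of_one_le_left (by positivity) h3
  have h6 : (3 * C * P * L) ^ 4 = 81 * (C * P * L) ^ 4 := by ring
  have : 0 ≤ (C * P * L) ^ 4 := by positivity
  linarith

theorem exists_norm_LFunction_ge_mul {ε : ℝ} (hε : 0 < ε) (hε' : ε ≤ 1 / 4) :
    ∃ c : ℝ, 0 < c ∧ ∀ (q : ℕ) [NeZero q] (χ : DirichletCharacter ℂ q) (s : ℂ) (τ : ℝ),
      AwayFromPole χ s → 1 < s.re → s.re ≤ 2 → 0 < τ → τ ≤ 1 → (χ ^ 2 ≠ 1 ∨ τ ≤ ‖s - 1‖) →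
      c * conductor q s ^ (-(14 * ε)) * τ ≤ ‖DirichletCharacter.LFunction χ s‖ := by
  obtain ⟨C, hC, h⟩ := exists_norm_LFunction_pow_four_ge hε hε'
  obtain ⟨D, hD, hd⟩ := exists_norm_LFunction_sub_le hε hε'
  set K := 6 * C * D + 2 with hK
  have hK2 : 2 ≤ K := by simp only [hK]; linarith [mul_pos (mul_pos (by norm_num : (0:ℝ) < 6) hC) hD]
  refine ⟨1 / (6 * C * K ^ 3), by positivity, fun q _ χ s τ hs h1 h2 hτ hτ1 hχ => ?_⟩
  have hq : (1 : ℝ) ≤ q := by exact_mod_cast NeZero.one_le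
  set Q := conductor q s with hQdef
  have hQ : 1 ≤ Q := by linarith [two_le_conductor q s]
  set P := Q ^ (2 * ε) with hP
  have hP1 : 1 ≤ P := Real.one_le_rpow hQ (by positivity)
  set y := 1 / (K * P ^ 2) with hy
  have hy0 : 0 < y := by positivity
  have hy2 : y ≤ 1 / 2 := by
    rw [hy]; gcongr
    nlinarith [one_le_pow₀ hP1 (n := 2)]
  have hP14 : Q ^ (-(14 * ε)) = (P ^ 7)⁻¹ := by
    rw [hP, ← Real.rpow_natCast, ← Real.rpow_mul (by linarith), ← Real.rpow_neg (by linarith)]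
    congr 1; push_cast; ring
  have hgoal : 1 / (6 * C * K ^ 3) * Q ^ (-(14 * ε)) * τ = y ^ 3 * τ / (6 * C * P) := by
    rw [hP14, hy]; field_simp
  rw [hgoal]
  have hmain : ∀ x : ℝ, y ^ 4 * τ ≤ x → s.re - 1 ≤ x → x ≤ 1 →
      y ^ 3 * τ / (C * P) ≤ ‖DirichletCharacter.LFunction χ (1 + x + s.im * I)‖ := by
    intro x hx1 hx2 hx3
    have hx0 : 0 < x := by linarith
    have h3 := h q χ s.im x τ hx0 hx3 hτ hτ1 (hχ.imp_right fun h => h.trans ?_)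
    · have e : s - 1 = ((s.re - 1 : ℝ) : ℂ) + (s.im : ℂ) * I := by
        apply Complex.ext <;> simp
      rw [e, norm_add_mul_I, norm_add_mul_I]
      apply Real.sqrt_le_sqrt
      nlinarith
    · rw [div_le_iff₀' (by positivity)]
      have h4 : (y ^ 3 * τ) ^ 4 ≤ x ^ 3 * τ := by
        calc (y ^ 3 * τ) ^ 4 = (y ^ 4 * τ) ^ 3 * τ := by ring
          _ ≤ _ := by gcongr
      exact le_of_pow_le_pow_left₀ (by norm_num) (by positivity) (h4.trans h3)
  have hy4 : y ^ 4 * τ ≤ 1 / 16 := by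
    calc y ^ 4 * τ ≤ (1 / 2) ^ 4 * 1 := by gcongr
      _ = _ := by norm_num
  have h6 : y ^ 3 * τ / (6 * C * P) = y ^ 3 * τ / (C * P) / 6 := by field_simp
  have hpos : 0 < y ^ 3 * τ / (C * P) := by positivity
  rcases le_total (y ^ 4 * τ) (s.re - 1) with hle | hle
  · have h3 := hmain (s.re - 1) hle le_rfl (by linarith)
    have e : (1 + ((s.re - 1 : ℝ) : ℂ) + s.im * I) = s := by apply Complex.ext <;> simp
    rw [e] at h3
    rw [h6]; linarith
  · have h3 := hmain (y ^ 4 * τ) le_rfl hle (by linarith)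
    set w : ℂ := 1 + ((y ^ 4 * τ : ℝ) : ℂ) + s.im * I with hw
    have hwre : w.re = 1 + y ^ 4 * τ := by simp [hw, -ofReal_mul, -ofReal_pow]
    have hws : w - s = ((y ^ 4 * τ - (s.re - 1) : ℝ) : ℂ) := by
      apply Complex.ext
      · rw [sub_re, hwre, ofReal_re]; ring
      · rw [sub_im, ofReal_im]; simp [hw, -ofReal_mul, -ofReal_pow]
    have hnorm : ‖w - s‖ ≤ y ^ 4 * τ := by
      rw [hws, norm_real, Real.norm_eq_abs, abs_of_nonneg (by linarith)]; linarith
    have hpos4 : 0 < y ^ 4 * τ := by positivity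
    have h4 := hd q χ s w hs (by linarith) (by linarith) (by linarith) (by linarith) (by linarith)
    have h5 : D * P * ‖w - s‖ ≤ y ^ 3 * τ / (C * P) / 6 := by
      calc D * P * ‖w - s‖ ≤ D * P * (y ^ 4 * τ) := by gcongr
        _ = y ^ 3 * τ / P * (D / K) := by
            have : y ^ 4 = y ^ 3 * (1 / (K * P ^ 2)) := by rw [pow_succ]
            rw [this]; field_simp
        _ ≤ y ^ 3 * τ / P * (1 / (6 * C)) := by
            refine mul_le_mul_of_nonneg_left ?_ (by positivity)
            rw [div_le_div_iff₀ (by positivity) (by positivity), hK]; linarith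
        _ = _ := by field_simp
    have h7 := norm_sub_norm_le (DirichletCharacter.LFunction χ w) (DirichletCharacter.LFunction χ s)
    rw [h6]; linarith

/-- The entire function `(s - 1) ζ(s)`. -/
noncomputable def zetaEntire : ℂ → ℂ := DirichletCharacter.LFunctionTrivChar₁ 1

lemma differentiable_zetaEntire : Differentiable ℂ zetaEntire :=
  DirichletCharacter.differentiable_LFunctionTrivChar₁ 1

lemma zetaEntire_one : zetaEntire 1 = 1 := by
  simp [zetaEntire, DirichletCharacter.LFunctionTrivChar₁]

lemma zetaEntire_of_ne_one {s : ℂ} (hs : s ≠ 1) : zetaEntire s = (s - 1) * riemannZeta s := by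
  rw [zetaEntire, DirichletCharacter.LFunctionTrivChar₁, Function.update_of_ne hs,
    DirichletCharacter.LFunctionTrivChar, DirichletCharacter.LFunction_modOne_eq]

section Estermann

open scoped ComplexOrder

variable {K : ℂ → ℂ} {a : ℕ → ℂ}

/-- The entire function `ζ(s) K(s) - K(1) / (s - 1)`. -/
noncomputable def poleFree (K : ℂ → ℂ) : ℂ → ℂ := dslope (fun s => zetaEntire s * K s) 1

lemma differentiable_poleFree (hK : Differentiable ℂ K) : Differentiable ℂ (poleFree K) := by
  rw [← differentiableOn_univ, poleFree, differentiableOn_dslope Filter.univ_mem]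
  exact (differentiable_zetaEntire.mul hK).differentiableOn

lemma poleFree_of_ne_one {s : ℂ} (hs : s ≠ 1) :
    poleFree K s = riemannZeta s * K s - K 1 * (1 * s - 1)⁻¹ := by
  have h : s - 1 ≠ 0 := sub_ne_zero.2 hs
  rw [poleFree, dslope_of_ne _ hs, slope_def_field, zetaEntire_one, zetaEntire_of_ne_one hs, one_mul]
  field_simp

lemma iteratedDeriv_poleFree_two (hK : Differentiable ℂ K)
    (haK : ∀ s : ℂ, 1 < s.re → LSeries a s = riemannZeta s * K s) (m : ℕ) :
    iteratedDeriv m (poleFree K) 2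
      = iteratedDeriv m (LSeries a) 2 - K 1 * ((-1) ^ m * m.factorial) := by
  have hset : {s : ℂ | 1 < s.re} ∈ 𝓝 (2 : ℂ) :=
    (isOpen_lt continuous_const continuous_re).mem_nhds (by simp)
  have hG : LSeries a =ᶠ[𝓝 2] (poleFree K + fun s => K 1 * (1 * s - 1)⁻¹) := by
    filter_upwards [hset] with s hs
    have h1 : s ≠ 1 := by rintro rfl; simp at hs
    rw [Pi.add_apply, poleFree_of_ne_one h1, haK s hs]; ring
  have hinv : ContDiffAt ℂ m (fun s : ℂ => K 1 * (1 * s - 1)⁻¹) 2 := by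
    refine contDiffAt_const.mul (ContDiffAt.inv (by fun_prop) (by norm_num))
  rw [hG.iteratedDeriv_eq, iteratedDeriv_add (differentiable_poleFree hK).contDiff.contDiffAt hinv,
    iteratedDeriv_const_mul_field, iteratedDeriv_eq_iterate (f := fun s : ℂ => (1 * s - 1)⁻¹),
    iter_deriv_inv_linear_sub]
  norm_num

theorem exists_norm_apply_one_ge : ∃ c : ℝ, 0 < c ∧ ∀ (K : ℂ → ℂ) (a : ℕ → ℂ) (M β : ℝ),
    Differentiable ℂ K → 0 ≤ a → 1 ≤ a 1 → LSeries.abscissaOfAbsConv a ≤ 1 →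
    (∀ s : ℂ, 1 < s.re → LSeries a s = riemannZeta s * K s) → 1 ≤ M →
    (∀ s : ℂ, ‖s - 2‖ ≤ 3 / 2 → ‖K s‖ ≤ M) → 7 / 8 ≤ β → β < 1 →
    (riemannZeta β * K β).re ≤ 0 → c * (1 - β) * M ^ (-(4 * (1 - β))) ≤ ‖K 1‖ := by
  obtain ⟨Z, hZ⟩ := (isCompact_closedBall (2 : ℂ) (3 / 2)).exists_bound_of_continuousOn
    differentiable_zetaEntire.continuous.continuousOn
  have hZ0 : 0 ≤ Z := (norm_nonneg _).trans (hZ 2 (Metric.mem_closedBall_self (by norm_num)))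
  set Z' := 2 * (Z + 1) with hZ'
  refine ⟨1 / (2 * (3 * (8 * Z'))), by positivity, fun K a M β hK ha0 ha1 ha haK hM hKM hβ hβ1 hF => ?_⟩
  have h12 : (1 : EReal) < ((2 : ℝ) : EReal) := by exact_mod_cast one_lt_two
  set lam := ‖K 1‖ with hlam
  set M' := Z' * M with hM'
  have hM'2 : 2 ≤ M' := by nlinarith
  set u := 2 - β with hu
  have hu1 : 1 < u := by linarith
  have hlam0 : 0 ≤ lam := norm_nonneg _
  set G := poleFree K with hG
  have hGd := differentiable_poleFree hK
  have hlamM : lam ≤ M := hKM 1 (by norm_num)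
  have hGb : ∀ s ∈ Metric.sphere (2 : ℂ) (3 / 2), ‖G s‖ ≤ M' := by
    intro s hs
    rw [mem_sphere_iff_norm] at hs
    have h1 : 1 / 2 ≤ ‖s - 1‖ := by
      have := norm_sub_norm_le (s - 2) (-1 : ℂ)
      rw [hs] at this; norm_num at this
      have e : s - 2 + 1 = s - 1 := by ring
      rw [e] at this; linarith
    have hs1 : s ≠ 1 := by rintro rfl; norm_num at h1
    rw [hG, poleFree, dslope_of_ne _ hs1, slope_def_field, norm_div, div_le_iff₀ (by linarith),
      zetaEntire_one, one_mul]
    have hz := hZ s (by rw [Metric.mem_closedBall, dist_eq_norm]; exact hs.le)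
    have hk := hKM s hs.le
    calc ‖zetaEntire s * K s - K 1‖ ≤ Z * M + M := by
          refine (norm_sub_le _ _).trans ?_
          rw [norm_mul]; gcongr
      _ = M' * (1 / 2) := by rw [hM', hZ']; ring
      _ ≤ _ := by gcongr
  set t : ℕ → ℂ := fun m => (m.factorial : ℂ)⁻¹ • ((β : ℂ) - 2) ^ m • iteratedDeriv m G 2 with ht
  have hsum : HasSum t (G β) := hasSum_taylorSeries_of_entire hGd 2 β
  have hβ2 : (β : ℂ) - 2 = ((-u : ℝ) : ℂ) := by rw [hu]; push_cast; ring
  have htn : ∀ m, ‖t m‖ ≤ M' * (3 / 4) ^ m := by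
    intro m
    have hfac : (0 : ℝ) < m.factorial := by positivity
    have h1 := norm_iteratedDeriv_le_of_forall_mem_sphere_norm_le m (by norm_num)
      hGd.diffContOnCl hGb
    simp only [ht, norm_smul, norm_inv, norm_pow, hβ2, Complex.norm_natCast, norm_real, norm_neg,
      Real.norm_eq_abs, abs_of_pos (by linarith : 0 < u)]
    calc (m.factorial : ℝ)⁻¹ * (u ^ m * ‖iteratedDeriv m G 2‖)
        ≤ (m.factorial : ℝ)⁻¹ * ((9 / 8) ^ m * (m.factorial * M' / (3 / 2) ^ m)) := by
          gcongr; linarith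
      _ = M' * ((9 / 8) ^ m / (3 / 2) ^ m) := by field_simp
      _ = M' * (3 / 4) ^ m := by rw [← div_pow]; norm_num
  have htre : ∀ m, (if m = 0 then 1 else 0) - lam * u ^ m ≤ (t m).re := by
    intro m
    have hb := LSeries.iteratedDeriv_alternating ha0 (x := 2)
      (lt_of_le_of_lt ha h12) m
    have hfac : (0 : ℝ) < m.factorial := by positivity
    set b := (-1) ^ m * iteratedDeriv m (LSeries a) ((2 : ℝ) : ℂ) with hbdef
    have e : t m = ((u ^ m / m.factorial : ℝ) : ℂ) * b - ((u ^ m : ℝ) : ℂ) * K 1 := by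
      simp only [ht, smul_eq_mul]
      rw [hG, iteratedDeriv_poleFree_two hK haK, hβ2, hbdef]
      have : (m.factorial : ℂ) ≠ 0 := by positivity
      have h1 : ((-u : ℝ) : ℂ) ^ m = (-1) ^ m * (u : ℂ) ^ m := by rw [← mul_pow]; simp
      have h2 : ((-1 : ℂ) ^ m) ^ 2 = 1 := by rw [← pow_mul, mul_comm, pow_mul]; simp
      rw [h1]; push_cast
      field_simp
      linear_combination (-(m.factorial : ℂ) * K 1) * h2
    rw [e, sub_re, re_ofReal_mul, re_ofReal_mul]
    have hK1 : (K 1).re ≤ lam := re_le_norm _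
    have hup : 0 < u ^ m := by positivity
    have hbre : 0 ≤ b.re := (Complex.le_def.1 hb).1
    have h3 : (if m = 0 then (1 : ℝ) else 0) ≤ u ^ m / m.factorial * b.re := by
      split_ifs with h
      · subst h
        simp only [pow_zero, Nat.factorial_zero, Nat.cast_one, div_one, one_mul, hbdef,
          iteratedDeriv_zero]
        have hs : LSeriesSummable a ((2 : ℝ) : ℂ) :=
          LSeriesSummable_of_abscissaOfAbsConv_lt_re (lt_of_le_of_lt ha h12)
        rw [LSeries, Complex.re_tsum hs]
        have hs' : Summable (fun n => (LSeries.term a ((2 : ℝ) : ℂ) n).re) :=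
          Complex.reCLM.summable hs
        have h1 : (1 : ℝ) ≤ (LSeries.term a ((2 : ℝ) : ℂ) 1).re := by
          rw [LSeries.term_of_ne_zero one_ne_zero]
          simpa using (Complex.le_def.1 ha1).1
        refine h1.trans (hs'.le_tsum 1 fun n _ => ?_)
        exact (Complex.le_def.1 (LSeries.term_nonneg (ha0 n) 2)).1
      · positivity
    nlinarith
  obtain ⟨m₀, hm₀⟩ : ∃ m₀, m₀ = ⌈4 * Real.log (8 * M')⌉₊ := ⟨_, rfl⟩
  have hlog : 0 < Real.log (8 * M') := Real.log_pos (by linarith)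
  have hm1 : 4 * Real.log (8 * M') ≤ m₀ := by rw [hm₀]; exact Nat.le_ceil _
  have hm2 : m₀ ≤ 4 * Real.log (8 * M') + 1 := by
    rw [hm₀]; exact (Nat.ceil_lt_add_one (by positivity)).le
  have hm0 : 0 < m₀ := by
    have : (0 : ℝ) < m₀ := by linarith
    exact_mod_cast this
  have htail : M' * (3 / 4) ^ m₀ ≤ 1 / 8 := by
    have h1 : Real.exp (1 / 4) ≤ 4 / 3 := by
      rw [← Real.exp_log (show (0:ℝ) < 4 / 3 by norm_num)]
      gcongr
      have := Real.one_sub_inv_le_log_of_pos (show (0:ℝ) < 4 / 3 by norm_num)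
      norm_num at this ⊢; linarith
    have h2 : 8 * M' ≤ (4 / 3) ^ m₀ := by
      calc 8 * M' = Real.exp (Real.log (8 * M')) := (Real.exp_log (by linarith)).symm
        _ ≤ Real.exp (m₀ * (1 / 4)) := by gcongr; linarith
        _ = Real.exp (1 / 4) ^ m₀ := Real.exp_nat_mul _ _
        _ ≤ _ := by gcongr
    have h3 : ((3 : ℝ) / 4) ^ m₀ = ((4 / 3) ^ m₀)⁻¹ := by rw [← inv_pow]; norm_num
    rw [h3, ← div_eq_mul_inv, div_le_iff₀ (by positivity)]
    linarith
  have hGre : 1 / 2 - lam * ((u ^ m₀ - 1) / (u - 1)) ≤ (G β).re := by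
    rw [← hsum.tsum_eq, ← hsum.summable.sum_add_tsum_nat_add m₀, add_re, re_sum]
    have h1 : 1 - lam * ((u ^ m₀ - 1) / (u - 1)) ≤ ∑ m ∈ Finset.range m₀, (t m).re := by
      refine le_trans (le_of_eq ?_) (Finset.sum_le_sum fun m _ => htre m)
      rw [Finset.sum_sub_distrib, ← Finset.mul_sum, geom_sum_eq (by linarith)]
      simp [hm0]
    have hgeo : HasSum (fun m : ℕ => M' * (3 / 4) ^ (m + m₀)) (M' * (3 / 4) ^ m₀ * 4) := by
      have := (hasSum_geometric_of_lt_one (r := (3:ℝ) / 4) (by norm_num) (by norm_num)).mul_left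
        (M' * (3 / 4) ^ m₀)
      have e : (fun m : ℕ => M' * (3 / 4) ^ (m + m₀)) = fun m => M' * (3 / 4) ^ m₀ * (3 / 4) ^ m :=
        funext fun m => by rw [pow_add]; ring
      rw [e]
      norm_num at this ⊢
      exact this
    have h2 := tsum_of_norm_bounded hgeo (fun m => htn (m + m₀))
    have h3 := (abs_le.1 ((abs_re_le_norm _).trans h2)).1
    linarith
  have hβne : (β : ℂ) ≠ 1 := by exact_mod_cast hβ1.ne
  have hGle : (G β).re ≤ lam / (1 - β) := by
    rw [hG, poleFree_of_ne_one hβne, sub_re]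
    have e : (1 * (β : ℂ) - 1)⁻¹ = (((β - 1)⁻¹ : ℝ) : ℂ) := by push_cast; ring_nf
    rw [e, re_mul_ofReal]
    have h1 : -((K 1).re * (β - 1)⁻¹) = (K 1).re / (1 - β) := by
      rw [← neg_sub, inv_neg]; field_simp
    have h2 : (K 1).re / (1 - β) ≤ lam / (1 - β) := by
      have : 0 ≤ 1 - β := by linarith
      gcongr
      exact re_le_norm _
    linarith
  have hmain : (1 - β) / 2 ≤ lam * u ^ m₀ := by
    have h1 : u - 1 = 1 - β := by rw [hu]; ring
    have h2 : 0 < 1 - β := by linarith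
    rw [h1] at hGre
    have h3 : 1 / 2 ≤ lam * u ^ m₀ / (1 - β) := by
      have : lam * u ^ m₀ / (1 - β) = lam * ((u ^ m₀ - 1) / (1 - β)) + lam / (1 - β) := by
        field_simp; ring
      linarith
    rw [le_div_iff₀ h2] at h3
    linarith
  have hum : u ^ m₀ ≤ 3 * (8 * Z') * M ^ (4 * (1 - β)) := by
    have h2 : 0 < 1 - β := by linarith
    have hZ2 : 1 ≤ 8 * Z' := by linarith
    calc u ^ m₀ ≤ Real.exp (1 - β) ^ m₀ := by
          gcongr
          have := Real.add_one_le_exp (1 - β)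
          linarith
      _ = Real.exp (m₀ * (1 - β)) := (Real.exp_nat_mul _ _).symm
      _ ≤ Real.exp (1 + Real.log (8 * M') * (4 * (1 - β))) := by gcongr; nlinarith
      _ = Real.exp 1 * (8 * M') ^ (4 * (1 - β)) := by
          rw [Real.exp_add, Real.rpow_def_of_pos (by linarith)]
      _ = Real.exp 1 * ((8 * Z') ^ (4 * (1 - β)) * M ^ (4 * (1 - β))) := by
          rw [hM', ← mul_assoc, Real.mul_rpow (by linarith) (by linarith)]
      _ ≤ 3 * ((8 * Z') ^ (1 : ℝ) * M ^ (4 * (1 - β))) := by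
          gcongr
          · linarith [Real.exp_one_lt_d9]
          · linarith
      _ = _ := by rw [Real.rpow_one]; ring
  have hMpos : 0 < M ^ (4 * (1 - β)) := by positivity
  rw [Real.rpow_neg (by linarith), ← div_eq_mul_inv, div_le_iff₀ hMpos]
  have h9 : 0 < 3 * (8 * Z') := by positivity
  have : (1 - β) / 2 ≤ lam * (3 * (8 * Z') * M ^ (4 * (1 - β))) :=
    hmain.trans (by gcongr)
  calc 1 / (2 * (3 * (8 * Z'))) * (1 - β) = (1 - β) / 2 / (3 * (8 * Z')) := by field_simp
    _ ≤ lam * (3 * (8 * Z') * M ^ (4 * (1 - β))) / (3 * (8 * Z')) := by gcongr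
    _ = _ := by
      have : Z' ≠ 0 := by linarith
      field_simp

end Estermann

section Coefficients

open scoped ComplexOrder ArithmeticFunction.vonMangoldt

/-- `g` is the coefficient sequence of minus the logarithmic derivative of the Dirichlet series
with coefficients `f`. -/
def IsLogDeriv (f g : ArithmeticFunction ℂ) : Prop := ∀ n : ℕ, (Real.log n : ℂ) * f n = (g * f) n

lemma IsLogDeriv.mul {f₁ f₂ g₁ g₂ : ArithmeticFunction ℂ} (h₁ : IsLogDeriv f₁ g₁)
    (h₂ : IsLogDeriv f₂ g₂) : IsLogDeriv (f₁ * f₂) (g₁ + g₂) := by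
  intro n
  have e : (g₁ + g₂) * (f₁ * f₂) = (g₁ * f₁) * f₂ + f₁ * (g₂ * f₂) := by ring
  rw [e, ArithmeticFunction.add_apply, ArithmeticFunction.mul_apply, ArithmeticFunction.mul_apply,
    ArithmeticFunction.mul_apply, Finset.mul_sum, ← Finset.sum_add_distrib]
  refine Finset.sum_congr rfl fun x hx => ?_
  obtain ⟨hx, hn⟩ := Nat.mem_divisorsAntidiagonal.1 hx
  have h1 : x.1 ≠ 0 := by rintro h; simp [h] at hx; exact hn hx.symm
  have h2 : x.2 ≠ 0 := by rintro h; simp [h] at hx; exact hn hx.symm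
  rw [← h₁ x.1, ← h₂ x.2, ← hx, Nat.cast_mul, Real.log_mul (by exact_mod_cast h1)
    (by exact_mod_cast h2)]
  push_cast; ring

lemma IsLogDeriv.nonneg {f g : ArithmeticFunction ℂ} (h : IsLogDeriv f g) (h1 : f 1 = 1)
    (hg : ∀ n, 0 ≤ g n) (n : ℕ) : 0 ≤ f n := by
  have hg1 : g 1 = 0 := by simpa [h1] using (h 1).symm
  induction n using Nat.strong_induction_on with
  | _ n ih =>
    rcases Nat.lt_or_ge n 2 with hn | hn
    · interval_cases n <;> simp [h1]
    · have hlog : 0 < Real.log n := Real.log_pos (by exact_mod_cast hn)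
      have key : 0 ≤ (Real.log n : ℂ) * f n := by
        rw [h n, ArithmeticFunction.mul_apply]
        refine Finset.sum_nonneg fun x hx => ?_
        obtain ⟨hx, hn0⟩ := Nat.mem_divisorsAntidiagonal.1 hx
        rcases eq_or_ne x.1 1 with h1 | h1
        · simp [h1, hg1]
        · refine mul_nonneg (hg _) (ih _ ?_)
          rw [← hx]
          have : x.2 ≠ 0 := by rintro h; simp [h] at hx; omega
          have : x.1 ≠ 0 := by rintro h; simp [h] at hx; omega
          exact lt_mul_left (by omega) (by omega)
      have h3 : f n = ((Real.log n)⁻¹ : ℝ) * ((Real.log n : ℂ) * f n) := by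
        push_cast
        rw [inv_mul_cancel_left₀ (by exact_mod_cast hlog.ne')]
      rw [h3]
      exact mul_nonneg (by exact_mod_cast (inv_pos.2 hlog).le) key

/-- The arithmetic function `n ↦ χ n` for `n ≠ 0`. -/
noncomputable def charFun {q : ℕ} (χ : DirichletCharacter ℂ q) : ArithmeticFunction ℂ :=
  toArithmeticFunction (χ ·)

lemma charFun_apply {q : ℕ} (χ : DirichletCharacter ℂ q) {n : ℕ} (hn : n ≠ 0) :
    charFun χ n = χ n := by
  simp [charFun, toArithmeticFunction, hn]

/-- The arithmetic function `n ↦ χ n Λ n`. -/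
noncomputable def charVonMangoldt {q : ℕ} (χ : DirichletCharacter ℂ q) : ArithmeticFunction ℂ :=
  ⟨fun n => χ n * (Λ n : ℂ), by simp⟩

lemma charVonMangoldt_apply {q : ℕ} (χ : DirichletCharacter ℂ q) (n : ℕ) :
    charVonMangoldt χ n = χ n * (Λ n : ℂ) := rfl

lemma isLogDeriv_charFun {q : ℕ} (χ : DirichletCharacter ℂ q) :
    IsLogDeriv (charFun χ) (charVonMangoldt χ) := by
  intro n
  rcases eq_or_ne n 0 with rfl | hn
  · simp
  rw [ArithmeticFunction.mul_apply, charFun_apply _ hn, ← ArithmeticFunction.vonMangoldt_sum,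
    ← Nat.sum_divisorsAntidiagonal (f := fun i _ => Λ i)]
  push_cast
  rw [Finset.sum_mul]
  refine Finset.sum_congr rfl fun x hx => ?_
  obtain ⟨hx, hn⟩ := Nat.mem_divisorsAntidiagonal.1 hx
  have h2 : x.2 ≠ 0 := by rintro h; simp [h] at hx; exact hn hx.symm
  rw [charFun_apply _ h2, charVonMangoldt_apply, ← hx]
  push_cast
  rw [map_mul]; ring

lemma charFun_one {q : ℕ} (χ : DirichletCharacter ℂ q) : charFun χ 1 = 1 := by
  simp [charFun_apply]

lemma LSeries_charFun {q : ℕ} [NeZero q] (χ : DirichletCharacter ℂ q) {s : ℂ} (hs : 1 < s.re) :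
    LSeries (charFun χ) s = DirichletCharacter.LFunction χ s := by
  rw [DirichletCharacter.LFunction_eq_LSeries _ hs]
  exact LSeries_congr (fun {n} hn => charFun_apply χ hn) s

lemma LSeriesSummable_charFun {q : ℕ} [NeZero q] (χ : DirichletCharacter ℂ q) {s : ℂ}
    (hs : 1 < s.re) : LSeriesSummable (charFun χ) s := by
  refine LSeriesSummable_of_bounded_of_one_lt_re (m := 1) (fun n hn => ?_) hs
  rw [charFun_apply _ hn]; exact χ.norm_le_one _

/-- The coefficients of `ζ(s) L(s, χ₁) L(s, χ₂) L(s, χ₁ χ₂)`. -/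
noncomputable def quadCoeff {q : ℕ} (χ₁ χ₂ : DirichletCharacter ℂ q) : ArithmeticFunction ℂ :=
  (charFun (1 : DirichletCharacter ℂ 1) * charFun χ₁) * (charFun χ₂ * charFun (χ₁ * χ₂))

variable {q : ℕ} {χ₁ χ₂ : DirichletCharacter ℂ q}

lemma quadCoeff_one : quadCoeff χ₁ χ₂ 1 = 1 := by
  simp [quadCoeff, charFun_one, ArithmeticFunction.mul_apply]

lemma quadCoeff_nonneg (h₁ : χ₁ ^ 2 = 1) (h₂ : χ₂ ^ 2 = 1) (n : ℕ) : 0 ≤ quadCoeff χ₁ χ₂ n := by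
  refine (((isLogDeriv_charFun (1 : DirichletCharacter ℂ 1)).mul (isLogDeriv_charFun χ₁)).mul
    ((isLogDeriv_charFun χ₂).mul (isLogDeriv_charFun (χ₁ * χ₂)))).nonneg quadCoeff_one
    (fun n => ?_) n
  have h : (1 : DirichletCharacter ℂ 1) (n : ZMod 1) = 1 :=
    MulChar.one_apply (isUnit_of_subsingleton _)
  simp only [ArithmeticFunction.add_apply, charVonMangoldt_apply, MulChar.mul_apply, h]
  have e : 1 * (Λ n : ℂ) + χ₁ n * (Λ n : ℂ) + (χ₂ n * (Λ n : ℂ) + χ₁ n * χ₂ n * (Λ n : ℂ))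
      = (1 + χ₁ n) * (1 + χ₂ n) * (Λ n : ℂ) := by ring
  have aux : ∀ χ : DirichletCharacter ℂ q, χ ^ 2 = 1 → 0 ≤ 1 + χ n := by
    intro χ hχ
    rcases MulChar.isQuadratic_iff_sq_eq_one.mpr hχ n with h | h | h <;> rw [h] <;> norm_num
  rw [e]
  exact mul_nonneg (mul_nonneg (aux _ h₁) (aux _ h₂))
    (by exact_mod_cast ArithmeticFunction.vonMangoldt_nonneg)

lemma LSeriesSummable_quadCoeff [NeZero q] {s : ℂ} (hs : 1 < s.re) :
    LSeriesSummable (quadCoeff χ₁ χ₂) s :=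
  ArithmeticFunction.LSeriesSummable_mul
    (ArithmeticFunction.LSeriesSummable_mul (LSeriesSummable_charFun _ hs)
      (LSeriesSummable_charFun _ hs))
    (ArithmeticFunction.LSeriesSummable_mul (LSeriesSummable_charFun _ hs)
      (LSeriesSummable_charFun _ hs))

lemma LSeries_quadCoeff [NeZero q] {s : ℂ} (hs : 1 < s.re) :
    LSeries (quadCoeff χ₁ χ₂) s = riemannZeta s * (DirichletCharacter.LFunction χ₁ s *
      (DirichletCharacter.LFunction χ₂ s * DirichletCharacter.LFunction (χ₁ * χ₂) s)) := by
  rw [quadCoeff, ArithmeticFunction.LSeries_mul'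
    (ArithmeticFunction.LSeriesSummable_mul (LSeriesSummable_charFun _ hs)
      (LSeriesSummable_charFun _ hs))
    (ArithmeticFunction.LSeriesSummable_mul (LSeriesSummable_charFun _ hs)
      (LSeriesSummable_charFun _ hs)),
    ArithmeticFunction.LSeries_mul' (LSeriesSummable_charFun _ hs) (LSeriesSummable_charFun _ hs),
    ArithmeticFunction.LSeries_mul' (LSeriesSummable_charFun _ hs) (LSeriesSummable_charFun _ hs),
    LSeries_charFun _ hs, LSeries_charFun _ hs, LSeries_charFun _ hs, LSeries_charFun _ hs,
    DirichletCharacter.LFunction_modOne_eq]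
  ring

lemma abscissaOfAbsConv_quadCoeff_le [NeZero q] :
    LSeries.abscissaOfAbsConv (quadCoeff χ₁ χ₂) ≤ 1 :=
  LSeries.abscissaOfAbsConv_le_of_forall_lt_LSeriesSummable fun y hy =>
    LSeriesSummable_quadCoeff (by simpa using hy)

/-- The coefficients of `ζ(s) L(s, χ)`. -/
noncomputable def zetaCoeff (χ : DirichletCharacter ℂ q) : ArithmeticFunction ℂ :=
  charFun (1 : DirichletCharacter ℂ 1) * charFun χ

lemma zetaCoeff_one : zetaCoeff χ₁ 1 = 1 := by
  simp [zetaCoeff, charFun_one, ArithmeticFunction.mul_apply]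

lemma zetaCoeff_nonneg (h₁ : χ₁ ^ 2 = 1) (n : ℕ) : 0 ≤ zetaCoeff χ₁ n := by
  refine ((isLogDeriv_charFun (1 : DirichletCharacter ℂ 1)).mul
    (isLogDeriv_charFun χ₁)).nonneg zetaCoeff_one (fun n => ?_) n
  have h : (1 : DirichletCharacter ℂ 1) (n : ZMod 1) = 1 :=
    MulChar.one_apply (isUnit_of_subsingleton _)
  simp only [ArithmeticFunction.add_apply, charVonMangoldt_apply, h]
  rw [← add_mul]
  refine mul_nonneg ?_ (by exact_mod_cast ArithmeticFunction.vonMangoldt_nonneg)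
  rcases MulChar.isQuadratic_iff_sq_eq_one.mpr h₁ n with h | h | h <;> rw [h] <;> norm_num

lemma LSeries_zetaCoeff [NeZero q] {s : ℂ} (hs : 1 < s.re) :
    LSeries (zetaCoeff χ₁) s = riemannZeta s * DirichletCharacter.LFunction χ₁ s := by
  rw [zetaCoeff, ArithmeticFunction.LSeries_mul' (LSeriesSummable_charFun _ hs)
    (LSeriesSummable_charFun _ hs), LSeries_charFun _ hs, LSeries_charFun _ hs,
    DirichletCharacter.LFunction_modOne_eq]

lemma abscissaOfAbsConv_zetaCoeff_le [NeZero q] :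
    LSeries.abscissaOfAbsConv (zetaCoeff χ₁) ≤ 1 :=
  LSeries.abscissaOfAbsConv_le_of_forall_lt_LSeriesSummable fun y hy =>
    ArithmeticFunction.LSeriesSummable_mul (LSeriesSummable_charFun _ (by simpa using hy))
      (LSeriesSummable_charFun _ (by simpa using hy))

end Coefficients

section RealValues

lemma im_LSeries_eq_zero {a : ℕ → ℂ} (ha : ∀ n, (a n).im = 0) (σ : ℝ) : (LSeries a σ).im = 0 := by
  rw [← conj_eq_iff_im, LSeries, conj_tsum]
  refine tsum_congr fun n => ?_
  rcases eq_or_ne n 0 with rfl | hn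
  · simp
  rw [LSeries.term_of_ne_zero hn, map_div₀, conj_eq_iff_im.2 (ha n),
    ← ofReal_natCast, ← ofReal_cpow (Nat.cast_nonneg n), conj_ofReal]

lemma im_apply_ofReal_eq_zero {f : ℂ → ℂ} (hf : Differentiable ℂ f)
    (h : ∀ σ : ℝ, 1 < σ → (f σ).im = 0) (σ : ℝ) : (f σ).im = 0 := by
  have hg : Differentiable ℂ (fun z => (starRingEnd ℂ) (f ((starRingEnd ℂ) z))) :=
    fun z => differentiableAt_conj_conj_iff.2 (hf _)
  have hfreq : ∃ᶠ z in 𝓝[≠] (2 : ℂ), (starRingEnd ℂ) (f ((starRingEnd ℂ) z)) = f z := by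
    have hev : ∀ᶠ σ : ℝ in 𝓝[≠] 2, (starRingEnd ℂ) (f ((starRingEnd ℂ) (σ : ℂ))) = f σ := by
      filter_upwards [mem_nhdsWithin_of_mem_nhds (lt_mem_nhds (show (1 : ℝ) < 2 by norm_num))]
        with σ hσ
      rw [conj_ofReal, conj_eq_iff_im]
      exact h σ hσ
    have ht : Tendsto (fun σ : ℝ => (σ : ℂ)) (𝓝[≠] 2) (𝓝[≠] 2) := by
      refine tendsto_nhdsWithin_iff.2 ⟨?_, ?_⟩
      · exact (Complex.continuous_ofReal.tendsto' 2 2 (by norm_num)).mono_left nhdsWithin_le_nhds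
      · filter_upwards [self_mem_nhdsWithin] with σ hσ
        simp only [mem_compl_iff, mem_singleton_iff] at hσ ⊢
        exact_mod_cast hσ
    exact ht.frequently hev.frequently
  have := AnalyticOnNhd.eq_of_frequently_eq
    (hg.differentiableOn.analyticOnNhd isOpen_univ) (hf.differentiableOn.analyticOnNhd isOpen_univ)
    hfreq
  have h2 := congrFun this σ
  simpa [conj_eq_iff_im] using h2

variable {q : ℕ} [NeZero q] {χ : DirichletCharacter ℂ q}

lemma im_LFunction_ofReal_eq_zero (h : χ ^ 2 = 1) (hχ : χ ≠ 1) (σ : ℝ) :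
    (DirichletCharacter.LFunction χ σ).im = 0 := by
  refine im_apply_ofReal_eq_zero (DirichletCharacter.differentiable_LFunction hχ) (fun σ hσ => ?_) σ
  rw [DirichletCharacter.LFunction_eq_LSeries _ (by simpa using hσ)]
  refine im_LSeries_eq_zero (fun n => ?_) σ
  rcases MulChar.isQuadratic_iff_sq_eq_one.mpr h n with h | h | h <;> rw [h] <;> simp

lemma re_LFunction_ofReal_nonneg (h : χ ^ 2 = 1) (hχ : χ ≠ 1) {β : ℝ}
    (hβ : ∀ σ : ℝ, β ≤ σ → σ < 1 → DirichletCharacter.LFunction χ σ ≠ 0) :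
    0 ≤ (DirichletCharacter.LFunction χ β).re := by
  by_contra! hneg
  have hlim : Tendsto (fun σ : ℝ => (DirichletCharacter.LFunction χ σ).re) atTop (𝓝 1) := by
    have habs : LSeries.abscissaOfAbsConv (χ ·) < ⊤ :=
      lt_of_le_of_lt (LSeries.abscissaOfAbsConv_le_of_forall_lt_LSeriesSummable (x := 1)
        fun y hy => DirichletCharacter.LSeriesSummable_of_one_lt_re χ (by simpa using hy))
        (EReal.coe_lt_top 1)
    have := (Complex.continuous_re.tendsto _).comp (LSeries.tendsto_atTop habs)
    simp only [Nat.cast_one, map_one, one_re] at this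
    refine this.congr' ?_
    filter_upwards [eventually_gt_atTop 1] with σ hσ
    simp only [Function.comp]
    rw [DirichletCharacter.LFunction_eq_LSeries _ (by simpa using hσ)]
  obtain ⟨σ₁, hσ₁, hσ₁'⟩ := ((hlim.eventually (lt_mem_nhds (show (0 : ℝ) < 1 by norm_num))).and
    (eventually_ge_atTop β)).exists
  have hcont : Continuous fun σ : ℝ => (DirichletCharacter.LFunction χ σ).re :=
    Complex.continuous_re.comp
      ((DirichletCharacter.differentiable_LFunction hχ).continuous.comp Complex.continuous_ofReal)
  obtain ⟨σ, hσ, hσ0⟩ := intermediate_value_Icc hσ₁' hcont.continuousOn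
    (show (0 : ℝ) ∈ Icc _ _ from ⟨hneg.le, hσ₁.le⟩)
  have hz : DirichletCharacter.LFunction χ σ = 0 :=
    Complex.ext hσ0 (im_LFunction_ofReal_eq_zero h hχ σ)
  rcases lt_or_ge σ 1 with h1 | h1
  · exact hβ σ hσ.1 h1 hz
  · exact DirichletCharacter.LFunction_ne_zero_of_one_le_re χ (.inl hχ) (by simpa using h1) hz

lemma exists_riemannZeta_re_nonpos : ∃ η : ℝ, 0 < η ∧ η ≤ 1 / 8 ∧ ∀ β : ℝ, 1 - η ≤ β → β < 1 →
    (riemannZeta β).re ≤ 0 ∧ (riemannZeta β).im = 0 := by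
  have hc : Continuous fun σ : ℝ => (zetaEntire σ).re :=
    Complex.continuous_re.comp
      (differentiable_zetaEntire.continuous.comp Complex.continuous_ofReal)
  have h1 : ∀ᶠ σ : ℝ in 𝓝 1, 0 < (zetaEntire σ).re :=
    hc.continuousAt.eventually_const_lt (by simp [zetaEntire_one])
  obtain ⟨r, hr, hball⟩ := Metric.eventually_nhds_iff.1 h1
  refine ⟨min (r / 2) (1 / 8), by positivity, min_le_right _ _, fun β hβ hβ1 => ?_⟩
  have him : (riemannZeta β).im = 0 := by
    rw [← conj_eq_iff_im, ← riemannZeta_conj, conj_ofReal]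
  refine ⟨?_, him⟩
  have h2 : 0 < (zetaEntire β).re := hball (by
    rw [Real.dist_eq, abs_lt]
    have := min_le_left (r / 2) (1 / 8)
    constructor <;> linarith)
  rw [zetaEntire_of_ne_one (by exact_mod_cast hβ1.ne)] at h2
  simp only [mul_re, sub_re, ofReal_re, one_re, him, mul_zero, sub_zero] at h2
  nlinarith

end RealValues

section EulerFactors

lemma prod_one_add_inv_le {S : Finset ℕ} (hS : ∀ p ∈ S, 2 ≤ p) :
    ∏ p ∈ S, (1 + (p : ℝ)⁻¹) ≤ S.card + 1 ∧ ((S.card : ℝ) + 1)⁻¹ ≤ ∏ p ∈ S, (1 - (p : ℝ)⁻¹) := by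
  induction S using Finset.induction_on_max with
  | empty => simp
  | insert m S hm ih =>
    have hmS : m ∉ S := fun h => lt_irrefl _ (hm m h)
    obtain ⟨h1, h2⟩ := ih fun p hp => hS p (Finset.mem_insert_of_mem hp)
    have hcard : S.card + 2 ≤ m := by
      have hsub : S ⊆ Finset.Ico 2 m := fun p hp =>
        Finset.mem_Ico.2 ⟨hS p (Finset.mem_insert_of_mem hp), hm p hp⟩
      have h3 := Finset.card_le_card hsub
      have h4 := hS m (Finset.mem_insert_self _ _)
      rw [Nat.card_Ico] at h3
      omega
    have hm' : (S.card : ℝ) + 2 ≤ m := by exact_mod_cast hcard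
    have hinv : (m : ℝ)⁻¹ ≤ ((S.card : ℝ) + 2)⁻¹ := inv_anti₀ (by positivity) hm'
    rw [Finset.prod_insert hmS, Finset.prod_insert hmS, Finset.card_insert_of_notMem hmS]
    have hn : (0 : ℝ) ≤ S.card := Nat.cast_nonneg _
    push_cast
    constructor
    · calc (1 + (m : ℝ)⁻¹) * ∏ p ∈ S, (1 + (p : ℝ)⁻¹)
          ≤ (1 + ((S.card : ℝ) + 2)⁻¹) * (S.card + 1) := by
            gcongr
        _ ≤ S.card + 1 + 1 := by
            have : ((S.card : ℝ) + 2)⁻¹ * (S.card + 1) ≤ 1 := by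
              rw [inv_mul_le_iff₀ (by positivity)]; linarith
            linarith
    · calc ((S.card : ℝ) + 1 + 1)⁻¹ = (1 - ((S.card : ℝ) + 2)⁻¹) * ((S.card : ℝ) + 1)⁻¹ := by
            field_simp; ring
        _ ≤ (1 - (m : ℝ)⁻¹) * ∏ p ∈ S, (1 - (p : ℝ)⁻¹) := by
            have : ((S.card : ℝ) + 2)⁻¹ ≤ 1 := inv_le_one_of_one_le₀ (by linarith)
            gcongr
            linarith

lemma card_primeFactors_add_one_le {Q : ℕ} (hQ : Q ≠ 0) {η : ℝ} (hη : 0 < η) (hη1 : η ≤ 1) :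
    (Q.primeFactors.card : ℝ) + 1 ≤ (η * Real.log 2)⁻¹ * (Q : ℝ) ^ η := by
  have h2 : (2 : ℝ) ^ Q.primeFactors.card ≤ Q := by
    have : 2 ^ Q.primeFactors.card ≤ Q := by
      rw [← Finset.prod_const]
      exact (Finset.prod_le_prod' fun p hp => (Nat.prime_of_mem_primeFactors hp).two_le).trans
        (Nat.le_of_dvd (Nat.pos_of_ne_zero hQ) (Nat.prod_primeFactors_dvd Q))
    exact_mod_cast this
  have hl : 0 < Real.log 2 := Real.log_pos one_lt_two
  have hl1 : Real.log 2 ≤ 1 := by have := Real.log_two_lt_d9; linarith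
  rw [le_inv_mul_iff₀ (by positivity)]
  have h3 : Real.exp (η * Real.log 2 * Q.primeFactors.card) ≤ (Q : ℝ) ^ η := by
    have : Real.exp (η * Real.log 2 * Q.primeFactors.card)
        = ((2 : ℝ) ^ Q.primeFactors.card) ^ η := by
      rw [Real.rpow_def_of_pos (by positivity), Real.log_pow]; ring_nf
    rw [this]
    gcongr
  have h4 := Real.add_one_le_exp (η * Real.log 2 * Q.primeFactors.card)
  have h5 : η * Real.log 2 ≤ 1 := by nlinarith
  nlinarith

lemma norm_eulerFactor_bounds {q : ℕ} (χ : DirichletCharacter ℂ q) (Q : ℕ) :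
    ‖∏ p ∈ Q.primeFactors, (1 - χ p * (p : ℂ) ^ (-1 : ℂ))‖ ≤ Q.primeFactors.card + 1 ∧
    ((Q.primeFactors.card : ℝ) + 1)⁻¹ ≤
      ‖∏ p ∈ Q.primeFactors, (1 - χ p * (p : ℂ) ^ (-1 : ℂ))‖ := by
  have h2 : ∀ p ∈ Q.primeFactors, 2 ≤ p := fun p hp => (Nat.prime_of_mem_primeFactors hp).two_le
  obtain ⟨h3, h4⟩ := prod_one_add_inv_le h2
  have hb : ∀ p : ℕ, ‖χ p * (p : ℂ) ^ (-1 : ℂ)‖ ≤ (p : ℝ)⁻¹ := fun p => by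
    rw [cpow_neg_one, norm_mul, norm_inv, Complex.norm_natCast]
    exact mul_le_of_le_one_left (by positivity) (χ.norm_le_one _)
  rw [norm_prod]
  constructor
  · refine (Finset.prod_le_prod (fun p _ => norm_nonneg _) fun p _ => ?_).trans h3
    refine (norm_sub_le _ _).trans ?_
    rw [norm_one]
    linarith [hb p]
  · refine h4.trans (Finset.prod_le_prod (fun p hp => ?_) fun p _ => ?_)
    · rw [sub_nonneg]
      exact inv_le_one_of_one_le₀ (by exact_mod_cast (by linarith [h2 p hp]))
    · have := norm_sub_norm_le (1 : ℂ) (χ p * (p : ℂ) ^ (-1 : ℂ))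
      rw [norm_one] at this
      linarith [hb p]

end EulerFactors

lemma norm_LFunction_le_mul {q : ℕ} [NeZero q] {χ : DirichletCharacter ℂ q} (hχ : χ ≠ 1) {s : ℂ}
    (hs : ‖s - 2‖ ≤ 3 / 2) : ‖DirichletCharacter.LFunction χ s‖ ≤ 22 * q := by
  have hq : (1 : ℝ) ≤ q := by exact_mod_cast NeZero.one_le
  have hre : 1 / 2 ≤ s.re := by
    have := (abs_re_le_norm (s - 2)).trans hs
    simp only [sub_re, re_ofNat, abs_le] at this
    linarith
  have hn : ‖s‖ ≤ 7 / 2 := by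
    calc ‖s‖ = ‖(s - 2) + 2‖ := by ring_nf
      _ ≤ ‖s - 2‖ + ‖(2 : ℂ)‖ := norm_add_le _ _
      _ ≤ 7 / 2 := by norm_num; linarith
  have h := norm_LFunction_le_sum_add χ (N := 1) le_rfl (s := s) (by linarith) (.inr hχ)
  rw [charMean_eq_zero hχ] at h
  simp only [Finset.Icc_self, Finset.sum_singleton, Nat.cast_one, Real.one_rpow, norm_zero,
    zero_mul, zero_div, add_zero] at h
  have h2 : 1 / s.re ≤ 2 := by rw [div_le_iff₀ (by linarith)]; linarith
  calc _ ≤ _ := h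
    _ ≤ 1 + 7 / 2 * (3 * q * 2) := by gcongr
    _ ≤ 22 * q := by linarith

open scoped ComplexOrder in
/-- **Siegel's theorem** on the size of `L(1, χ)` for quadratic characters. -/
theorem exists_norm_LFunction_one_ge {ε : ℝ} (hε : 0 < ε) : ∃ c : ℝ, 0 < c ∧
    ∀ (q : ℕ) [NeZero q] (χ : DirichletCharacter ℂ q), χ ^ 2 = 1 → χ ≠ 1 →
      c * (q : ℝ) ^ (-ε) ≤ ‖DirichletCharacter.LFunction χ 1‖ := by
  obtain ⟨η₀, hη₀, hη₀', hzeta⟩ := exists_riemannZeta_re_nonpos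
  obtain ⟨c₀, hc₀, hest⟩ := exists_norm_apply_one_ge
  set η := min η₀ (ε / 20) with hη
  have hηpos : 0 < η := lt_min hη₀ (by positivity)
  have hη8 : η ≤ 1 / 8 := (min_le_left _ _).trans hη₀'
  have hηε : 20 * η ≤ ε := by have := min_le_right η₀ (ε / 20); linarith
  by_cases hex : ∃ (q₁ : ℕ) (_ : NeZero q₁) (χ₁ : DirichletCharacter ℂ q₁) (β : ℝ), χ₁ ^ 2 = 1 ∧
    χ₁ ≠ 1 ∧ 1 - η < β ∧ β < 1 ∧ DirichletCharacter.LFunction χ₁ β = 0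
  · obtain ⟨q₁, _, χ₁, β, hsq₁, hne₁, hβ, hβ1, hzero⟩ := hex
    obtain ⟨C, hC, hup⟩ := exists_norm_LFunction_le_of_awayFromPole hηpos (by linarith)
    have hL₁ : 0 < ‖DirichletCharacter.LFunction χ₁ 1‖ :=
      norm_pos_iff.2 (DirichletCharacter.LFunction_apply_one_ne_zero hne₁)
    set D := (η * Real.log 2)⁻¹ with hD
    have hDpos : 0 < D := inv_pos.2 (mul_pos hηpos (Real.log_pos one_lt_two))
    -- lower bounds in terms of the common modulus
    set c₁ := ‖DirichletCharacter.LFunction χ₁ 1‖ / D with hc₁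
    set c₂ := c₀ * (1 - β) * (10648 : ℝ) ^ (-(4 * η)) / (C ^ 2 * 2 ^ (4 * η)) with hc₂
    have hc₁pos : 0 < c₁ := by positivity
    have hc₂pos : 0 < c₂ := by have : 0 < 1 - β := by linarith
                               positivity
    have hkey : ∀ (Q : ℕ) [NeZero Q] (χ₁' χ' : DirichletCharacter ℂ Q), χ₁' ^ 2 = 1 → χ' ^ 2 = 1 →
        χ₁' ≠ 1 → χ' ≠ 1 → DirichletCharacter.LFunction χ₁' β = 0 →
        c₁ * (Q : ℝ) ^ (-η) ≤ ‖DirichletCharacter.LFunction χ₁' 1‖ →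
        min c₁ c₂ * (Q : ℝ) ^ (-(16 * η)) ≤ ‖DirichletCharacter.LFunction χ' 1‖ := by
      intro Q _ χ₁' χ' h1 h2 hn1 hn2 hz hlow
      have hQ : (1 : ℝ) ≤ Q := by exact_mod_cast NeZero.one_le
      have hQ0 : (0 : ℝ) < Q := by linarith
      rcases eq_or_ne (χ₁' * χ') 1 with h | h
      · have : χ₁' = χ' := by
          have h3 : χ₁' * χ' * χ' = χ' := by rw [h, one_mul]
          rwa [mul_assoc, ← sq, h2, mul_one] at h3
        rw [← this]
        refine le_trans ?_ hlow
        gcongr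
        · exact min_le_left _ _
        · linarith
      · have hle : ∀ ψ : DirichletCharacter ℂ Q, ψ ≠ 1 →
            ‖DirichletCharacter.LFunction ψ 1‖ ≤ C * (2 * Q) ^ (2 * η) := by
          intro ψ hψ
          have h3 := hup Q ψ 1 1 (.inl hψ) (by simp) (by simp; linarith) (by norm_num)
          have h4 : conductor Q 1 = 2 * Q := by simp [conductor, mul_comm]
          rwa [h4] at h3
        have hM : ∀ ψ : DirichletCharacter ℂ Q, ψ ≠ 1 → ∀ s : ℂ, ‖s - 2‖ ≤ 3 / 2 →
            ‖DirichletCharacter.LFunction ψ s‖ ≤ 22 * Q := fun ψ hψ s hs =>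
          norm_LFunction_le_mul hψ hs
        have h5 := hest (fun s => DirichletCharacter.LFunction χ₁' s *
          (DirichletCharacter.LFunction χ' s * DirichletCharacter.LFunction (χ₁' * χ') s))
          (quadCoeff χ₁' χ') (10648 * Q ^ 3) β
          ((DirichletCharacter.differentiable_LFunction hn1).mul
            ((DirichletCharacter.differentiable_LFunction hn2).mul
              (DirichletCharacter.differentiable_LFunction h)))
          (fun n => quadCoeff_nonneg h1 h2 n) quadCoeff_one.ge abscissaOfAbsConv_quadCoeff_le
          (fun s hs => LSeries_quadCoeff hs) (by nlinarith [one_le_pow₀ hQ (n := 3)])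
          (fun s hs => by
            rw [norm_mul, norm_mul]
            calc _ ≤ (22 * Q : ℝ) * ((22 * Q) * (22 * Q)) := by
                  gcongr
                  exacts [hM _ hn1 s hs, hM _ hn2 s hs, hM _ h s hs]
              _ = _ := by ring)
          (by linarith) hβ1 (by simp [hz])
        rw [norm_mul, norm_mul] at h5
        have h6 : c₂ * (C ^ 2 * 2 ^ (4 * η)) * (Q : ℝ) ^ (-(12 * η)) ≤
            c₀ * (1 - β) * (10648 * (Q : ℝ) ^ 3) ^ (-(4 * (1 - β))) := by
          have : 0 < 1 - β := by linarith
          rw [hc₂, div_mul_cancel₀ _ (by positivity)]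
          have h7 : (10648 : ℝ) ^ (-(4 * η)) * (Q : ℝ) ^ (-(12 * η))
              = (10648 * (Q : ℝ) ^ 3) ^ (-(4 * η)) := by
            rw [Real.mul_rpow (by norm_num) (by positivity), ← Real.rpow_natCast,
              ← Real.rpow_mul hQ0.le]
            congr 2
            push_cast; ring
          rw [mul_assoc, h7]
          gcongr
          · nlinarith [one_le_pow₀ hQ (n := 3)]
          · linarith
        have h8 : ‖DirichletCharacter.LFunction χ₁' 1‖ * (‖DirichletCharacter.LFunction χ' 1‖ *
            ‖DirichletCharacter.LFunction (χ₁' * χ') 1‖)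
            ≤ ‖DirichletCharacter.LFunction χ' 1‖ * ((C ^ 2 * 2 ^ (4 * η)) * (Q : ℝ) ^ (4 * η)) := by
          calc _ ≤ (C * (2 * Q) ^ (2 * η)) * (‖DirichletCharacter.LFunction χ' 1‖ *
                (C * (2 * Q) ^ (2 * η))) := by
                gcongr
                exacts [hle _ hn1, hle _ h]
            _ = _ := by
                rw [Real.mul_rpow (by norm_num) hQ0.le,
                  show (4 * η) = 2 * η + 2 * η by ring, Real.rpow_add (by norm_num),
                  Real.rpow_add hQ0]
                ring
        have h9 := h6.trans (h5.trans h8)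
        have h10 : c₂ * (Q : ℝ) ^ (-(16 * η)) ≤ ‖DirichletCharacter.LFunction χ' 1‖ := by
          have h11 : (Q : ℝ) ^ (-(16 * η)) = (Q : ℝ) ^ (-(12 * η)) / (Q : ℝ) ^ (4 * η) := by
            rw [← Real.rpow_sub hQ0]; ring_nf
          rw [h11, ← mul_div_assoc, div_le_iff₀ (by positivity)]
          have h12 : 0 < C ^ 2 * (2 : ℝ) ^ (4 * η) := by positivity
          nlinarith
        refine le_trans ?_ h10
        gcongr
        exact min_le_right _ _
    refine ⟨min c₁ c₂ / D * (q₁ : ℝ) ^ (-(17 * η)), by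
      have : (0 : ℝ) < q₁ := by exact_mod_cast NeZero.pos q₁
      have := lt_min hc₁pos hc₂pos
      positivity, ?_⟩
    intro q _ χ hsq hne
    have : NeZero (q₁ * q) := ⟨mul_ne_zero (NeZero.ne _) (NeZero.ne _)⟩
    have hq0 : (0 : ℝ) < q := by exact_mod_cast NeZero.pos q
    have hq1 : (1 : ℝ) ≤ q := by exact_mod_cast NeZero.one_le
    have hq₁0 : (0 : ℝ) < q₁ := by exact_mod_cast NeZero.pos q₁
    have hd₁ : q₁ ∣ q₁ * q := dvd_mul_right _ _
    have hd : q ∣ q₁ * q := dvd_mul_left _ _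
    have hlift : ∀ {m : ℕ} (hm : m ∣ q₁ * q) (ψ : DirichletCharacter ℂ m), ψ ^ 2 = 1 →
        (DirichletCharacter.changeLevel hm ψ) ^ 2 = 1 := by
      intro m hm ψ hψ
      rw [← map_pow, hψ, map_one]
    have hcard := card_primeFactors_add_one_le (NeZero.ne (q₁ * q)) hηpos (by linarith)
    rw [← hD] at hcard
    have hQ0 : (0 : ℝ) < ((q₁ * q : ℕ) : ℝ) := by exact_mod_cast NeZero.pos (q₁ * q)
    have hfin := hkey (q₁ * q) (DirichletCharacter.changeLevel hd₁ χ₁)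
      (DirichletCharacter.changeLevel hd χ) (hlift _ _ hsq₁) (hlift _ _ hsq)
      (hne₁ ∘ (DirichletCharacter.changeLevel_eq_one_iff hd₁).mp)
      (hne ∘ (DirichletCharacter.changeLevel_eq_one_iff hd).mp)
      (by rw [DirichletCharacter.LFunction_changeLevel hd₁ χ₁ (.inl hne₁), hzero, zero_mul])
      (by
        rw [DirichletCharacter.LFunction_changeLevel hd₁ χ₁ (.inl hne₁), norm_mul, hc₁, div_mul_eq_mul_div,
          mul_div_assoc]
        gcongr
        refine le_trans ?_ (norm_eulerFactor_bounds χ₁ (q₁ * q)).2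
        rw [Real.rpow_neg hQ0.le, div_eq_mul_inv, ← mul_inv]
        refine inv_anti₀ (by positivity) ?_
        rw [mul_comm _ D]; exact hcard)
    rw [DirichletCharacter.LFunction_changeLevel hd χ (.inl hne), norm_mul] at hfin
    have h1 := hfin.trans (mul_le_mul_of_nonneg_left
      ((norm_eulerFactor_bounds χ (q₁ * q)).1.trans hcard) (norm_nonneg _))
    have h2 : min c₁ c₂ / D * ((q₁ * q : ℕ) : ℝ) ^ (-(17 * η))
        ≤ ‖DirichletCharacter.LFunction χ 1‖ := by
      have h11 : ((q₁ * q : ℕ) : ℝ) ^ (-(17 * η))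
          = ((q₁ * q : ℕ) : ℝ) ^ (-(16 * η)) / ((q₁ * q : ℕ) : ℝ) ^ η := by
        rw [← Real.rpow_sub hQ0]; ring_nf
      rw [h11, div_mul_div_comm, div_le_iff₀ (by positivity)]
      exact h1
    refine le_trans ?_ h2
    rw [mul_assoc, Nat.cast_mul, Real.mul_rpow hq₁0.le hq0.le]
    have := lt_min hc₁pos hc₂pos
    gcongr
    linarith
  · push Not at hex
    refine ⟨c₀ * (η / 2) * (22 : ℝ) ^ (-ε), by positivity, fun q _ χ hsq hne => ?_⟩
    have hq1 : (1 : ℝ) ≤ q := by exact_mod_cast NeZero.one_le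
    have hq0 : (0 : ℝ) < q := by linarith
    have hη₀η : η ≤ η₀ := min_le_left _ _
    obtain ⟨hz1, hz2⟩ := hzeta (1 - η / 2) (by linarith) (by linarith)
    have h5 := hest (DirichletCharacter.LFunction χ) (zetaCoeff χ) (22 * q) (1 - η / 2)
      (DirichletCharacter.differentiable_LFunction hne) (fun n => zetaCoeff_nonneg hsq n)
      zetaCoeff_one.ge abscissaOfAbsConv_zetaCoeff_le (fun s hs => LSeries_zetaCoeff hs)
      (by linarith) (fun s hs => norm_LFunction_le_mul hne hs) (by linarith) (by linarith)
      (by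
        rw [mul_re, hz2, zero_mul, sub_zero]
        exact mul_nonpos_of_nonpos_of_nonneg hz1 (re_LFunction_ofReal_nonneg hsq hne
          fun σ h1 h2 => hex q inferInstance χ σ hsq hne (by linarith) h2))
    refine le_trans ?_ h5
    rw [mul_assoc, ← Real.mul_rpow (by norm_num) hq0.le, sub_sub_cancel]
    gcongr
    · linarith
    · linarith

lemma one_le_conductor (q : ℕ) [NeZero q] (s : ℂ) : 1 ≤ conductor q s :=
  one_le_two.trans (two_le_conductor q s)

lemma natCast_le_conductor (q : ℕ) (s : ℂ) : (q : ℝ) ≤ conductor q s := by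
  have : (0 : ℝ) ≤ q := Nat.cast_nonneg q
  rw [conductor]
  nlinarith [abs_nonneg s.im]

theorem exists_norm_LFunction_ge {ε : ℝ} (hε : 0 < ε) : ∃ c : ℝ, 0 < c ∧
    ∀ (q : ℕ) [NeZero q] (χ : DirichletCharacter ℂ q) (s : ℂ), AwayFromPole χ s →
      1 < s.re → s.re ≤ 2 → c * conductor q s ^ (-ε) ≤ ‖DirichletCharacter.LFunction χ s‖ := by
  set η := min (ε / 17) (1 / 4) with hη
  have hη0 : 0 < η := by positivity
  have hη4 : η ≤ 1 / 4 := min_le_right _ _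
  have hηε : 17 * η ≤ ε := by have := min_le_left (ε / 17) (1 / 4); linarith
  obtain ⟨c₁, hc₁, h₁⟩ := exists_norm_LFunction_ge_mul hη0 hη4
  obtain ⟨c₂, hc₂, h₂⟩ := exists_norm_LFunction_one_ge hη0
  obtain ⟨C, hC, h₃⟩ := exists_norm_LFunction_sub_le hη0 hη4
  set κ := min (1 / 4) (c₂ / (2 * C)) with hκ
  have hκ0 : 0 < κ := by positivity
  refine ⟨min (c₁ * κ) (c₂ / 2), by positivity, fun q _ χ s hpole hs1 hs2 => ?_⟩
  have hQ := one_le_conductor q s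
  have hQ0 : 0 < conductor q s := by linarith
  set Q := conductor q s with hQdef
  have hκ1 : κ ≤ 1 / 4 := min_le_left _ _
  have hτ1 : κ * Q ^ (-(3 * η)) ≤ κ :=
    mul_le_of_le_one_right hκ0.le (Real.rpow_le_one_of_one_le_of_nonpos hQ (by linarith))
  by_cases hcase : χ ^ 2 ≠ 1 ∨ κ * Q ^ (-(3 * η)) ≤ ‖s - 1‖
  · refine le_trans ?_ (h₁ q χ s (κ * Q ^ (-(3 * η))) hpole hs1 hs2 (by positivity)
      (by linarith) hcase)
    calc min (c₁ * κ) (c₂ / 2) * Q ^ (-ε) ≤ c₁ * κ * Q ^ (-(17 * η)) := by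
          gcongr
          exact min_le_left _ _
      _ = c₁ * Q ^ (-(14 * η)) * (κ * Q ^ (-(3 * η))) := by
          rw [show -(17 * η) = -(14 * η) + -(3 * η) by ring, Real.rpow_add hQ0]; ring
  · push Not at hcase
    obtain ⟨hsq, hclose⟩ := hcase
    have hχ : χ ≠ 1 := by
      refine hpole.resolve_right fun him => ?_
      have h4 := (abs_im_le_norm (s - 1))
      simp only [sub_im, one_im, sub_zero] at h4
      linarith
    have h5 := h₃ q χ s 1 hpole (by rw [norm_sub_rev]; linarith) (by simp; linarith)
      (by norm_num) (by linarith) (by linarith)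
    have h6 := h₂ q χ hsq hχ
    have h7 : C * Q ^ (2 * η) * ‖1 - s‖ ≤ c₂ / 2 * Q ^ (-η) := by
      rw [norm_sub_rev]
      calc C * Q ^ (2 * η) * ‖s - 1‖ ≤ C * Q ^ (2 * η) * (c₂ / (2 * C) * Q ^ (-(3 * η))) := by
            have : κ ≤ c₂ / (2 * C) := min_le_right _ _
            gcongr
            exact hclose.le.trans (by gcongr)
        _ = c₂ / 2 * Q ^ (-η) := by
            rw [show -η = 2 * η + -(3 * η) by ring, Real.rpow_add hQ0]; field_simp
    have h8 : c₂ * Q ^ (-η) ≤ c₂ * (q : ℝ) ^ (-η) := by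
      have : (0 : ℝ) < q := by exact_mod_cast NeZero.pos q
      exact mul_le_mul_of_nonneg_left (Real.rpow_le_rpow_of_nonpos this
        (natCast_le_conductor q s) (by linarith)) hc₂.le
    have h9 : min (c₁ * κ) (c₂ / 2) * Q ^ (-ε) ≤ c₂ / 2 * Q ^ (-η) := by
      gcongr
      · exact min_le_right _ _
      · linarith
    have h10 := norm_sub_norm_le (DirichletCharacter.LFunction χ 1)
      (DirichletCharacter.LFunction χ s)
    have h11 := h5.trans h7
    linarith

lemma exists_norm_iteratedDeriv_inv_LFunction_le (k : ℕ) {ε : ℝ} (hε : 0 < ε) : ∃ C : ℝ, 0 < C ∧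
    ∀ (q : ℕ) [NeZero q] (χ : DirichletCharacter ℂ q) (s : ℂ), AwayFromPole χ s →
      1 < s.re → s.re ≤ 2 →
      ‖iteratedDeriv k (fun w => (DirichletCharacter.LFunction χ w)⁻¹) s‖
        ≤ C * conductor q s ^ ε := by
  set η := min (ε / (3 * k + 1)) (1 / 4) with hη
  have hη0 : 0 < η := by positivity
  have hη4 : η ≤ 1 / 4 := min_le_right _ _
  have hηε : (3 * k + 1) * η ≤ ε := by
    have := min_le_left (ε / (3 * k + 1)) (1 / 4)
    rw [← hη, le_div_iff₀ (by positivity)] at this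
    linarith
  obtain ⟨c, hc, h₁⟩ := exists_norm_LFunction_ge hη0
  obtain ⟨C, hC, h₃⟩ := exists_norm_LFunction_sub_le hη0 hη4
  set κ := min (η / 2) (c / (2 * C)) with hκ
  have hκ0 : 0 < κ := by positivity
  have hκη : κ ≤ η / 2 := min_le_left _ _
  refine ⟨k.factorial * (2 / c) / κ ^ k, by positivity, fun q _ χ s hpole hs1 hs2 => ?_⟩
  have hQ := one_le_conductor q s
  have hQ0 : 0 < conductor q s := by linarith
  set Q := conductor q s with hQdef
  set r := κ * Q ^ (-(3 * η)) with hr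
  have hr0 : 0 < r := by positivity
  have hrκ : r ≤ κ :=
    mul_le_of_le_one_right hκ0.le (Real.rpow_le_one_of_one_le_of_nonpos hQ (by linarith))
  have hbd : ∀ w : ℂ, ‖w - s‖ ≤ r →
      c / 2 * Q ^ (-η) ≤ ‖DirichletCharacter.LFunction χ w‖ := by
    intro w hw
    have hre := (abs_re_le_norm (w - s)).trans hw
    rw [sub_re, abs_le] at hre
    have h5 := h₃ q χ s w hpole (by linarith) (by linarith) (by linarith) (by linarith)
      (by linarith)
    have h7 : C * Q ^ (2 * η) * ‖w - s‖ ≤ c / 2 * Q ^ (-η) := by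
      calc C * Q ^ (2 * η) * ‖w - s‖ ≤ C * Q ^ (2 * η) * (c / (2 * C) * Q ^ (-(3 * η))) := by
            have : κ ≤ c / (2 * C) := min_le_right _ _
            gcongr
            exact hw.trans (mul_le_mul_of_nonneg_right this (by positivity))
        _ = c / 2 * Q ^ (-η) := by
            rw [show -η = 2 * η + -(3 * η) by ring, Real.rpow_add hQ0]; field_simp
    have h10 := norm_sub_norm_le (DirichletCharacter.LFunction χ s)
      (DirichletCharacter.LFunction χ w)
    rw [norm_sub_rev] at h10
    have h11 := h₁ q χ s hpole hs1 hs2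
    linarith
  have hpos : 0 < c / 2 * Q ^ (-η) := by positivity
  have hdiff : DiffContOnCl ℂ (fun w => (DirichletCharacter.LFunction χ w)⁻¹) (Metric.ball s r) := by
    refine DifferentiableOn.diffContOnCl fun w hw => DifferentiableAt.differentiableWithinAt ?_
    have hw' : ‖w - s‖ ≤ r := by
      simpa [dist_eq_norm] using Metric.closure_ball_subset_closedBall hw
    refine (DirichletCharacter.differentiableAt_LFunction χ w
      (hpole.ne_one (by linarith))).inv ?_
    exact norm_pos_iff.1 (hpos.trans_le (hbd w hw'))
  refine (norm_iteratedDeriv_le_of_forall_mem_sphere_norm_le (C := 2 / c * Q ^ η) k hr0 hdiff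
    fun w hw => ?_).trans ?_
  · have h1 := hbd w (mem_sphere_iff_norm.1 hw).le
    rw [norm_inv]
    calc ‖DirichletCharacter.LFunction χ w‖⁻¹ ≤ (c / 2 * Q ^ (-η))⁻¹ := inv_anti₀ hpos h1
      _ = 2 / c * Q ^ η := by rw [mul_inv, Real.rpow_neg hQ0.le, inv_inv, inv_div]
  · have h2 : r ^ k = κ ^ k * Q ^ (-(3 * k * η)) := by
      rw [hr, mul_pow, ← Real.rpow_natCast (Q ^ _), ← Real.rpow_mul hQ0.le]
      ring_nf
    rw [h2]
    calc k.factorial * (2 / c * Q ^ η) / (κ ^ k * Q ^ (-(3 * k * η)))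
        = k.factorial * (2 / c) / κ ^ k * Q ^ ((3 * k + 1) * η) := by
          rw [Real.rpow_neg hQ0.le, show (3 * k + 1) * η = 3 * k * η + η by ring,
            Real.rpow_add hQ0]
          field_simp
      _ ≤ _ := by gcongr

lemma exists_norm_iteratedDeriv_inv_riemannZeta_le (k : ℕ) : ∃ C : ℝ, 0 < C ∧
    ∀ s : ℂ, |s.im| ≤ 1 → 1 < s.re → s.re ≤ 2 →
      ‖iteratedDeriv k (fun w => (riemannZeta w)⁻¹) s‖ ≤ C := by
  have han : ∀ s : ℂ, 1 ≤ s.re → AnalyticAt ℂ (fun w => (w - 1) / zetaEntire w) s := by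
    intro s hs
    have hd : AnalyticAt ℂ zetaEntire s := differentiable_zetaEntire.analyticAt s
    refine AnalyticAt.div (by fun_prop) hd ?_
    rcases eq_or_ne s 1 with rfl | h
    · simp [zetaEntire_one]
    · rw [zetaEntire_of_ne_one h]
      exact mul_ne_zero (sub_ne_zero.2 h) (riemannZeta_ne_zero_of_one_le_re hs)
  have hcont : ContinuousOn (iteratedDeriv k (fun w => (w - 1) / zetaEntire w))
      (Icc 1 2 ×ℂ Icc (-1) 1) := by
    intro s hs
    have := (han s hs.1.1).iterated_deriv k
    rw [← iteratedDeriv_eq_iterate] at this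
    exact this.continuousAt.continuousWithinAt
  obtain ⟨C, hC⟩ := (isCompact_Icc.reProdIm isCompact_Icc).exists_bound_of_continuousOn hcont
  refine ⟨max C 1, by positivity, fun s him h1 h2 => ?_⟩
  have hev : (fun w => (riemannZeta w)⁻¹) =ᶠ[𝓝 s] fun w => (w - 1) / zetaEntire w := by
    filter_upwards [(isOpen_lt continuous_const continuous_re).mem_nhds h1] with w hw
    have hw1 : w ≠ 1 := by rintro rfl; simp at hw
    have := sub_ne_zero.2 hw1
    rw [zetaEntire_of_ne_one hw1]
    rw [div_mul_eq_div_div, div_self this, one_div]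
  rw [hev.iteratedDeriv_eq]
  exact (hC s ⟨⟨h1.le, h2⟩, abs_le.1 him⟩).trans (le_max_left _ _)

/-- Bounds for the derivatives of `1 / L(s, χ)` to the right of the line `re s = 1`. -/
theorem exists_norm_LSeries_logMul_moebius_le (k : ℕ) {ε : ℝ} (hε : 0 < ε) : ∃ C : ℝ, 0 < C ∧
    ∀ (q : ℕ) [NeZero q] (χ : DirichletCharacter ℂ q) (s : ℂ), (χ ≠ 1 ∨ q = 1) →
      1 < s.re → s.re ≤ 2 →
      ‖LSeries (LSeries.logMul^[k] fun n => χ n * (ArithmeticFunction.moebius n : ℂ)) s‖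
        ≤ C * conductor q s ^ ε := by
  obtain ⟨C₁, hC₁, h₁⟩ := exists_norm_iteratedDeriv_inv_LFunction_le k hε
  obtain ⟨C₂, hC₂, h₂⟩ := exists_norm_iteratedDeriv_inv_riemannZeta_le k
  refine ⟨max C₁ C₂, by positivity, fun q _ χ s hχ hs1 hs2 => ?_⟩
  have habs : LSeries.abscissaOfAbsConv (fun n => χ n * (ArithmeticFunction.moebius n : ℂ)) ≤ 1 :=
    LSeries.abscissaOfAbsConv_le_of_forall_lt_LSeriesSummable fun y hy =>
      DirichletCharacter.LSeriesSummable_mul χ <|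
        ArithmeticFunction.LSeriesSummable_moebius_iff.mpr (by simpa using hy)
  have h3 := LSeries_iteratedDeriv (f := fun n => χ n * (ArithmeticFunction.moebius n : ℂ)) k
    (s := s) (habs.trans_lt (by exact_mod_cast hs1))
  have hev : LSeries (fun n => χ n * (ArithmeticFunction.moebius n : ℂ)) =ᶠ[𝓝 s]
      fun w => (DirichletCharacter.LFunction χ w)⁻¹ := by
    filter_upwards [(isOpen_lt continuous_const continuous_re).mem_nhds hs1] with w hw
    rw [DirichletCharacter.LFunction_eq_LSeries _ hw]
    exact eq_inv_of_mul_eq_one_right (DirichletCharacter.LSeries.mul_mu_eq_one χ hw)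
  rw [hev.iteratedDeriv_eq] at h3
  have h4 := congrArg norm h3
  rw [norm_mul, norm_pow, norm_neg, norm_one, one_pow, one_mul] at h4
  rw [← h4]
  have hQ := one_le_conductor q s
  by_cases hpole : AwayFromPole χ s
  · exact (h₁ q χ s hpole hs1 hs2).trans (by gcongr; exact le_max_left _ _)
  · rw [AwayFromPole, not_or] at hpole
    obtain ⟨h5, h6⟩ := hpole
    obtain rfl := hχ.resolve_left h5
    rw [DirichletCharacter.LFunction_modOne_eq]
    calc _ ≤ C₂ := h₂ s (not_le.1 h6).le hs1 hs2
      _ ≤ max C₁ C₂ * 1 := by rw [mul_one]; exact le_max_right _ _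
      _ ≤ _ := by gcongr; exact Real.one_le_rpow hQ hε.le

section Perron

/-- The function `x ↦ max 0 (1 - x)` on the positive reals. -/
noncomputable def tent (x : ℝ) : ℂ :=
  indicator (Ioc (0 : ℝ) 1) (fun _ => 1 : ℝ → ℂ) x -
    indicator (Ioc (0 : ℝ) 1) (fun t => (t : ℂ) ^ (1 : ℂ) : ℝ → ℂ) x

lemma tent_eq {x : ℝ} (hx : 0 < x) : tent x = ((max 0 (1 - x) : ℝ) : ℂ) := by
  rcases le_or_gt x 1 with h | h
  · have : x ∈ Ioc (0 : ℝ) 1 := ⟨hx, h⟩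
    rw [tent, indicator_of_mem this, indicator_of_mem this, max_eq_right (by linarith), cpow_one]
    push_cast; rfl
  · have : x ∉ Ioc (0 : ℝ) 1 := fun h' => by linarith [h'.2]
    rw [tent, indicator_of_notMem this, indicator_of_notMem this, max_eq_left (by linarith)]
    simp

/-- The Mellin transform of `tent`. -/
noncomputable def tentMellin (s : ℂ) : ℂ := 1 / s - 1 / (s + 1)

lemma hasMellin_tent {s : ℂ} (hs : 0 < s.re) : HasMellin tent s (tentMellin s) := by
  have h1 := hasMellin_one_Ioc hs
  have h2 := hasMellin_cpow_Ioc 1 (s := s) (by rw [one_re]; linarith)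
  have h3 := hasMellin_sub h1.1 h2.1
  rw [h1.2, h2.2] at h3
  exact h3

lemma norm_tentMellin_le {c : ℝ} (hc : 1 ≤ c) (t : ℝ) :
    ‖tentMellin (c + t * I)‖ ≤ (1 + t ^ 2)⁻¹ := by
  have aux : ∀ r : ℝ, 1 ≤ r → Real.sqrt (1 + t ^ 2) ≤ ‖(r : ℂ) + t * I‖ := by
    intro r hr
    rw [norm_add_mul_I]
    gcongr
    nlinarith
  have h1 := aux c hc
  have h2 := aux (c + 1) (by linarith)
  have hpos : 0 < Real.sqrt (1 + t ^ 2) := by positivity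
  have hs : ((c : ℂ) + t * I) ≠ 0 := norm_pos_iff.1 (hpos.trans_le h1)
  have hs' : ((c : ℂ) + t * I + 1) ≠ 0 := by
    have := norm_pos_iff.1 (hpos.trans_le h2)
    push_cast at this
    rwa [show ((c : ℂ) + t * I + 1) = c + 1 + t * I by ring]
  have e : tentMellin (c + t * I) = (((c : ℂ) + t * I) * ((c + 1 : ℝ) + t * I))⁻¹ := by
    rw [tentMellin]
    push_cast
    rw [show ((c : ℂ) + 1 + t * I) = c + t * I + 1 by ring]
    field_simp
    ring
  rw [e, norm_inv, norm_mul]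
  refine inv_anti₀ (by positivity) ?_
  calc 1 + t ^ 2 = Real.sqrt (1 + t ^ 2) * Real.sqrt (1 + t ^ 2) :=
        (Real.mul_self_sqrt (by positivity)).symm
    _ ≤ _ := by gcongr

lemma continuous_tentMellin {c : ℝ} (hc : 1 ≤ c) :
    Continuous fun t : ℝ => tentMellin (c + t * I) := by
  have aux : ∀ r : ℝ, 1 ≤ r → ∀ t : ℝ, (r : ℂ) + t * I ≠ 0 := by
    intro r hr t h
    have := congrArg re h
    simp at this
    linarith
  refine Continuous.sub ?_ ?_
  · exact continuous_const.div (by fun_prop) (aux c hc)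
  · refine continuous_const.div (by fun_prop) fun t => ?_
    have := aux (c + 1) (by linarith) t
    push_cast at this
    rwa [show ((c : ℂ) + t * I + 1) = c + 1 + t * I by ring]

lemma integrable_tentMellin {c : ℝ} (hc : 1 ≤ c) :
    Integrable fun t : ℝ => tentMellin (c + t * I) :=
  integrable_inv_one_add_sq.mono' (continuous_tentMellin hc).aestronglyMeasurable
    (Eventually.of_forall fun t => norm_tentMellin_le hc t)

lemma integral_tentMellin {c : ℝ} (hc : 1 ≤ c) {x : ℝ} (hx : 0 < x) :
    ∫ t : ℝ, (x : ℂ) ^ (-(c + t * I)) * tentMellin (c + t * I)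
      = 2 * Real.pi * ((max 0 (1 - x) : ℝ) : ℂ) := by
  have hm : ∀ t : ℝ, mellin tent (c + t * I) = tentMellin (c + t * I) := fun t =>
    (hasMellin_tent (by simp; linarith)).2
  have hcont : ContinuousAt tent x := by
    have h1 : Continuous fun x : ℝ => ((max 0 (1 - x) : ℝ) : ℂ) := by fun_prop
    refine h1.continuousAt.congr ?_
    filter_upwards [lt_mem_nhds hx] with y hy
    exact (tent_eq hy).symm
  have h := mellinInv_mellin_eq c tent hx (hasMellin_tent (by simp; linarith)).1
    (by simpa only [VerticalIntegrable, hm] using integrable_tentMellin hc) hcont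
  rw [mellinInv] at h
  simp only [hm, smul_eq_mul, tent_eq hx] at h
  rw [← h, real_smul]
  have : (Real.pi : ℂ) ≠ 0 := by exact_mod_cast Real.pi_ne_zero
  generalize ∫ y : ℝ, (x : ℂ) ^ (-(c + y * I)) * tentMellin (c + y * I) = J
  push_cast
  field_simp

/-- Perron's formula with the weight `1 - n / N`. -/
theorem sum_mul_one_sub_div_eq_integral {a : ℕ → ℂ} {N : ℕ} (hN : 1 ≤ N) {c : ℝ} (hc : 1 ≤ c)
    (ha : LSeriesSummable a c) :
    2 * Real.pi * ∑ n ∈ Finset.Icc 1 N, a n * (1 - n / N) =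
      ∫ t : ℝ, LSeries a (c + t * I) * ((N : ℂ) ^ ((c : ℂ) + t * I) * tentMellin (c + t * I)) := by
  have hN0 : (0 : ℝ) < N := by exact_mod_cast hN
  have hNc : (N : ℂ) ≠ 0 := by exact_mod_cast hN0.ne'
  set F : ℕ → ℝ → ℂ := fun n t => LSeries.term a (c + t * I) n *
    ((N : ℂ) ^ ((c : ℂ) + t * I) * tentMellin (c + t * I)) with hF
  have hre : ∀ t : ℝ, ((c : ℂ) + t * I).re = c := fun t => by simp
  have hnorm : ∀ n t, ‖F n t‖ = ‖LSeries.term a c n‖ * ((N : ℝ) ^ c * ‖tentMellin (c + t * I)‖) := by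
    intro n t
    simp only [hF, norm_mul]
    rw [LSeries.norm_term_eq, LSeries.norm_term_eq, hre, ofReal_re, ← ofReal_natCast,
      norm_cpow_eq_rpow_re_of_pos hN0, hre]
  have hFint : ∀ n, Integrable (F n) := by
    intro n
    have hcont : Continuous (F n) := by
      refine Continuous.mul ?_ (Continuous.mul ?_ (continuous_tentMellin hc))
      · rcases eq_or_ne n 0 with rfl | hn
        · simpa using continuous_const
        · simp only [LSeries.term_of_ne_zero hn]
          refine continuous_const.div ?_ fun t => ?_
          · exact Continuous.const_cpow (by fun_prop) (.inl (by exact_mod_cast hn))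
          · exact (cpow_ne_zero_iff).2 (.inl (by exact_mod_cast hn))
      · exact Continuous.const_cpow (by fun_prop) (.inl hNc)
    refine Integrable.mono' (((integrable_tentMellin hc).norm.const_mul ((N : ℝ) ^ c)).const_mul
      ‖LSeries.term a c n‖) hcont.aestronglyMeasurable (Eventually.of_forall fun t => (hnorm n t).le)
  have hsum : Summable fun n => ∫ t, ‖F n t‖ := by
    simp_rw [hnorm, integral_const_mul]
    exact (summable_norm_iff.2 ha).mul_right _
  have hval : ∀ n, ∫ t, F n t = 2 * Real.pi *
      (if n ∈ Finset.Icc 1 N then a n * (1 - n / N) else 0) := by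
    intro n
    rcases eq_or_ne n 0 with rfl | hn
    · simp [hF]
    have hn0 : (0 : ℝ) < n := by exact_mod_cast Nat.pos_of_ne_zero hn
    have hx : 0 < (n : ℝ) / N := by positivity
    have e : F n = fun t : ℝ => a n *
        ((((n : ℝ) / N : ℝ) : ℂ) ^ (-((c : ℂ) + t * I)) * tentMellin (c + t * I)) := by
      funext t
      simp only [hF]
      rw [LSeries.term_of_ne_zero hn, ofReal_div, div_cpow_ofReal_nonneg hn0.le hN0.le, cpow_neg, cpow_neg,
        ofReal_natCast, ofReal_natCast]
      rw [inv_div_inv]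
      ring
    rw [e, integral_const_mul, integral_tentMellin hc hx]
    split_ifs with h
    · have : (n : ℝ) / N ≤ 1 := by
        rw [div_le_one hN0]; exact_mod_cast (Finset.mem_Icc.1 h).2
      rw [max_eq_right (by linarith)]
      push_cast; ring
    · have : 1 ≤ (n : ℝ) / N := by
        rw [one_le_div hN0]
        have : ¬ n ≤ N := fun h' => h (Finset.mem_Icc.2 ⟨Nat.pos_of_ne_zero hn, h'⟩)
        exact_mod_cast (not_le.1 this).le
      rw [max_eq_left (by linarith)]
      simp
  have h := hasSum_integral_of_summable_integral_norm hFint hsum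
  simp only [hval] at h
  have h2 : HasSum (fun n => 2 * (Real.pi : ℂ) *
      (if n ∈ Finset.Icc 1 N then a n * (1 - n / N) else 0)) (∑ n ∈ Finset.Icc 1 N,
      2 * (Real.pi : ℂ) * (if n ∈ Finset.Icc 1 N then a n * (1 - n / N) else 0)) :=
    hasSum_sum_of_ne_finset_zero fun b hb => by simp only [if_neg hb, mul_zero]
  have h3 := h2.unique h
  rw [Finset.mul_sum]
  rw [Finset.sum_congr rfl (fun n hn => by rw [if_pos hn])] at h3
  rw [h3]
  congr 1
  funext t
  simp only [hF]
  rw [tsum_mul_right, LSeries]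

end Perron

section Smoothed

lemma logMul_iterate_apply (f : ℕ → ℂ) (k n : ℕ) :
    LSeries.logMul^[k] f n = (Real.log n : ℂ) ^ k * f n := by
  induction k with
  | zero => simp
  | succ k ih =>
    rw [Function.iterate_succ_apply', LSeries.logMul, ih, pow_succ', ← natCast_log, mul_assoc]

/-- The coefficients of the Dirichlet series `1 / L(s, χ)`. -/
noncomputable def moebiusTwist {q : ℕ} (χ : DirichletCharacter ℂ q) (n : ℕ) : ℂ :=
  χ n * (ArithmeticFunction.moebius n : ℂ)

lemma norm_moebius_le (n : ℕ) : ‖(ArithmeticFunction.moebius n : ℂ)‖ ≤ 1 := by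
  rw [norm_intCast]
  exact_mod_cast ArithmeticFunction.abs_moebius_le_one

lemma norm_moebiusTwist_le {q : ℕ} (χ : DirichletCharacter ℂ q) (n : ℕ) :
    ‖moebiusTwist χ n‖ ≤ 1 := by
  rw [moebiusTwist, norm_mul]
  exact mul_le_one₀ (χ.norm_le_one _) (norm_nonneg _) (norm_moebius_le n)

lemma lSeriesSummable_logMul_moebiusTwist {q : ℕ} (χ : DirichletCharacter ℂ q) (k : ℕ) {s : ℂ}
    (hs : 1 < s.re) : LSeriesSummable (LSeries.logMul^[k] (moebiusTwist χ)) s := by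
  have h0 : LSeries.abscissaOfAbsConv (moebiusTwist χ) ≤ 1 := by
    refine LSeries.abscissaOfAbsConv_le_of_le_const ⟨1, fun n _ => norm_moebiusTwist_le χ n⟩
  have h : LSeries.abscissaOfAbsConv (LSeries.logMul^[k] (moebiusTwist χ)) ≤ 1 := by
    rwa [LSeries.absicssaOfAbsConv_logPowMul]
  exact LSeriesSummable_of_abscissaOfAbsConv_lt_re (h.trans_lt (by exact_mod_cast hs))

lemma integrable_sqrt_div : Integrable fun t : ℝ => (1 + t ^ 2) ^ (-(3 / 4) : ℝ) := by
  have := integrable_rpow_neg_one_add_norm_sq (E := ℝ) (μ := volume) (r := 3 / 2)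
    (by simp; norm_num)
  simpa [show -(3 / 2 : ℝ) / 2 = -(3 / 4) by norm_num] using this

lemma conductor_rpow_mul_le {q : ℕ} [NeZero q] (c t : ℝ) :
    conductor q (c + t * I) ^ (1 / 2 : ℝ) * (1 + t ^ 2)⁻¹ ≤ 2 * q * (1 + t ^ 2) ^ (-(3 / 4) : ℝ) := by
  have hq : (1 : ℝ) ≤ q := by exact_mod_cast NeZero.one_le
  have h1 : (0 : ℝ) < 1 + t ^ 2 := by positivity
  have e : conductor q (c + t * I) = q * (|t| + 2) := by simp [conductor]
  have h2 : |t| + 2 ≤ 4 * (1 + t ^ 2) ^ (1 / 2 : ℝ) := by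
    rw [← Real.sqrt_eq_rpow]
    have : |t| ≤ √(1 + t ^ 2) := Real.abs_le_sqrt (by linarith)
    have : 1 ≤ √(1 + t ^ 2) := Real.one_le_sqrt.2 (by nlinarith)
    linarith
  have h3 : conductor q (c + t * I) ^ (1 / 2 : ℝ) ≤ 2 * q * (1 + t ^ 2) ^ (1 / 4 : ℝ) := by
    rw [e]
    calc ((q : ℝ) * (|t| + 2)) ^ (1 / 2 : ℝ)
        ≤ (q ^ 2 * (4 * (1 + t ^ 2) ^ (1 / 2 : ℝ))) ^ (1 / 2 : ℝ) := by
          gcongr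
          nlinarith
      _ = 2 * q * (1 + t ^ 2) ^ (1 / 4 : ℝ) := by
          rw [← Real.sqrt_eq_rpow, Real.sqrt_mul (by positivity), Real.sqrt_sq (by positivity),
            Real.sqrt_mul (by norm_num), show (4 : ℝ) = 2 ^ 2 by norm_num,
            Real.sqrt_sq (by norm_num), Real.sqrt_eq_rpow, ← Real.rpow_mul h1.le]
          norm_num
          ring
  calc _ ≤ (2 * q * (1 + t ^ 2) ^ (1 / 4 : ℝ)) * (1 + t ^ 2)⁻¹ := by gcongr
    _ = _ := by
      rw [← Real.rpow_neg_one, mul_assoc, ← Real.rpow_add h1]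
      norm_num

lemma one_le_log_add_two {N : ℕ} (hN : 1 ≤ N) : 1 < Real.log (N + 2) := by
  have hN' : (1 : ℝ) ≤ N := by exact_mod_cast hN
  rw [Real.lt_log_iff_exp_lt (by positivity)]
  have := Real.exp_one_lt_d9
  norm_num at this ⊢
  linarith

/-- Smoothed sums of the Möbius function twisted by a character. -/
theorem exists_norm_sum_log_pow_mul_one_sub_le (k : ℕ) : ∃ C : ℝ, 0 < C ∧
    ∀ (q : ℕ) [NeZero q] (χ : DirichletCharacter ℂ q) (N : ℕ), (χ ≠ 1 ∨ q = 1) → 1 ≤ N →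
    ‖∑ n ∈ Finset.Icc 1 N, (Real.log n : ℂ) ^ k * moebiusTwist χ n * (1 - n / N)‖ ≤ C * q * N := by
  obtain ⟨C, hC, h⟩ := exists_norm_LSeries_logMul_moebius_le k (ε := 1 / 2) (by norm_num)
  set J := ∫ t : ℝ, (1 + t ^ 2) ^ (-(3 / 4) : ℝ) with hJ
  have hJ0 : 0 ≤ J := integral_nonneg fun t => by positivity
  refine ⟨C * Real.exp 1 * 2 * (J + 1), by positivity, fun q _ χ N hχ hN => ?_⟩
  have hN' : (1 : ℝ) ≤ N := by exact_mod_cast hN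
  have hl := one_le_log_add_two hN
  set l := Real.log (N + 2) with hldef
  set c : ℝ := 1 + 1 / l with hc
  have hc1 : 1 < c := by rw [hc]; have : 0 < 1 / l := by positivity
                         linarith
  have hc2 : c ≤ 2 := by
    have : 1 / l ≤ 1 := by rw [div_le_one (by linarith)]; exact hl.le
    linarith
  have hNc : (N : ℝ) ^ c ≤ Real.exp 1 * N := by
    rw [hc, Real.rpow_add (by linarith), Real.rpow_one, mul_comm]
    gcongr
    calc (N : ℝ) ^ (1 / l) ≤ (N + 2 : ℝ) ^ (1 / l) := by gcongr; linarith
      _ = Real.exp 1 := by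
        rw [Real.rpow_def_of_pos (by positivity), ← hldef, mul_one_div_cancel (by linarith)]
  have hP := sum_mul_one_sub_div_eq_integral (a := LSeries.logMul^[k] (moebiusTwist χ)) hN hc1.le
    (lSeriesSummable_logMul_moebiusTwist χ k (by simpa using hc1))
  simp only [logMul_iterate_apply] at hP
  have hInt : ‖∫ t : ℝ, LSeries (LSeries.logMul^[k] (moebiusTwist χ)) (c + t * I) *
      ((N : ℂ) ^ ((c : ℂ) + t * I) * tentMellin (c + t * I))‖ ≤
      ∫ t : ℝ, C * Real.exp 1 * 2 * q * N * (1 + t ^ 2) ^ (-(3 / 4) : ℝ) := by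
    refine norm_integral_le_of_norm_le (integrable_sqrt_div.const_mul _)
      (Eventually.of_forall fun t => ?_)
    have hb := h q χ (c + t * I) hχ (by simpa using hc1) (by simpa using hc2)
    rw [norm_mul, norm_mul, ← ofReal_natCast, norm_cpow_eq_rpow_re_of_pos (by linarith)]
    have e : ((c : ℂ) + t * I).re = c := by simp
    rw [e]
    calc _ ≤ (C * conductor q (c + t * I) ^ (1 / 2 : ℝ)) *
          ((Real.exp 1 * N) * (1 + t ^ 2)⁻¹) := by
          refine mul_le_mul hb ?_ (by positivity) ((norm_nonneg _).trans hb)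
          exact mul_le_mul hNc (norm_tentMellin_le hc1.le t) (norm_nonneg _) (by positivity)
      _ = C * Real.exp 1 * N * (conductor q (c + t * I) ^ (1 / 2 : ℝ) * (1 + t ^ 2)⁻¹) := by ring
      _ ≤ C * Real.exp 1 * N * (2 * q * (1 + t ^ 2) ^ (-(3 / 4) : ℝ)) := by
          gcongr C * Real.exp 1 * N * ?_
          exact conductor_rpow_mul_le c t
      _ = _ := by ring
  rw [← hP, integral_const_mul, ← hJ, norm_mul] at hInt
  have h2pi : 1 ≤ ‖(2 * Real.pi : ℂ)‖ := by
    rw [norm_mul, norm_real, Real.norm_eq_abs, abs_of_pos Real.pi_pos]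
    have := Real.pi_gt_three
    norm_num
    linarith
  calc _ ≤ ‖(2 * Real.pi : ℂ)‖ * ‖∑ n ∈ Finset.Icc 1 N,
        (Real.log n : ℂ) ^ k * moebiusTwist χ n * (1 - n / N)‖ :=
        le_mul_of_one_le_left (norm_nonneg _) h2pi
    _ ≤ _ := hInt
    _ ≤ C * Real.exp 1 * 2 * (J + 1) * q * N := by
      have : 0 ≤ C * Real.exp 1 * 2 * q * N := by positivity
      nlinarith

end Smoothed

section Abel

lemma sum_Ioc_mul_eq (w g : ℕ → ℂ) {m n : ℕ} (hmn : m ≤ n) :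
    ∑ i ∈ Finset.Ioc m n, w i * g i = w (n + 1) * ∑ i ∈ Finset.Ioc m n, g i -
      ∑ i ∈ Finset.Ioc m n, (w (i + 1) - w i) * ∑ l ∈ Finset.Ioc m i, g l := by
  induction n, hmn using Nat.le_induction with
  | base => simp
  | succ n hn ih =>
    have hs : ∀ F : ℕ → ℂ, ∑ i ∈ Finset.Ioc m (n + 1), F i = ∑ i ∈ Finset.Ioc m n, F i + F (n + 1) :=
      fun F => Finset.sum_Ioc_succ_top (by omega) F
    rw [hs, hs fun i => (w (i + 1) - w i) * _, ih, hs g]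
    ring

/-- A discrete form of partial summation, as an inequality. -/
theorem norm_sum_Ioc_mul_le (w g : ℕ → ℂ) {m n : ℕ} (hmn : m ≤ n) {B : ℝ}
    (hB : ∀ k ∈ Finset.Icc m n, ‖∑ i ∈ Finset.Ioc m k, g i‖ ≤ B) :
    ‖∑ i ∈ Finset.Ioc m n, w i * g i‖ ≤
      B * (‖w (n + 1)‖ + ∑ i ∈ Finset.Ioc m n, ‖w (i + 1) - w i‖) := by
  rw [sum_Ioc_mul_eq w g hmn, mul_add]
  refine (norm_sub_le _ _).trans (add_le_add ?_ ?_)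
  · rw [norm_mul, mul_comm]
    gcongr
    exact hB n (Finset.mem_Icc.2 ⟨hmn, le_rfl⟩)
  · rw [Finset.mul_sum]
    refine (norm_sum_le _ _).trans (Finset.sum_le_sum fun i hi => ?_)
    rw [norm_mul, mul_comm]
    gcongr
    obtain ⟨h1, h2⟩ := Finset.mem_Ioc.1 hi
    exact hB i (Finset.mem_Icc.2 ⟨h1.le, h2⟩)

lemma sum_Ioc_sub_succ (w : ℕ → ℝ) {m n : ℕ} (hmn : m ≤ n) :
    ∑ i ∈ Finset.Ioc m n, (w i - w (i + 1)) = w (m + 1) - w (n + 1) := by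
  induction n, hmn using Nat.le_induction with
  | base => simp
  | succ n hn ih =>
    rw [Finset.sum_Ioc_succ_top (by omega), ih]
    ring

/-- Partial summation against a nonincreasing nonnegative weight. -/
theorem norm_sum_Ioc_antitone_mul_le (w : ℕ → ℝ) (g : ℕ → ℂ) {m n : ℕ} (hmn : m ≤ n) {B : ℝ}
    (hw : ∀ i, m < i → w (i + 1) ≤ w i) (hw0 : 0 ≤ w (n + 1))
    (hB : ∀ k ∈ Finset.Icc m n, ‖∑ i ∈ Finset.Ioc m k, g i‖ ≤ B) :
    ‖∑ i ∈ Finset.Ioc m n, (w i : ℂ) * g i‖ ≤ B * w (m + 1) := by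
  refine (norm_sum_Ioc_mul_le (fun i => (w i : ℂ)) g hmn hB).trans (le_of_eq ?_)
  have : ∑ i ∈ Finset.Ioc m n, ‖(w (i + 1) : ℂ) - w i‖ = w (m + 1) - w (n + 1) := by
    rw [← sum_Ioc_sub_succ w hmn]
    refine Finset.sum_congr rfl fun i hi => ?_
    rw [← ofReal_sub, norm_real, Real.norm_eq_abs, abs_sub_comm, abs_of_nonneg]
    have := hw i (Finset.mem_Ioc.1 hi).1
    linarith
  rw [this, norm_real, Real.norm_eq_abs, abs_of_nonneg hw0]
  ring

/-- Partial summation against a nondecreasing nonnegative weight. -/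
theorem norm_sum_Ioc_monotone_mul_le (w : ℕ → ℝ) (g : ℕ → ℂ) {m n : ℕ} (hmn : m ≤ n) {B : ℝ}
    (hw : ∀ i, m < i → w i ≤ w (i + 1)) (hw0 : 0 ≤ w (m + 1))
    (hB : ∀ k ∈ Finset.Icc m n, ‖∑ i ∈ Finset.Ioc m k, g i‖ ≤ B) :
    ‖∑ i ∈ Finset.Ioc m n, (w i : ℂ) * g i‖ ≤ B * (2 * w (n + 1)) := by
  have hB0 : 0 ≤ B := (norm_nonneg _).trans (hB m (Finset.mem_Icc.2 ⟨le_rfl, hmn⟩))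
  refine (norm_sum_Ioc_mul_le (fun i => (w i : ℂ)) g hmn hB).trans ?_
  have h1 : ∑ i ∈ Finset.Ioc m n, ‖(w (i + 1) : ℂ) - w i‖ = w (n + 1) - w (m + 1) := by
    rw [← neg_sub, ← sum_Ioc_sub_succ w hmn, ← Finset.sum_neg_distrib]
    refine Finset.sum_congr rfl fun i hi => ?_
    rw [← ofReal_sub, norm_real, Real.norm_eq_abs, abs_of_nonneg]
    · ring
    · have := hw i (Finset.mem_Ioc.1 hi).1
      linarith
  have h2 : 0 ≤ w (n + 1) := by
    have : 0 ≤ ∑ i ∈ Finset.Ioc m n, ‖(w (i + 1) : ℂ) - w i‖ := by positivity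
    linarith
  rw [h1, norm_real, Real.norm_eq_abs, abs_of_nonneg h2]
  gcongr
  linarith

/-- Passing from bounds for smoothed partial sums to bounds for partial sums. -/
theorem norm_sum_Ioc_le_of_smoothed {a : ℕ → ℂ} {K L : ℝ} {N H : ℕ} (hH : 1 ≤ H) (hHN : H ≤ N)
    (hK : ∀ m : ℕ, 1 ≤ m → ‖∑ n ∈ Finset.Icc 1 m, a n * (1 - n / m)‖ ≤ K * m)
    (hL : ∀ n ∈ Finset.Ioc N (2 * N), ‖a n‖ ≤ L) :
    ‖∑ n ∈ Finset.Ioc 0 N, a n‖ ≤ 5 * K * N ^ 2 / H + H * L := by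
  set A : ℕ → ℂ := fun m => ∑ n ∈ Finset.Ioc 0 m, a n with hA
  set S : ℕ → ℂ := fun m => ∑ n ∈ Finset.Ioc 0 m, a n * (m - n) with hS
  have hSb : ∀ m : ℕ, 1 ≤ m → ‖S m‖ ≤ K * m ^ 2 := by
    intro m hm
    have hm0 : (m : ℂ) ≠ 0 := by exact_mod_cast (Nat.pos_of_ne_zero (by omega)).ne'
    have e : S m = m * ∑ n ∈ Finset.Icc 1 m, a n * (1 - n / m) := by
      rw [hS, Finset.mul_sum]
      refine Finset.sum_congr rfl fun n _ => ?_
      field_simp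
    rw [e, norm_mul, Complex.norm_natCast]
    calc (m : ℝ) * _ ≤ m * (K * m) := by gcongr; exact hK m hm
      _ = _ := by ring
  have hstep : ∀ m, S (m + 1) = S m + A m := by
    intro m
    simp only [hS, hA]
    rw [Finset.sum_Ioc_succ_top (by omega), sub_self, mul_zero, add_zero, ← Finset.sum_add_distrib]
    refine Finset.sum_congr rfl fun n _ => ?_
    push_cast; ring
  have hdiff : ∀ j, S (N + j) = S N + ∑ i ∈ Finset.range j, A (N + i) := by
    intro j
    induction j with
    | zero => simp
    | succ j ih => rw [← add_assoc, hstep, ih, Finset.sum_range_succ, add_assoc]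
  have hAd : ∀ i, i ≤ H → ‖A (N + i) - A N‖ ≤ H * L := by
    intro i hi
    have e : A (N + i) - A N = ∑ n ∈ Finset.Ioc N (N + i), a n := by
      rw [sub_eq_iff_eq_add', hA, Finset.sum_Ioc_consecutive _ (by omega) (by omega)]
    have hL0 : 0 ≤ L := (norm_nonneg _).trans (hL (N + 1) (Finset.mem_Ioc.2 ⟨by omega, by omega⟩))
    rw [e]
    calc _ ≤ ∑ n ∈ Finset.Ioc N (N + i), L := by
          refine (norm_sum_le _ _).trans (Finset.sum_le_sum fun n hn => hL n ?_)
          rw [Finset.mem_Ioc] at hn ⊢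
          omega
      _ = i * L := by simp
      _ ≤ _ := by gcongr
  have hH0 : (0 : ℝ) < H := by exact_mod_cast hH
  have hHN' : (H : ℝ) ≤ N := by exact_mod_cast hHN
  have e : (H : ℂ) * A N = S (N + H) - S N - ∑ i ∈ Finset.range H, (A (N + i) - A N) := by
    rw [hdiff, Finset.sum_sub_distrib]
    simp
  have hK0 : 0 ≤ K := by simpa using (norm_nonneg _).trans (hK 1 le_rfl)
  have hm : H * ‖A N‖ ≤ 5 * K * N ^ 2 + H * (H * L) := by
    calc H * ‖A N‖ = ‖(H : ℂ) * A N‖ := by rw [norm_mul, Complex.norm_natCast]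
      _ ≤ ‖S (N + H)‖ + ‖S N‖ + ∑ i ∈ Finset.range H, ‖A (N + i) - A N‖ := by
          rw [e]
          refine (norm_sub_le _ _).trans (add_le_add (norm_sub_le _ _) (norm_sum_le _ _))
      _ ≤ K * (N + H : ℕ) ^ 2 + K * N ^ 2 + ∑ i ∈ Finset.range H, H * L := by
          gcongr with i hi
          · exact hSb _ (by omega)
          · exact hSb _ (by omega)
          · exact hAd i (Finset.mem_range.1 hi).le
      _ ≤ _ := by
          rw [Finset.sum_const, Finset.card_range, nsmul_eq_mul]
          push_cast
          have : K * (N + H : ℝ) ^ 2 ≤ K * (N + N) ^ 2 := by gcongr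
          nlinarith
  rw [← mul_le_mul_iff_right₀ hH0]
  calc _ ≤ _ := hm
    _ = _ := by field_simp

end Abel

lemma log_pow_le_factorial_mul (j : ℕ) {x : ℝ} (hx : 1 ≤ x) : Real.log x ^ j ≤ j.factorial * x := by
  have := Real.pow_div_factorial_le_exp (x := Real.log x) (Real.log_nonneg hx) j
  rw [Real.exp_log (by linarith), div_le_iff₀ (by positivity)] at this
  linarith

section MoebiusTwist

theorem exists_norm_sum_log_pow_mul_moebiusTwist_le (j : ℕ) : ∃ C : ℝ, 0 < C ∧
    ∀ (q : ℕ) [NeZero q] (χ : DirichletCharacter ℂ q) (N : ℕ), (χ ≠ 1 ∨ q = 1) → 1 ≤ N →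
    ‖∑ n ∈ Finset.Ioc 0 N, (Real.log n : ℂ) ^ (2 * j) * moebiusTwist χ n‖ ≤
      C * q * N * Real.log (N + 2) ^ j := by
  obtain ⟨C, hC, h⟩ := exists_norm_sum_log_pow_mul_one_sub_le (2 * j)
  refine ⟨5 * C + (1 + 3 * j.factorial) * 4 ^ j, by positivity, fun q _ χ N hχ hN => ?_⟩
  have hN' : (1 : ℝ) ≤ N := by exact_mod_cast hN
  have hq : (1 : ℝ) ≤ q := by exact_mod_cast NeZero.one_le
  have hl := one_le_log_add_two hN
  set l := Real.log (N + 2) with hldef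
  have hlj : 1 ≤ l ^ j := one_le_pow₀ hl.le
  have hlj' : l ^ j ≤ 3 * j.factorial * N := by
    have := log_pow_le_factorial_mul j (x := N + 2) (by linarith)
    have h0 : (0 : ℝ) < j.factorial := by positivity
    nlinarith
  set H := ⌈(N : ℝ) / l ^ j⌉₊ with hH
  have hx : 0 < (N : ℝ) / l ^ j := by positivity
  have hH1 : (N : ℝ) / l ^ j ≤ H := Nat.le_ceil _
  have hH2 : (H : ℝ) ≤ (1 + 3 * j.factorial) * (N / l ^ j) := by
    have h1 := (Nat.ceil_lt_add_one hx.le).le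
    have h2 : 1 ≤ 3 * j.factorial * (N / l ^ j) := by
      rw [mul_div_assoc', le_div_iff₀ (by positivity)]
      linarith
    linarith
  have hHN : H ≤ N := by
    rw [hH, Nat.ceil_le]
    exact div_le_self (by positivity) hlj
  have hL : ∀ n ∈ Finset.Ioc N (2 * N),
      ‖(Real.log n : ℂ) ^ (2 * j) * moebiusTwist χ n‖ ≤ (2 * l) ^ (2 * j) := by
    intro n hn
    obtain ⟨hn1, hn2⟩ := Finset.mem_Ioc.1 hn
    have hn1' : (1 : ℝ) ≤ n := by exact_mod_cast (by omega : 1 ≤ n)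
    have hn2' : (n : ℝ) ≤ 2 * N := by exact_mod_cast hn2
    have hlog : Real.log n ≤ 2 * l := by
      rw [hldef, ← Real.log_rpow (by positivity)]
      refine Real.log_le_log (by positivity) ?_
      norm_num
      nlinarith
    rw [norm_mul, norm_pow, norm_real, Real.norm_eq_abs, abs_of_nonneg (Real.log_nonneg hn1')]
    calc _ ≤ (2 * l) ^ (2 * j) * 1 := by
          gcongr
          exact norm_moebiusTwist_le χ n
      _ = _ := mul_one _
  have hm := norm_sum_Ioc_le_of_smoothed (K := C * q) (Nat.ceil_pos.2 hx) hHN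
    (fun m hm => h q χ m hχ hm) hL
  refine hm.trans ?_
  have hl0 : 0 < l ^ j := by positivity
  have e1 : 5 * (C * q) * N ^ 2 / H ≤ 5 * C * q * N * l ^ j := by
    rw [div_le_iff₀ (hx.trans_le hH1)]
    calc 5 * (C * q) * N ^ 2 = 5 * C * q * N * l ^ j * (N / l ^ j) := by field_simp
      _ ≤ _ := by gcongr
  have e2 : H * (2 * l) ^ (2 * j) ≤ (1 + 3 * j.factorial) * 4 ^ j * N * l ^ j := by
    calc _ ≤ (1 + 3 * j.factorial) * (N / l ^ j) * (2 * l) ^ (2 * j) := by gcongr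
      _ = _ := by
        rw [mul_pow, pow_mul, mul_comm 2 j, pow_mul l]
        field_simp
        norm_num
  have e3 : (1 + 3 * j.factorial) * 4 ^ j * N * l ^ j * 1 ≤
    (1 + 3 * j.factorial) * 4 ^ j * N * l ^ j * (q : ℝ) := by gcongr
  linarith

theorem exists_norm_sum_moebiusTwist_le_div (j : ℕ) : ∃ C : ℝ, 0 < C ∧
    ∀ (q : ℕ) [NeZero q] (χ : DirichletCharacter ℂ q) (N : ℕ), (χ ≠ 1 ∨ q = 1) → 1 ≤ N →
    ‖∑ n ∈ Finset.Ioc 0 N, moebiusTwist χ n‖ ≤ C * q * N / Real.log (N + 2) ^ j := by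
  obtain ⟨C, hC, h⟩ := exists_norm_sum_log_pow_mul_moebiusTwist_le j
  refine ⟨3 * (2 * j).factorial + 2 * C * 16 ^ j, by positivity, fun q _ χ N hχ hN => ?_⟩
  have hN' : (1 : ℝ) ≤ N := by exact_mod_cast hN
  have hq : (1 : ℝ) ≤ q := by exact_mod_cast NeZero.one_le
  have hl := one_le_log_add_two hN
  set l := Real.log (N + 2) with hldef
  have hl0 : 0 < l := by linarith
  set Y := N.sqrt with hY
  have hY1 : 1 ≤ Y := Nat.sqrt_pos.2 hN
  have hYN : Y ≤ N := Nat.sqrt_le_self N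
  have hYs : (Y : ℝ) * Y ≤ N := by exact_mod_cast Nat.sqrt_le N
  have hYl : (N : ℝ) + 1 ≤ (Y + 1) * (Y + 1) := by
    exact_mod_cast Nat.succ_le_of_lt (Nat.lt_succ_sqrt N)
  rw [← Finset.sum_Ioc_consecutive _ (Nat.zero_le Y) hYN]
  have h1 : ‖∑ n ∈ Finset.Ioc 0 Y, moebiusTwist χ n‖ ≤ 3 * (2 * j).factorial * q * N / l ^ j := by
    have h2 : ‖∑ n ∈ Finset.Ioc 0 Y, moebiusTwist χ n‖ ≤ Y := by
      refine (norm_sum_le _ _).trans ((Finset.sum_le_sum fun n _ => norm_moebiusTwist_le χ n).trans ?_)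
      simp
    have hF : (1 : ℝ) ≤ (2 * j).factorial := by exact_mod_cast Nat.one_le_iff_ne_zero.2 (Nat.factorial_ne_zero _)
    have h3 : Y * l ^ j ≤ 3 * (2 * j).factorial * N := by
      refine abs_le_of_sq_le_sq' ?_ (by positivity) |>.2
      have h4 := log_pow_le_factorial_mul (2 * j) (x := N + 2) (by linarith)
      calc ((Y : ℝ) * l ^ j) ^ 2 = Y * Y * l ^ (2 * j) := by ring
        _ ≤ N * ((2 * j).factorial * (N + 2)) := by gcongr
        _ ≤ N * ((2 * j).factorial * (3 * N)) := by gcongr; linarith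
        _ = 3 * (2 * j).factorial * N ^ 2 * 1 := by ring
        _ ≤ 3 * (2 * j).factorial * N ^ 2 * (3 * (2 * j).factorial) := by gcongr; linarith
        _ = _ := by ring
    rw [le_div_iff₀ (by positivity)]
    have h5 : 3 * (2 * j).factorial * N * 1 ≤ 3 * (2 * j).factorial * N * (q : ℝ) := by gcongr
    have h6 : ‖∑ n ∈ Finset.Ioc 0 Y, moebiusTwist χ n‖ * l ^ j ≤ Y * l ^ j := by gcongr
    linarith
  have hlogY : l / 4 ≤ Real.log (Y + 1 : ℕ) := by
    rw [div_le_iff₀ (by norm_num), hldef, mul_comm, ← Real.log_rpow (by positivity)]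
    refine Real.log_le_log (by positivity) ?_
    push_cast
    rw [show (4 : ℝ) = (4 : ℕ) by norm_num, Real.rpow_natCast]
    calc (N : ℝ) + 2 ≤ (N + 1) * (N + 1) := by nlinarith
      _ ≤ ((Y + 1) * (Y + 1)) * ((Y + 1) * (Y + 1)) := by gcongr
      _ = _ := by ring
  have hlogpos : ∀ i : ℕ, Y < i → 0 < Real.log i := fun i hi =>
    Real.log_pos (by exact_mod_cast (by omega : 1 < i))
  have h2 : ‖∑ n ∈ Finset.Ioc Y N, moebiusTwist χ n‖ ≤ 2 * C * 16 ^ j * q * N / l ^ j := by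
    have e : ∑ n ∈ Finset.Ioc Y N, moebiusTwist χ n = ∑ n ∈ Finset.Ioc Y N,
        (((Real.log n ^ (2 * j))⁻¹ : ℝ) : ℂ) * ((Real.log n : ℂ) ^ (2 * j) * moebiusTwist χ n) := by
      refine Finset.sum_congr rfl fun n hn => ?_
      have h0 : (Real.log n : ℂ) ≠ 0 := by exact_mod_cast (hlogpos n (Finset.mem_Ioc.1 hn).1).ne'
      rw [ofReal_inv, ofReal_pow, inv_mul_cancel_left₀ (pow_ne_zero _ h0)]
    have hA : ∀ k : ℕ, 1 ≤ k → k ≤ N →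
        ‖∑ n ∈ Finset.Ioc 0 k, (Real.log n : ℂ) ^ (2 * j) * moebiusTwist χ n‖ ≤
        C * q * N * l ^ j := by
      intro k hk hkN
      have hkN' : (k : ℝ) ≤ N := by exact_mod_cast hkN
      refine (h q χ k hχ hk).trans ?_
      have := one_le_log_add_two hk
      gcongr
      rw [hldef]
      gcongr
    rw [e]
    refine (norm_sum_Ioc_antitone_mul_le (fun n => (Real.log n ^ (2 * j))⁻¹) _ hYN
      (B := 2 * (C * q * N * l ^ j)) ?_ ?_ ?_).trans ?_
    · intro i hi
      have := hlogpos i hi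
      have hi0 : (0 : ℝ) < i := by exact_mod_cast (by omega : 0 < i)
      gcongr
      simp
    · have := hlogpos (N + 1) (by omega)
      positivity
    · intro k hk
      obtain ⟨hk1, hk2⟩ := Finset.mem_Icc.1 hk
      have e2 := Finset.sum_Ioc_consecutive
        (fun n => (Real.log n : ℂ) ^ (2 * j) * moebiusTwist χ n) (Nat.zero_le Y) hk1
      rw [← eq_sub_iff_add_eq'] at e2
      rw [e2, two_mul (C * q * N * l ^ j)]
      exact (norm_sub_le _ _).trans (add_le_add (hA k (by omega) hk2) (hA Y hY1 hYN))
    · have hw : (Real.log (Y + 1 : ℕ) ^ (2 * j))⁻¹ ≤ ((l / 4) ^ (2 * j))⁻¹ := by gcongr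
      calc _ ≤ 2 * (C * q * N * l ^ j) * ((l / 4) ^ (2 * j))⁻¹ := by gcongr
        _ = _ := by
          rw [div_pow, pow_mul 4, mul_comm 2 j, pow_mul l]
          field_simp
          norm_num
  calc _ ≤ _ := norm_add_le _ _
    _ ≤ _ := add_le_add h1 h2
    _ = _ := by ring

end MoebiusTwist

section Decay

/-- The function `x / (log x) ^ A`, with the logarithm shifted so as to be monotone. -/
noncomputable def decay (A : ℕ) (x : ℝ) : ℝ := x / Real.log (x + Real.exp (2 * A)) ^ A

lemma log_add_exp_ge (A : ℕ) {x : ℝ} (hx : 0 ≤ x) : 2 * A ≤ Real.log (x + Real.exp (2 * A)) := by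
  rw [Real.le_log_iff_exp_le (by positivity)]
  linarith

lemma one_le_log_add_exp_pow (A : ℕ) {x : ℝ} (hx : 0 ≤ x) :
    1 ≤ Real.log (x + Real.exp (2 * A)) ^ A := by
  rcases Nat.eq_zero_or_pos A with rfl | hA
  · simp
  · have hA' : (1 : ℝ) ≤ A := by exact_mod_cast hA
    exact one_le_pow₀ (by linarith [log_add_exp_ge A hx])

lemma decay_nonneg (A : ℕ) {x : ℝ} (hx : 0 ≤ x) : 0 ≤ decay A x :=
  div_nonneg hx (zero_le_one.trans (one_le_log_add_exp_pow A hx))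

lemma sqrt_mul_decay_le (A : ℕ) {x r : ℝ} (hx : 0 ≤ x) (hr : 1 ≤ r) :
    √r * decay A x ≤ decay A (r * x) := by
  have hc : (1 : ℝ) ≤ Real.exp (2 * A) := Real.one_le_exp (by positivity)
  set c := Real.exp (2 * A) with hcdef
  have h1 := one_le_log_add_exp_pow A hx
  have h2 := one_le_log_add_exp_pow A (x := r * x) (by positivity)
  have hkey : Real.log (r * x + c) ^ A ≤ √r * Real.log (x + c) ^ A := by
    rcases Nat.eq_zero_or_pos A with rfl | hA
    · simpa using hr
    · have hA' : (1 : ℝ) ≤ A := by exact_mod_cast hA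
      have hl := log_add_exp_ge A hx
      rw [← hcdef] at hl
      have hlr : 0 ≤ Real.log r := Real.log_nonneg hr
      have h3 : Real.log (r * x + c) ≤ Real.exp (Real.log r / (2 * A)) * Real.log (x + c) := by
        calc Real.log (r * x + c) ≤ Real.log (r * (x + c)) := by
              refine Real.log_le_log (by positivity) ?_
              nlinarith
          _ = Real.log r + Real.log (x + c) := Real.log_mul (by positivity) (by positivity)
          _ ≤ Real.log r / (2 * A) * Real.log (x + c) + Real.log (x + c) := by
              gcongr
              rw [div_mul_eq_mul_div, le_div_iff₀ (by positivity)]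
              gcongr
          _ = (Real.log r / (2 * A) + 1) * Real.log (x + c) := by ring
          _ ≤ _ := by
              gcongr
              · linarith
              · exact Real.add_one_le_exp _
      calc Real.log (r * x + c) ^ A
          ≤ (Real.exp (Real.log r / (2 * A)) * Real.log (x + c)) ^ A := by
            gcongr
            exact Real.log_nonneg (by nlinarith)
        _ = √r * Real.log (x + c) ^ A := by
            rw [mul_pow, ← Real.exp_nat_mul, Real.sqrt_eq_rpow, Real.rpow_def_of_pos (by linarith)]
            congr 2
            field_simp
  rw [decay, decay, ← hcdef, ← mul_div_assoc, div_le_div_iff₀ (by linarith) (by linarith)]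
  calc √r * x * Real.log (r * x + c) ^ A ≤ √r * x * (√r * Real.log (x + c) ^ A) := by gcongr
    _ = (√r * √r) * x * Real.log (x + c) ^ A := by ring
    _ = _ := by rw [Real.mul_self_sqrt (by linarith)]

lemma decay_mono (A : ℕ) {x y : ℝ} (hx : 0 ≤ x) (hxy : x ≤ y) : decay A x ≤ decay A y := by
  rcases hx.eq_or_lt with rfl | hx0
  · simpa [decay] using decay_nonneg A hxy
  · have hr : 1 ≤ y / x := (one_le_div hx0).2 hxy
    have h := sqrt_mul_decay_le A hx hr
    rw [div_mul_cancel₀ _ hx0.ne'] at h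
    exact (le_mul_of_one_le_left (decay_nonneg A hx) (Real.one_le_sqrt.2 hr)).trans h

lemma decay_div_le (A : ℕ) {x d : ℝ} (hx : 0 ≤ x) (hd : 1 ≤ d) :
    decay A (x / d) ≤ decay A x / √d := by
  have hd0 : 0 < √d := Real.sqrt_pos.2 (by linarith)
  rw [le_div_iff₀ hd0, mul_comm]
  have h := sqrt_mul_decay_le A (x := x / d) (by positivity) hd
  rwa [mul_div_cancel₀ _ (by linarith : d ≠ 0)] at h

lemma decay_natCast_div_le (A N d : ℕ) : decay A (N / d : ℕ) ≤ decay A N :=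
  decay_mono A (by positivity) (by exact_mod_cast Nat.div_le_self N d)

end Decay

theorem exists_norm_sum_moebiusTwist_le_decay (A : ℕ) : ∃ C : ℝ, 0 < C ∧
    ∀ (q : ℕ) [NeZero q] (χ : DirichletCharacter ℂ q) (N : ℕ), (χ ≠ 1 ∨ q = 1) →
    ‖∑ n ∈ Finset.Ioc 0 N, moebiusTwist χ n‖ ≤ C * q * decay A N := by
  obtain ⟨C, hC, h⟩ := exists_norm_sum_moebiusTwist_le_div A
  refine ⟨C * (1 + 2 * A) ^ A, by positivity, fun q _ χ N hχ => ?_⟩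
  rcases Nat.eq_zero_or_pos N with rfl | hN
  · simp [decay]
  have hN' : (1 : ℝ) ≤ N := by exact_mod_cast hN
  refine (h q χ N hχ hN).trans ?_
  have hl := one_le_log_add_two hN
  have hc : (1 : ℝ) ≤ Real.exp (2 * A) := Real.one_le_exp (by positivity)
  have h1 := one_le_log_add_exp_pow A (x := N) (by linarith)
  have hlog : Real.log (N + Real.exp (2 * A)) ≤ (1 + 2 * A) * Real.log (N + 2) := by
    calc Real.log (N + Real.exp (2 * A)) ≤ Real.log ((N + 2) * Real.exp (2 * A)) := by
          refine Real.log_le_log (by positivity) ?_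
          nlinarith
      _ = Real.log (N + 2) + 2 * A := by
          rw [Real.log_mul (by positivity) (by positivity), Real.log_exp]
      _ ≤ _ := by
          have : (0 : ℝ) ≤ 2 * A := by positivity
          nlinarith
  have hlog' : Real.log (N + Real.exp (2 * A)) ^ A ≤ (1 + 2 * A) ^ A * Real.log (N + 2) ^ A := by
    rw [← mul_pow]
    gcongr
    exact Real.log_nonneg (by linarith)
  rw [decay, ← mul_div_assoc, div_le_div_iff₀ (by positivity) (by linarith)]
  calc C * q * N * Real.log (N + Real.exp (2 * A)) ^ A
      ≤ C * q * N * ((1 + 2 * A) ^ A * Real.log (N + 2) ^ A) := by gcongr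
    _ = _ := by ring

section Sifted

/-- The summatory function of the Möbius function over integers free of the primes in `P`. -/
noncomputable def siftedMoebiusSum (P : Finset ℕ) (N : ℕ) : ℂ :=
  ∑ n ∈ Finset.Ioc 0 N with ∀ p ∈ P, ¬ p ∣ n, (ArithmeticFunction.moebius n : ℂ)

lemma siftedMoebiusSum_insert {P : Finset ℕ} (hP : ∀ p ∈ P, p.Prime) {p : ℕ} (hp : p.Prime)
    (hpP : p ∉ P) (N : ℕ) : siftedMoebiusSum (insert p P) N =
      siftedMoebiusSum P N + siftedMoebiusSum (insert p P) (N / p) := by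
  have hsplit : siftedMoebiusSum P N = siftedMoebiusSum (insert p P) N +
      ∑ n ∈ Finset.Ioc 0 N with (∀ p ∈ P, ¬ p ∣ n) ∧ p ∣ n, (ArithmeticFunction.moebius n : ℂ) := by
    rw [siftedMoebiusSum, siftedMoebiusSum,
      ← Finset.sum_filter_add_sum_filter_not _ (fun n => ¬ p ∣ n), Finset.filter_filter,
      Finset.filter_filter]
    congr 2
    · ext n
      simp only [Finset.mem_filter, Finset.forall_mem_insert]
      tauto
    · ext n
      simp only [Finset.mem_filter, not_not]
  have hdiv : ∑ n ∈ Finset.Ioc 0 N with (∀ p ∈ P, ¬ p ∣ n) ∧ p ∣ n,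
      (ArithmeticFunction.moebius n : ℂ) = - siftedMoebiusSum (insert p P) (N / p) := by
    have h1 : ∑ n ∈ Finset.Ioc 0 N with (∀ p ∈ P, ¬ p ∣ n) ∧ p ∣ n,
        (ArithmeticFunction.moebius n : ℂ) = ∑ m ∈ Finset.Ioc 0 (N / p) with ∀ p ∈ P, ¬ p ∣ m,
          (ArithmeticFunction.moebius (p * m) : ℂ) := by
      symm
      refine Finset.sum_bij (fun m _ => p * m) ?_ ?_ ?_ (fun _ _ => rfl)
      · intro m hm
        simp only [Finset.mem_filter, Finset.mem_Ioc] at hm ⊢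
        obtain ⟨⟨h1, h2⟩, h3⟩ := hm
        refine ⟨⟨Nat.mul_pos hp.pos h1, ?_⟩, fun r hr hrm => ?_, dvd_mul_right _ _⟩
        · rw [mul_comm]; exact (Nat.le_div_iff_mul_le hp.pos).1 h2
        · rcases (hP r hr).dvd_mul.1 hrm with h | h
          · rw [(Nat.prime_dvd_prime_iff_eq (hP r hr) hp).1 h] at hr
            exact hpP hr
          · exact h3 r hr h
      · intro a _ b _ h
        exact Nat.eq_of_mul_eq_mul_left hp.pos h
      · intro n hn
        simp only [Finset.mem_filter, Finset.mem_Ioc] at hn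
        obtain ⟨⟨h1, h2⟩, h3, m, rfl⟩ := hn
        refine ⟨m, ?_, rfl⟩
        simp only [Finset.mem_filter, Finset.mem_Ioc]
        refine ⟨⟨Nat.pos_of_mul_pos_left h1, ?_⟩, fun r hr hrm => h3 r hr (hrm.mul_left _)⟩
        rw [Nat.le_div_iff_mul_le hp.pos, mul_comm]; exact h2
    rw [h1, siftedMoebiusSum, ← Finset.sum_neg_distrib]
    symm
    refine Finset.sum_subset_zero_on_sdiff ?_ ?_ ?_
    · intro m hm
      simp only [Finset.mem_filter, Finset.forall_mem_insert] at hm ⊢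
      exact ⟨hm.1, hm.2.2⟩
    · intro m hm
      simp only [Finset.mem_sdiff, Finset.mem_filter, Finset.forall_mem_insert] at hm
      have hpm : p ∣ m := by
        by_contra h
        exact hm.2 ⟨hm.1.1, h, hm.1.2⟩
      rw [ArithmeticFunction.moebius_eq_zero_of_not_squarefree]
      · simp
      · intro hs
        have := hs p (mul_dvd_mul_left p hpm)
        exact hp.not_isUnit this
    · intro m hm
      simp only [Finset.mem_filter, Finset.forall_mem_insert] at hm
      rw [ArithmeticFunction.isMultiplicative_moebius.map_mul_of_coprime
        ((Nat.Prime.coprime_iff_not_dvd hp).2 hm.2.1), ArithmeticFunction.moebius_apply_prime hp]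
      push_cast
      ring
  rw [hsplit, hdiv]
  ring

lemma norm_siftedMoebiusSum_insert_le (A : ℕ) {P : Finset ℕ} (hP : ∀ p ∈ P, p.Prime) {p : ℕ}
    (hp : p.Prime) (hpP : p ∉ P) {K : ℝ} (hK : 0 ≤ K)
    (h : ∀ N, ‖siftedMoebiusSum P N‖ ≤ K * decay A N) (N : ℕ) :
    ‖siftedMoebiusSum (insert p P) N‖ ≤ 4 * K * decay A N := by
  induction N using Nat.strong_induction_on with
  | _ N ih =>
    rcases Nat.eq_zero_or_pos N with rfl | hN
    · simp [siftedMoebiusSum, decay]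
    have h0 := decay_nonneg A (x := N) (by positivity)
    have hp2 : (2 : ℝ) ≤ p := by exact_mod_cast hp.two_le
    have hd : decay A (N / p : ℕ) ≤ decay A N * (3 / 4) := by
      calc decay A (N / p : ℕ) ≤ decay A ((N : ℝ) / p) :=
            decay_mono A (by positivity) Nat.cast_div_le
        _ ≤ decay A N / √p := decay_div_le A (by positivity) (by linarith)
        _ ≤ _ := by
          rw [div_eq_mul_inv]
          gcongr
          rw [inv_le_comm₀ (by positivity) (by norm_num)]
          exact Real.le_sqrt_of_sq_le (by norm_num; linarith)
    rw [siftedMoebiusSum_insert hP hp hpP]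
    calc _ ≤ ‖siftedMoebiusSum P N‖ + ‖siftedMoebiusSum (insert p P) (N / p)‖ := norm_add_le _ _
      _ ≤ K * decay A N + 4 * K * (decay A N * (3 / 4)) := by
          refine add_le_add (h N) ((ih _ (Nat.div_lt_self hN hp.one_lt)).trans ?_)
          gcongr
      _ = _ := by ring

lemma norm_siftedMoebiusSum_le (A : ℕ) {K : ℝ} (hK : 0 ≤ K)
    (h : ∀ N, ‖siftedMoebiusSum ∅ N‖ ≤ K * decay A N) {P : Finset ℕ} (hP : ∀ p ∈ P, p.Prime)
    (N : ℕ) : ‖siftedMoebiusSum P N‖ ≤ 4 ^ P.card * K * decay A N := by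
  induction P using Finset.induction_on generalizing N with
  | empty => simpa using h N
  | insert p P hp ih =>
    rw [Finset.forall_mem_insert] at hP
    rw [Finset.card_insert_of_notMem hp, pow_succ', mul_assoc 4]
    exact norm_siftedMoebiusSum_insert_le A hP.2 hP.1 hp (by positivity) (ih hP.2) N

lemma two_pow_card_primeFactors_le {q : ℕ} (hq : q ≠ 0) : 2 ^ q.primeFactors.card ≤ q :=
  calc 2 ^ q.primeFactors.card ≤ ∏ p ∈ q.primeFactors, p :=
        Finset.pow_card_le_prod _ _ _ fun _ hp => (Nat.prime_of_mem_primeFactors hp).two_le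
    _ ≤ q := Nat.le_of_dvd (Nat.pos_of_ne_zero hq) (Nat.prod_primeFactors_dvd q)

lemma coprime_iff_forall_primeFactors {q n : ℕ} (hq : q ≠ 0) :
    n.Coprime q ↔ ∀ p ∈ q.primeFactors, ¬ p ∣ n := by
  rw [← not_iff_not, Nat.Prime.not_coprime_iff_dvd]
  push Not
  simp only [Nat.mem_primeFactors]
  constructor
  · rintro ⟨p, hp, h1, h2⟩
    exact ⟨p, ⟨hp, h2, hq⟩, h1⟩
  · rintro ⟨p, ⟨hp, h2, -⟩, h1⟩
    exact ⟨p, hp, h1, h2⟩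

lemma sum_moebiusTwist_one {q : ℕ} [NeZero q] (N : ℕ) :
    ∑ n ∈ Finset.Ioc 0 N, moebiusTwist (1 : DirichletCharacter ℂ q) n =
      siftedMoebiusSum q.primeFactors N := by
  rw [siftedMoebiusSum, Finset.sum_filter]
  refine Finset.sum_congr rfl fun n _ => ?_
  rw [moebiusTwist]
  split_ifs with h
  · rw [MulChar.one_apply ((ZMod.isUnit_iff_coprime _ _).2
      ((coprime_iff_forall_primeFactors (NeZero.ne q)).2 h)), one_mul]
  · rw [MulChar.map_nonunit, zero_mul]
    rwa [ZMod.isUnit_iff_coprime, coprime_iff_forall_primeFactors (NeZero.ne q)]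

/-- The Möbius function has small summatory function when twisted by any Dirichlet character,
with polynomial dependence on the modulus. -/
theorem exists_norm_sum_moebiusTwist_le (A : ℕ) : ∃ C : ℝ, 0 < C ∧
    ∀ (q : ℕ) [NeZero q] (χ : DirichletCharacter ℂ q) (N : ℕ),
    ‖∑ n ∈ Finset.Ioc 0 N, moebiusTwist χ n‖ ≤ C * q ^ 2 * decay A N := by
  obtain ⟨C, hC, h⟩ := exists_norm_sum_moebiusTwist_le_decay A
  refine ⟨C, hC, fun q _ χ N => ?_⟩
  have hq : (1 : ℝ) ≤ q := by exact_mod_cast NeZero.one_le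
  have h0 := decay_nonneg A (x := N) (by positivity)
  by_cases hχ : χ = 1
  · subst hχ
    have h1 : ∀ N, ‖siftedMoebiusSum ∅ N‖ ≤ C * decay A N := by
      intro N
      have := h 1 1 N (.inr rfl)
      rw [sum_moebiusTwist_one] at this
      simpa using this
    rw [sum_moebiusTwist_one]
    refine (norm_siftedMoebiusSum_le A hC.le h1
      (fun p hp => Nat.prime_of_mem_primeFactors hp) N).trans ?_
    have : (4 : ℝ) ^ q.primeFactors.card ≤ q ^ 2 := by
      rw [show (4 : ℝ) = 2 ^ 2 by norm_num, ← pow_mul, mul_comm, pow_mul]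
      gcongr
      exact_mod_cast two_pow_card_primeFactors_le (NeZero.ne q)
    calc _ ≤ (q : ℝ) ^ 2 * C * decay A N := by gcongr
      _ = _ := by ring
  · refine (h q χ N (.inl hχ)).trans ?_
    gcongr
    nlinarith

end Sifted

section MajorArcs

lemma norm_sum_moebius_residue_le {q : ℕ} [NeZero q] {r : ZMod q} (hr : IsUnit r) {N : ℕ} {K : ℝ}
    (hK : ∀ χ : DirichletCharacter ℂ q, ‖∑ n ∈ Finset.Ioc 0 N, moebiusTwist χ n‖ ≤ K) :
    ‖∑ n ∈ Finset.Ioc 0 N with ((n : ℕ) : ZMod q) = r, (ArithmeticFunction.moebius n : ℂ)‖ ≤ K := by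
  have hphi : (q.totient : ℂ) ≠ 0 := by
    exact_mod_cast (Nat.totient_pos.2 (NeZero.pos q)).ne'
  have e : (q.totient : ℂ) * ∑ n ∈ Finset.Ioc 0 N with ((n : ℕ) : ZMod q) = r,
      (ArithmeticFunction.moebius n : ℂ) =
      ∑ χ : DirichletCharacter ℂ q, χ r⁻¹ * ∑ n ∈ Finset.Ioc 0 N, moebiusTwist χ n := by
    simp_rw [Finset.mul_sum]
    rw [Finset.sum_comm, Finset.sum_filter]
    refine Finset.sum_congr rfl fun n _ => ?_
    have h := DirichletCharacter.sum_char_inv_mul_char_eq ℂ hr (n : ZMod q)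
    simp_rw [moebiusTwist, ← mul_assoc, ← Finset.sum_mul, h, eq_comm (a := r)]
    split_ifs <;> simp
  have hcard : ∑ _χ : DirichletCharacter ℂ q, K = q.totient * K := by
    rw [Finset.sum_const, Finset.card_univ, nsmul_eq_mul, ← Nat.card_eq_fintype_card,
      DirichletCharacter.card_eq_totient_of_hasEnoughRootsOfUnity]
  have hphi' : (0 : ℝ) < q.totient := by exact_mod_cast Nat.totient_pos.2 (NeZero.pos q)
  rw [← mul_le_mul_iff_right₀ hphi', ← hcard]
  calc _ = ‖(q.totient : ℂ) * ∑ n ∈ Finset.Ioc 0 N with ((n : ℕ) : ZMod q) = r,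
        (ArithmeticFunction.moebius n : ℂ)‖ := by rw [norm_mul, Complex.norm_natCast]
    _ ≤ ∑ χ : DirichletCharacter ℂ q, ‖χ r⁻¹ * ∑ n ∈ Finset.Ioc 0 N, moebiusTwist χ n‖ := by
        rw [e]; exact norm_sum_le _ _
    _ ≤ _ := by
        refine Finset.sum_le_sum fun χ _ => ?_
        rw [norm_mul]
        exact (mul_le_of_le_one_left (norm_nonneg _) (χ.norm_le_one _)).trans (hK χ)

lemma norm_sum_moebius_coprime_mul_le {q : ℕ} [NeZero q] {N : ℕ} {K : ℝ}
    (hK : ∀ χ : DirichletCharacter ℂ q, ‖∑ n ∈ Finset.Ioc 0 N, moebiusTwist χ n‖ ≤ K)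
    {F : ZMod q → ℂ} (hF : ∀ r, ‖F r‖ ≤ 1) :
    ‖∑ n ∈ Finset.Ioc 0 N with n.Coprime q, (ArithmeticFunction.moebius n : ℂ) * F n‖ ≤ q * K := by
  classical
  have e : ∑ n ∈ Finset.Ioc 0 N with n.Coprime q, (ArithmeticFunction.moebius n : ℂ) * F n =
      ∑ r : ZMod q with IsUnit r, F r * ∑ n ∈ Finset.Ioc 0 N with ((n : ℕ) : ZMod q) = r,
        (ArithmeticFunction.moebius n : ℂ) := by
    simp_rw [← ZMod.isUnit_iff_coprime]
    rw [← Finset.sum_fiberwise_of_maps_to (s := {n ∈ Finset.Ioc 0 N | IsUnit ((n : ℕ) : ZMod q)})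
      (t := ({r | IsUnit r} : Finset (ZMod q))) (g := fun n => ((n : ℕ) : ZMod q))
      (fun n hn => by simpa using (Finset.mem_filter.1 hn).2)]
    refine Finset.sum_congr rfl fun r hr => ?_
    rw [Finset.filter_filter, Finset.mul_sum]
    refine Finset.sum_congr ?_ fun n hn => ?_
    · ext n
      have := (Finset.mem_filter.1 hr).2
      simp only [Finset.mem_filter]
      constructor
      · rintro ⟨h1, -, h2⟩; exact ⟨h1, h2⟩
      · rintro ⟨h1, h2⟩; exact ⟨h1, h2 ▸ this, h2⟩
    · rw [(Finset.mem_filter.1 hn).2, mul_comm]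
  have hK0 : 0 ≤ K := (norm_nonneg _).trans (hK 1)
  rw [e]
  calc _ ≤ ∑ r : ZMod q with IsUnit r, K := by
        refine (norm_sum_le _ _).trans (Finset.sum_le_sum fun r hr => ?_)
        rw [norm_mul]
        exact (mul_le_of_le_one_left (norm_nonneg _) (hF r)).trans
          (norm_sum_moebius_residue_le (Finset.mem_filter.1 hr).2 hK)
    _ ≤ ∑ r : ZMod q, K :=
        Finset.sum_le_sum_of_subset_of_nonneg (Finset.filter_subset _ _) fun _ _ _ => hK0
    _ = _ := by simp [ZMod.card]

lemma moebius_mul_eq (d m : ℕ) : ArithmeticFunction.moebius (d * m) =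
    if m.Coprime d then ArithmeticFunction.moebius d * ArithmeticFunction.moebius m else 0 := by
  split_ifs with h
  · exact ArithmeticFunction.isMultiplicative_moebius.map_mul_of_coprime h.symm
  · rw [ArithmeticFunction.moebius_eq_zero_of_not_squarefree]
    intro hs
    exact h (Nat.squarefree_mul_iff.1 hs).1.symm

/-- The Möbius function has small correlation with periodic functions. -/
theorem exists_norm_sum_moebius_mul_periodic_le (A : ℕ) : ∃ C : ℝ, 0 < C ∧
    ∀ (q : ℕ) [NeZero q] (F : ZMod q → ℂ) (_ : ∀ r, ‖F r‖ ≤ 1) (N : ℕ),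
    ‖∑ n ∈ Finset.Ioc 0 N, (ArithmeticFunction.moebius n : ℂ) * F n‖ ≤ C * q ^ 4 * decay A N := by
  obtain ⟨C, hC, h⟩ := exists_norm_sum_moebiusTwist_le A
  refine ⟨C, hC, fun q _ F hF N => ?_⟩
  have hq0 := NeZero.ne q
  have e : ∑ n ∈ Finset.Ioc 0 N, (ArithmeticFunction.moebius n : ℂ) * F n =
      ∑ d ∈ q.divisors, (ArithmeticFunction.moebius d : ℂ) *
        ∑ m ∈ Finset.Ioc 0 (N / d) with m.Coprime q,
          (ArithmeticFunction.moebius m : ℂ) * F (d * m) := by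
    rw [← Finset.sum_fiberwise_of_maps_to (t := q.divisors) (g := fun n => n.gcd q)
      (fun n _ => Nat.mem_divisors.2 ⟨Nat.gcd_dvd_right _ _, hq0⟩)]
    refine Finset.sum_congr rfl fun d hd => ?_
    have hdq := Nat.dvd_of_mem_divisors hd
    obtain ⟨c, rfl⟩ := hdq
    have hd0 : 0 < d := Nat.pos_of_mem_divisors hd
    rw [Finset.mul_sum]
    symm
    have h1 : ∑ n ∈ Finset.Ioc 0 N with n.gcd (d * c) = d,
        (ArithmeticFunction.moebius n : ℂ) * F n =
        ∑ m ∈ Finset.Ioc 0 (N / d) with m.Coprime c,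
        (ArithmeticFunction.moebius (d * m) : ℂ) * F (d * m) := by
      symm
      refine Finset.sum_bij (fun m _ => d * m) ?_ ?_ ?_ (fun m _ => by push_cast; rfl)
      · intro m hm
        simp only [Finset.mem_filter, Finset.mem_Ioc] at hm ⊢
        obtain ⟨⟨h1, h2⟩, h3⟩ := hm
        refine ⟨⟨Nat.mul_pos hd0 h1, ?_⟩, ?_⟩
        · rw [mul_comm]; exact (Nat.le_div_iff_mul_le hd0).1 h2
        · rw [Nat.gcd_mul_left, h3, mul_one]
      · intro a _ b _ h
        exact Nat.eq_of_mul_eq_mul_left hd0 h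
      · intro n hn
        simp only [Finset.mem_filter, Finset.mem_Ioc] at hn
        obtain ⟨⟨h1, h2⟩, h3⟩ := hn
        obtain ⟨m, rfl⟩ : d ∣ n := by
          have := Nat.gcd_dvd_left n (d * c)
          rwa [h3] at this
        refine ⟨m, ?_, rfl⟩
        simp only [Finset.mem_filter, Finset.mem_Ioc]
        refine ⟨⟨Nat.pos_of_mul_pos_left h1, ?_⟩, ?_⟩
        · rw [Nat.le_div_iff_mul_le hd0, mul_comm]; exact h2
        · rw [Nat.gcd_mul_left] at h3
          exact Nat.eq_of_mul_eq_mul_left hd0 (h3.trans (mul_one d).symm)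
    rw [h1]
    refine Finset.sum_subset_zero_on_sdiff ?_ ?_ ?_
    · intro m hm
      simp only [Finset.mem_filter] at hm ⊢
      exact ⟨hm.1, hm.2.coprime_dvd_right (dvd_mul_left _ _)⟩
    · intro m hm
      simp only [Finset.mem_sdiff, Finset.mem_filter] at hm
      rw [moebius_mul_eq, if_neg]
      · simp
      · intro hmd
        exact hm.2 ⟨hm.1.1, Nat.Coprime.mul_right hmd hm.1.2⟩
    · intro m hm
      simp only [Finset.mem_filter] at hm
      rw [moebius_mul_eq, if_pos (hm.2.coprime_dvd_right (dvd_mul_right _ _))]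
      push_cast
      ring
  have h0 := decay_nonneg A (x := N) (by positivity)
  rw [e]
  calc _ ≤ ∑ d ∈ q.divisors, q * (C * q ^ 2 * decay A N) := by
        refine (norm_sum_le _ _).trans (Finset.sum_le_sum fun d _ => ?_)
        rw [norm_mul]
        refine (mul_le_of_le_one_left (norm_nonneg _) (norm_moebius_le d)).trans ?_
        refine norm_sum_moebius_coprime_mul_le (F := fun r => F ((d : ZMod q) * r)) (fun χ => ?_)
          (fun r => hF _)
        refine (h q χ _).trans ?_
        gcongr
        exact decay_natCast_div_le A N d
    _ ≤ q * (q * (C * q ^ 2 * decay A N)) := by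
        rw [Finset.sum_const, nsmul_eq_mul]
        gcongr
        exact Nat.card_divisors_le_self q
    _ = _ := by ring

/-- The additive character `x ↦ exp (2 π i x)`. -/
noncomputable def expi (x : ℝ) : ℂ := cexp (2 * Real.pi * x * I)

lemma expi_add (x y : ℝ) : expi (x + y) = expi x * expi y := by
  rw [expi, expi, expi, ← Complex.exp_add]
  push_cast
  ring_nf

lemma norm_expi (x : ℝ) : ‖expi x‖ = 1 := by
  rw [expi, show (2 * Real.pi * x * I : ℂ) = (2 * Real.pi * x : ℝ) * I by push_cast; ring,
    norm_exp_ofReal_mul_I]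

@[simp] lemma expi_zero : expi 0 = 1 := by simp [expi]

lemma expi_neg (x : ℝ) : expi (-x) = (starRingEnd ℂ) (expi x) := by
  rw [expi, expi, ← exp_conj]
  simp [Complex.conj_ofNat]

@[simp] lemma expi_intCast (n : ℤ) : expi n = 1 := by
  rw [expi, Complex.exp_eq_one_iff]
  exact ⟨n, by push_cast; ring⟩

lemma expi_add_intCast (x : ℝ) (n : ℤ) : expi (x + n) = expi x := by
  rw [expi_add, expi_intCast, mul_one]

lemma expi_nat_mul (n : ℕ) (x : ℝ) : expi (n * x) = expi x ^ n := by
  rw [expi, expi, ← Complex.exp_nat_mul]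
  push_cast
  ring_nf

lemma norm_expi_sub_one_le (x : ℝ) : ‖expi x - 1‖ ≤ 2 * Real.pi * |x| := by
  have h := Real.norm_exp_I_mul_ofReal_sub_one_le (x := 2 * Real.pi * x)
  rw [Real.norm_eq_abs, abs_mul, abs_of_pos Real.two_pi_pos] at h
  convert h using 3
  rw [expi]
  push_cast
  ring_nf

/-- Exponential sums over the Möbius function near a rational number of small denominator. -/
theorem exists_norm_sum_moebius_mul_expi_le_of_major (A : ℕ) : ∃ C : ℝ, 0 < C ∧
    ∀ (q : ℕ) [NeZero q] (a : ℤ) (α : ℝ) (N : ℕ),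
    ‖∑ n ∈ Finset.Ioc 0 N, (ArithmeticFunction.moebius n : ℂ) * expi (n * α)‖ ≤
      C * q ^ 4 * decay A N * (1 + 2 * Real.pi * |α - a / q| * N) := by
  obtain ⟨C, hC, h⟩ := exists_norm_sum_moebius_mul_periodic_le A
  refine ⟨C, hC, fun q _ a α N => ?_⟩
  set β := α - a / q with hβ
  have hq0 : (q : ℝ) ≠ 0 := by exact_mod_cast NeZero.ne q
  set F : ZMod q → ℂ := fun r => expi (r.val * (a / q)) with hF
  have hFn : ∀ n : ℕ, F n = expi (n * (a / q)) := by
    intro n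
    rw [hF]
    simp only [ZMod.val_natCast]
    conv_rhs => rw [← Nat.mod_add_div n q]
    rw [show (((n % q + q * (n / q) : ℕ) : ℝ) * (a / q)) =
      (n % q : ℕ) * (a / q) + (((n / q : ℕ) : ℤ) * a : ℤ) by
        rw [Nat.cast_add, Nat.cast_mul, Int.cast_mul, Int.cast_natCast]; field_simp, expi_add_intCast]
  have hsum : ∑ n ∈ Finset.Ioc 0 N, (ArithmeticFunction.moebius n : ℂ) * expi (n * α) =
      ∑ n ∈ Finset.Ioc 0 N, expi (n * β) * ((ArithmeticFunction.moebius n : ℂ) * F n) := by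
    refine Finset.sum_congr rfl fun n _ => ?_
    rw [hFn, mul_left_comm, ← expi_add]
    congr 2
    rw [hβ]; ring
  have h0 := decay_nonneg A (x := N) (by positivity)
  rw [hsum]
  refine (norm_sum_Ioc_mul_le (fun n : ℕ => expi (n * β)) _ (Nat.zero_le N)
    (B := C * q ^ 4 * decay A N) ?_).trans ?_
  · intro k hk
    refine (h q F (fun r => (norm_expi _).le) k).trans ?_
    gcongr
    exact decay_mono A (by positivity) (by exact_mod_cast (Finset.mem_Icc.1 hk).2)
  · gcongr
    · exact (norm_expi _).le
    · calc _ ≤ ∑ i ∈ Finset.Ioc 0 N, 2 * Real.pi * |β| := by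
            refine Finset.sum_le_sum fun i _ => ?_
            rw [show ((i + 1 : ℕ) : ℝ) * β = i * β + β by push_cast; ring, expi_add,
              ← mul_sub_one, norm_mul, norm_expi, one_mul]
            exact norm_expi_sub_one_le β
        _ = _ := by simp; ring

end MajorArcs

section DistInt

/-- The distance from a real number to the nearest integer. -/
noncomputable def distInt (x : ℝ) : ℝ := |x - round x|

lemma four_mul_distInt_le (x : ℝ) : 4 * distInt x ≤ ‖expi x - 1‖ := by
  have e : expi x = cexp (I * (2 * Real.pi * (x - round x) : ℝ)) := by
    rw [← expi_add_intCast x (- round x), expi]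
    push_cast
    ring_nf
  have h1 : |x - round x| ≤ 1 / 2 := abs_sub_round x
  have h2 : |Real.pi * (x - round x)| ≤ Real.pi / 2 := by
    rw [abs_mul, abs_of_pos Real.pi_pos]
    nlinarith [Real.pi_pos]
  have h3 := Real.mul_abs_le_abs_sin h2
  rw [abs_mul, abs_of_pos Real.pi_pos] at h3
  have h4 : 2 / Real.pi * (Real.pi * |x - round x|) = 2 * |x - round x| := by
    field_simp
  rw [e, norm_exp_I_mul_ofReal_sub_one, show 2 * Real.pi * (x - round x) / 2 =
    Real.pi * (x - round x) by ring, norm_mul, Real.norm_eq_abs, Real.norm_eq_abs, distInt]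
  rw [h4] at h3
  rw [abs_of_pos (by norm_num : (0 : ℝ) < 2)]
  linarith

lemma norm_sum_expi_mul_distInt_le (θ : ℝ) (K M : ℕ) :
    ‖∑ k ∈ Finset.Ioc K M, expi (k * θ)‖ * (2 * distInt θ) ≤ 1 := by
  rcases le_or_gt K M with h | h
  · have e : (∑ k ∈ Finset.Ioc K M, expi (k * θ)) * (expi θ - 1) =
        expi ((M + 1 : ℕ) * θ) - expi ((K + 1 : ℕ) * θ) := by
      induction M, h using Nat.le_induction with
      | base => simp
      | succ M hM ih =>
        rw [Finset.sum_Ioc_succ_top (by omega), add_mul, ih, mul_sub_one, ← expi_add]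
        rw [show ((M + 1 : ℕ) * θ + θ) = ((M + 1 + 1 : ℕ) * θ) by push_cast; ring]
        ring
    have h1 : ‖∑ k ∈ Finset.Ioc K M, expi (k * θ)‖ * ‖expi θ - 1‖ ≤ 2 := by
      rw [← norm_mul, e]
      refine (norm_sub_le _ _).trans ?_
      rw [norm_expi, norm_expi]
      norm_num
    have h2 := mul_le_mul_of_nonneg_left (four_mul_distInt_le θ)
      (norm_nonneg (∑ k ∈ Finset.Ioc K M, expi (k * θ)))
    linarith
  · simp [Finset.Ioc_eq_empty (by omega : ¬ K < M)]

lemma norm_sum_expi_le_card (θ : ℝ) (s : Finset ℕ) : ‖∑ k ∈ s, expi (k * θ)‖ ≤ s.card :=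
  (norm_sum_le _ _).trans (by simp [norm_expi])

lemma card_le_of_injOn_of_abs_sub_le {s : Finset ℕ} {z : ℕ → ℤ} (hz : Set.InjOn z s) {c ρ : ℝ}
    (hρ : 0 ≤ ρ) (h : ∀ l ∈ s, |(z l : ℝ) - c| ≤ ρ) : (s.card : ℝ) ≤ 2 * ρ + 1 := by
  have h1 : s.card ≤ (Finset.Icc ⌈c - ρ⌉ ⌊c + ρ⌋).card := by
    refine Finset.card_le_card_of_injOn z (fun l hl => ?_) hz
    have := abs_le.1 (h l hl)
    rw [Finset.coe_Icc, Set.mem_Icc, Int.ceil_le, Int.le_floor]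
    constructor <;> linarith
  rw [Int.card_Icc] at h1
  have h2 : ((⌊c + ρ⌋ + 1 - ⌈c - ρ⌉).toNat : ℝ) ≤ 2 * ρ + 1 := by
    rcases le_total 0 (⌊c + ρ⌋ + 1 - ⌈c - ρ⌉) with h | h
    · have h3 : (((⌊c + ρ⌋ + 1 - ⌈c - ρ⌉).toNat : ℤ) : ℝ) = (⌊c + ρ⌋ + 1 - ⌈c - ρ⌉ : ℤ) := by
        rw [Int.toNat_of_nonneg h]
      rw [Int.cast_natCast] at h3
      rw [h3]
      push_cast
      have := Int.floor_le (c + ρ)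
      have := Int.le_ceil (c - ρ)
      linarith
    · rw [Int.toNat_of_nonpos h]
      simp
      linarith
  exact (by exact_mod_cast h1 : (s.card : ℝ) ≤ _).trans h2

/-- The number of terms of an arithmetic progression modulo one which are close to zero. -/
theorem card_distInt_le {α β δ : ℝ} {a : ℤ} {q : ℕ} (hq : 0 < q) (haq : IsCoprime a (q : ℤ))
    (hα : |α - a / q| ≤ 1 / q ^ 2) (hδ : 0 ≤ δ) (H : ℕ) :
    (((Finset.Ioc 0 H).filter fun l : ℕ => distInt (l * α - β) ≤ δ).card : ℝ) ≤
      (H / q + 1) * (2 * δ * q + 3) := by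
  have hq' : (0 : ℝ) < q := by exact_mod_cast hq
  set s := (Finset.Ioc 0 H).filter fun l : ℕ => distInt (l * α - β) ≤ δ with hs
  have hmap : ∀ l ∈ s, (l - 1) / q ∈ Finset.range (H / q + 1) := by
    intro l hl
    have := (Finset.mem_Ioc.1 (Finset.mem_filter.1 hl).1).2
    rw [Finset.mem_range, Nat.lt_succ_iff]
    exact Nat.div_le_div_right (by omega)
  rw [Finset.card_eq_sum_card_fiberwise hmap]
  push_cast
  have hfib : ∀ b ∈ Finset.range (H / q + 1),
      (((s.filter fun l => (l - 1) / q = b).card : ℕ) : ℝ) ≤ 2 * δ * q + 3 := by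
    intro b _
    have hmem : ∀ l ∈ s.filter fun l => (l - 1) / q = b,
        b * q + 1 ≤ l ∧ l ≤ b * q + q ∧ distInt (l * α - β) ≤ δ := by
      intro l hl
      simp only [hs, Finset.mem_filter, Finset.mem_Ioc] at hl
      obtain ⟨⟨⟨h1, -⟩, h2⟩, h3⟩ := hl
      have h4 := Nat.div_mul_le_self (l - 1) q
      have h5 := Nat.lt_div_mul_add (a := l - 1) hq
      rw [h3] at h4 h5
      exact ⟨by omega, by omega, h2⟩
    set z : ℕ → ℤ := fun l => a * l - q * round (l * α - β) with hz
    have := card_le_of_injOn_of_abs_sub_le (s := s.filter fun l => (l - 1) / q = b) (z := z)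
      (c := q * (β + (a / q - α) * (b * q))) (ρ := δ * q + 1) ?_ (by positivity) ?_
    · linarith
    · intro l hl l' hl' h
      obtain ⟨h1, h2, -⟩ := hmem l hl
      obtain ⟨h1', h2', -⟩ := hmem l' hl'
      have hdvd : (q : ℤ) ∣ a * (l - l') := by
        simp only [hz] at h
        exact ⟨round (l * α - β) - round (l' * α - β), by linarith⟩
      have hdvd' := haq.symm.dvd_of_dvd_mul_left hdvd
      have := Int.eq_zero_of_abs_lt_dvd hdvd' (by rw [abs_lt]; constructor <;> omega)
      omega
    · intro l hl
      obtain ⟨h1, h2, h3⟩ := hmem l hl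
      have e : ((z l : ℤ) : ℝ) - q * (β + (a / q - α) * (b * q)) =
          q * ((l * α - β) - round (l * α - β)) + q * ((a / q - α) * (l - b * q)) := by
        simp only [hz]
        push_cast
        field_simp
        ring
      have h1' : (b : ℝ) * q + 1 ≤ l := by exact_mod_cast h1
      have h2' : (l : ℝ) ≤ b * q + q := by exact_mod_cast h2
      rw [e]
      refine (abs_add_le _ _).trans (add_le_add ?_ ?_)
      · rw [abs_mul, abs_of_pos hq', mul_comm]
        exact mul_le_mul_of_nonneg_right h3 hq'.le
      · rw [abs_mul, abs_mul, abs_of_pos hq', abs_sub_comm, abs_of_nonneg (by linarith : 0 ≤ (l : ℝ) - b * q)]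
        calc (q : ℝ) * (|α - a / q| * (l - b * q)) ≤ q * (1 / q ^ 2 * q) := by
              gcongr
              · linarith only [h1']
              · linarith only [h2']
          _ = 1 := by field_simp
  calc _ ≤ ∑ _b ∈ Finset.range (H / q + 1), (2 * δ * q + 3) := Finset.sum_le_sum hfib
    _ = ((H / q : ℕ) + 1) * (2 * δ * q + 3) := by
        rw [Finset.sum_const, Finset.card_range, nsmul_eq_mul, Nat.cast_add_one]
    _ ≤ _ := by
      gcongr
      exact Nat.cast_div_le

end DistInt

section BilinearForms

/-- A bound for bilinear sums with an additive character. -/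
theorem sq_norm_sum_bilinear_le {α δ : ℝ} {a : ℤ} {q : ℕ} (hq : 0 < q)
    (haq : IsCoprime a (q : ℤ)) (hα : |α - a / q| ≤ 1 / q ^ 2) (hδ : 0 < δ) {f g : ℕ → ℂ}
    (hf : ∀ l, ‖f l‖ ≤ 1) {K : ℕ} (hK : 0 < K) (N : ℕ) :
    ‖∑ k ∈ Finset.Ioc K (2 * K), g k * ∑ l ∈ Finset.Ioc 0 (N / k), f l * expi (k * (l * α))‖ ^ 2 ≤
      (∑ k ∈ Finset.Ioc K (2 * K), ‖g k‖ ^ 2) * ((N / K : ℕ) *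
        (K * (((N / K : ℕ) / q + 1) * (2 * δ * q + 3)) + (N / K : ℕ) / (2 * δ))) := by
  set L := N / K with hL
  set T : ℕ → ℂ := fun k => ∑ l ∈ Finset.Ioc 0 (N / k), f l * expi (k * (l * α)) with hT
  have hT2 : ∀ k ∈ Finset.Ioc K (2 * K), T k =
      ∑ l ∈ Finset.Ioc 0 L, if l * k ≤ N then f l * expi (k * (l * α)) else 0 := by
    intro k hk
    have hk1 := (Finset.mem_Ioc.1 hk).1
    rw [← Finset.sum_filter]
    refine Finset.sum_congr ?_ fun _ _ => rfl
    ext l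
    simp only [Finset.mem_filter, Finset.mem_Ioc]
    rw [Nat.le_div_iff_mul_le (by omega)]
    constructor
    · rintro ⟨h1, h2⟩
      refine ⟨⟨h1, ?_⟩, h2⟩
      rw [hL, Nat.le_div_iff_mul_le hK]
      exact (Nat.mul_le_mul_left l hk1.le).trans h2
    · rintro ⟨⟨h1, -⟩, h2⟩
      exact ⟨h1, h2⟩
  have hCS : ‖∑ k ∈ Finset.Ioc K (2 * K), g k * T k‖ ^ 2 ≤
      (∑ k ∈ Finset.Ioc K (2 * K), ‖g k‖ ^ 2) * ∑ k ∈ Finset.Ioc K (2 * K), ‖T k‖ ^ 2 := by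
    refine le_trans ?_ (Finset.sum_mul_sq_le_sq_mul_sq _ _ _)
    gcongr
    refine (norm_sum_le _ _).trans (Finset.sum_le_sum fun k _ => (norm_mul_le _ _))
  refine hCS.trans (mul_le_mul_of_nonneg_left ?_ (by positivity))
  set J : ℕ → ℕ → ℂ := fun l₁ l₂ => ∑ k ∈ Finset.Ioc K (min (2 * K) (min (N / l₁) (N / l₂))),
    expi (k * (l₂ * α - l₁ * α)) with hJ
  have hexp : ((∑ k ∈ Finset.Ioc K (2 * K), ‖T k‖ ^ 2 : ℝ) : ℂ) =
      ∑ l₁ ∈ Finset.Ioc 0 L, ∑ l₂ ∈ Finset.Ioc 0 L, (starRingEnd ℂ) (f l₁) * f l₂ * J l₁ l₂ := by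
    push_cast
    have h1 : ∀ k ∈ Finset.Ioc K (2 * K), ((‖T k‖ : ℂ) ^ 2) =
        ∑ l₁ ∈ Finset.Ioc 0 L, ∑ l₂ ∈ Finset.Ioc 0 L, if l₁ * k ≤ N ∧ l₂ * k ≤ N then
          (starRingEnd ℂ) (f l₁) * f l₂ * expi (k * (l₂ * α - l₁ * α)) else 0 := by
      intro k hk
      rw [← Complex.conj_mul', hT2 k hk, map_sum, Finset.sum_mul_sum]
      refine Finset.sum_congr rfl fun l₁ _ => Finset.sum_congr rfl fun l₂ _ => ?_
      by_cases c1 : l₁ * k ≤ N <;> by_cases c2 : l₂ * k ≤ N <;> simp only [c1, c2, if_true, if_false,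
        and_true, and_false, and_self, map_zero, zero_mul, mul_zero]
      rw [map_mul, ← expi_neg, mul_mul_mul_comm, ← expi_add]
      congr 2
      ring
    rw [Finset.sum_congr rfl h1, Finset.sum_comm]
    refine Finset.sum_congr rfl fun l₁ hl₁ => ?_
    rw [Finset.sum_comm]
    refine Finset.sum_congr rfl fun l₂ hl₂ => ?_
    rw [← Finset.sum_filter, hJ, Finset.mul_sum]
    refine Finset.sum_congr ?_ fun _ _ => rfl
    ext k
    simp only [Finset.mem_filter, Finset.mem_Ioc, le_min_iff]
    rw [Nat.le_div_iff_mul_le (Finset.mem_Ioc.1 hl₁).1, Nat.le_div_iff_mul_le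
      (Finset.mem_Ioc.1 hl₂).1, mul_comm l₁, mul_comm l₂]
    tauto
  have hJ1 : ∀ l₁ l₂, ‖J l₁ l₂‖ ≤ K := by
    intro l₁ l₂
    refine (norm_sum_expi_le_card _ _).trans ?_
    rw [Nat.card_Ioc]
    exact_mod_cast (by omega : min (2 * K) (min (N / l₁) (N / l₂)) - K ≤ K)
  have hrow : ∀ l₁, ∑ l₂ ∈ Finset.Ioc 0 L, ‖J l₁ l₂‖ ≤
      K * ((L / q + 1) * (2 * δ * q + 3)) + L / (2 * δ) := by
    intro l₁
    rw [← Finset.sum_filter_add_sum_filter_not _ (fun l₂ : ℕ => distInt (l₂ * α - l₁ * α) ≤ δ)]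
    refine add_le_add ?_ ?_
    · calc _ ≤ ∑ l₂ ∈ (Finset.Ioc 0 L).filter fun l₂ : ℕ => distInt (l₂ * α - l₁ * α) ≤ δ,
            (K : ℝ) := Finset.sum_le_sum fun l₂ _ => hJ1 l₁ l₂
        _ = K * ((Finset.Ioc 0 L).filter fun l₂ : ℕ => distInt (l₂ * α - l₁ * α) ≤ δ).card := by
            rw [Finset.sum_const, nsmul_eq_mul, mul_comm]
        _ ≤ _ := by
            gcongr
            exact card_distInt_le hq haq hα hδ.le L
    · calc _ ≤ ∑ l₂ ∈ (Finset.Ioc 0 L).filter fun l₂ : ℕ => ¬ distInt (l₂ * α - l₁ * α) ≤ δ,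
            1 / (2 * δ) := by
            refine Finset.sum_le_sum fun l₂ hl₂ => ?_
            have h1 := norm_sum_expi_mul_distInt_le (l₂ * α - l₁ * α) K
              (min (2 * K) (min (N / l₁) (N / l₂)))
            have h2 := not_le.1 (Finset.mem_filter.1 hl₂).2
            rw [le_div_iff₀ (by positivity)]
            refine le_trans ?_ h1
            gcongr
        _ ≤ ∑ l₂ ∈ Finset.Ioc 0 L, 1 / (2 * δ) :=
            Finset.sum_le_sum_of_subset_of_nonneg (Finset.filter_subset _ _)
              fun _ _ _ => by positivity
        _ = _ := by simp; ring
  calc ∑ k ∈ Finset.Ioc K (2 * K), ‖T k‖ ^ 2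
      = ‖((∑ k ∈ Finset.Ioc K (2 * K), ‖T k‖ ^ 2 : ℝ) : ℂ)‖ := by
        rw [norm_real, Real.norm_eq_abs, abs_of_nonneg (by positivity)]
    _ ≤ ∑ l₁ ∈ Finset.Ioc 0 L, ∑ l₂ ∈ Finset.Ioc 0 L, ‖J l₁ l₂‖ := by
        rw [hexp]
        refine (norm_sum_le _ _).trans (Finset.sum_le_sum fun l₁ _ => (norm_sum_le _ _).trans
          (Finset.sum_le_sum fun l₂ _ => ?_))
        rw [norm_mul, norm_mul, RCLike.norm_conj]
        exact mul_le_of_le_one_left (norm_nonneg _)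
          (mul_le_one₀ (hf _) (norm_nonneg _) (hf _))
    _ ≤ ∑ _l₁ ∈ Finset.Ioc 0 L, (K * ((L / q + 1) * (2 * δ * q + 3)) + L / (2 * δ)) :=
        Finset.sum_le_sum fun l₁ _ => hrow l₁
    _ = _ := by rw [Finset.sum_const, Nat.card_Ioc, nsmul_eq_mul, Nat.sub_zero]

end BilinearForms

section DivisorSums

lemma sum_Ioc_one_div_le (X : ℕ) : ∑ g ∈ Finset.Ioc 0 X, (1 : ℝ) / g ≤ 1 + Real.log X := by
  have h := harmonic_le_one_add_log X
  rw [harmonic_eq_sum_Icc] at h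
  push_cast at h
  rw [show Finset.Ioc 0 X = Finset.Icc 1 X from rfl]
  simpa only [one_div] using h

lemma card_divisors_sq_le {k X : ℕ} (hk : 0 < k) (hkX : k ≤ X) : k.divisors.card ^ 2 ≤
    ((Finset.Ioc 0 X ×ˢ Finset.Ioc 0 X ×ˢ Finset.Ioc 0 X).filter
      fun t : ℕ × ℕ × ℕ => t.1 * t.2.1 * t.2.2 ∣ k).card := by
  rw [sq, ← Finset.card_product]
  refine Finset.card_le_card_of_injOn
    (fun d => (d.1.gcd d.2, d.1 / d.1.gcd d.2, d.2 / d.1.gcd d.2)) ?_ ?_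
  · rintro ⟨d, e⟩ hde
    simp only [Finset.coe_product, Set.mem_prod, Finset.mem_coe, Nat.mem_divisors] at hde
    obtain ⟨⟨hd, -⟩, he, -⟩ := hde
    have hd0 := Nat.pos_of_dvd_of_pos hd hk
    have he0 := Nat.pos_of_dvd_of_pos he hk
    have hg := Nat.gcd_pos_of_pos_left e hd0
    have hdk := Nat.le_of_dvd hk hd
    have hek := Nat.le_of_dvd hk he
    simp only [Finset.coe_filter, Finset.mem_product, Finset.mem_Ioc, Set.mem_ofPred_eq]
    refine ⟨⟨⟨hg, (Nat.gcd_le_left e hd0).trans (hdk.trans hkX)⟩,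
      ⟨Nat.div_pos (Nat.gcd_le_left e hd0) hg, (Nat.div_le_self _ _).trans (hdk.trans hkX)⟩,
      ⟨Nat.div_pos (Nat.gcd_le_right d he0) hg, (Nat.div_le_self _ _).trans (hek.trans hkX)⟩⟩, ?_⟩
    rw [Nat.mul_div_cancel' (Nat.gcd_dvd_left d e), ← Nat.mul_div_assoc _ (Nat.gcd_dvd_right d e)]
    exact Nat.lcm_dvd hd he
  · rintro ⟨d, e⟩ - ⟨d', e'⟩ - h
    simp only [Prod.mk.injEq] at h
    obtain ⟨h1, h2, h3⟩ := h
    rw [Prod.mk.injEq]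
    constructor
    · rw [← Nat.mul_div_cancel' (Nat.gcd_dvd_left d e), h2, h1,
        Nat.mul_div_cancel' (Nat.gcd_dvd_left d' e')]
    · rw [← Nat.mul_div_cancel' (Nat.gcd_dvd_right d e), h3, h1,
        Nat.mul_div_cancel' (Nat.gcd_dvd_right d' e')]

theorem sum_card_divisors_sq_le (X : ℕ) :
    ∑ k ∈ Finset.Ioc 0 X, (k.divisors.card : ℝ) ^ 2 ≤ X * (1 + Real.log X) ^ 3 := by
  set P := Finset.Ioc 0 X ×ˢ Finset.Ioc 0 X ×ˢ Finset.Ioc 0 X with hP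
  have h1 : ∀ k ∈ Finset.Ioc 0 X, (k.divisors.card : ℝ) ^ 2 ≤
      ∑ t ∈ P, if t.1 * t.2.1 * t.2.2 ∣ k then (1 : ℝ) else 0 := by
    intro k hk
    obtain ⟨hk1, hk2⟩ := Finset.mem_Ioc.1 hk
    rw [Finset.sum_boole]
    exact_mod_cast card_divisors_sq_le hk1 hk2
  have h2 : ∀ m : ℕ, (∑ k ∈ Finset.Ioc 0 X, if m ∣ k then (1 : ℝ) else 0) ≤ X / m := by
    intro m
    rw [Finset.sum_boole, Nat.Ioc_filter_dvd_card_eq_div]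
    exact Nat.cast_div_le
  have hH : 0 ≤ ∑ g ∈ Finset.Ioc 0 X, (1 : ℝ) / g := by positivity
  calc _ ≤ ∑ k ∈ Finset.Ioc 0 X, ∑ t ∈ P, if t.1 * t.2.1 * t.2.2 ∣ k then (1 : ℝ) else 0 :=
        Finset.sum_le_sum h1
    _ = ∑ t ∈ P, ∑ k ∈ Finset.Ioc 0 X, if t.1 * t.2.1 * t.2.2 ∣ k then (1 : ℝ) else 0 :=
        Finset.sum_comm
    _ ≤ ∑ t ∈ P, (X : ℝ) / (t.1 * t.2.1 * t.2.2 : ℕ) := Finset.sum_le_sum fun t _ => h2 _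
    _ = X * (∑ g ∈ Finset.Ioc 0 X, (1 : ℝ) / g) ^ 3 := by
        rw [hP, Finset.sum_product, pow_succ', sq, Finset.sum_mul_sum, Finset.sum_mul_sum,
          Finset.mul_sum]
        refine Finset.sum_congr rfl fun g _ => ?_
        rw [Finset.sum_product, Finset.mul_sum]
        refine Finset.sum_congr rfl fun a _ => ?_
        rw [Finset.mul_sum, Finset.mul_sum]
        refine Finset.sum_congr rfl fun b _ => ?_
        push_cast
        rw [div_mul_div_comm, div_mul_div_comm, ← mul_div_assoc]
        ring_nf
    _ ≤ _ := by
        gcongr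
        exact sum_Ioc_one_div_le X

end DivisorSums

section Vaughan

open ArithmeticFunction
open scoped ArithmeticFunction.Moebius ArithmeticFunction.zeta

lemma sum_Ioc_convolution_mul (f g : ArithmeticFunction ℂ) (F : ℕ → ℂ) (N : ℕ) :
    ∑ n ∈ Finset.Ioc 0 N, (f * g) n * F n =
      ∑ k ∈ Finset.Ioc 0 N, f k * ∑ l ∈ Finset.Ioc 0 (N / k), g l * F (k * l) := by
  have h1 : ∀ n ∈ Finset.Ioc 0 N, (f * g) n * F n =
      ∑ x ∈ Finset.Ioc 0 N ×ˢ Finset.Ioc 0 N with x.1 * x.2 = n,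
        f x.1 * (g x.2 * F (x.1 * x.2)) := by
    intro n hn
    have hn := Finset.mem_Ioc.1 hn
    rw [mul_apply, Nat.divisorsAntidiagonal_eq_prod_filter_of_le hn.1.ne' hn.2, Finset.sum_mul]
    refine Finset.sum_congr rfl fun x hx => ?_
    rw [(Finset.mem_filter.1 hx).2, mul_assoc]
  rw [Finset.sum_congr rfl h1]
  have h2 : ∀ k ∈ Finset.Ioc 0 N, f k * ∑ l ∈ Finset.Ioc 0 (N / k), g l * F (k * l) =
      ∑ l ∈ Finset.Ioc 0 N, if k * l ≤ N then f k * (g l * F (k * l)) else 0 := by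
    intro k hk
    have hk := Finset.mem_Ioc.1 hk
    rw [Finset.mul_sum, ← Finset.sum_filter]
    refine Finset.sum_congr ?_ fun _ _ => rfl
    ext l
    rw [Finset.mem_filter, Finset.mem_Ioc, Finset.mem_Ioc, Nat.le_div_iff_mul_le hk.1, mul_comm l]
    constructor
    · rintro ⟨hl, h⟩
      exact ⟨⟨hl, (Nat.le_mul_of_pos_left l hk.1).trans h⟩, h⟩
    · rintro ⟨⟨hl, -⟩, h⟩
      exact ⟨hl, h⟩
  rw [Finset.sum_congr rfl h2, ← Finset.sum_product', ← Finset.sum_filter]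
  rw [← Finset.sum_fiberwise_of_maps_to (g := fun x : ℕ × ℕ => x.1 * x.2) (t := Finset.Ioc 0 N)]
  · refine Finset.sum_congr rfl fun n hn => ?_
    refine Finset.sum_congr ?_ fun _ _ => rfl
    ext x
    have hn := (Finset.mem_Ioc.1 hn).2
    simp only [Finset.mem_filter]
    constructor
    · rintro ⟨h, rfl⟩
      exact ⟨⟨h, hn⟩, rfl⟩
    · rintro ⟨⟨h, -⟩, h'⟩
      exact ⟨h, h'⟩
  · intro x hx
    simp only [Finset.mem_filter, Finset.mem_product, Finset.mem_Ioc] at hx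
    exact Finset.mem_Ioc.2 ⟨Nat.mul_pos hx.1.1.1 hx.1.2.1, hx.2⟩

/-- The part of the Möbius function supported on integers up to `U`. -/
noncomputable def moebiusLow (U : ℕ) : ArithmeticFunction ℂ :=
  ⟨fun n => if n ≤ U then (μ n : ℂ) else 0, by simp⟩

lemma moebiusLow_apply (U n : ℕ) : moebiusLow U n = if n ≤ U then (μ n : ℂ) else 0 := rfl

/-- The part of the Möbius function supported on integers greater than `U`. -/
noncomputable def moebiusHigh (U : ℕ) : ArithmeticFunction ℂ :=
  ⟨fun n => if n ≤ U then 0 else (μ n : ℂ), by simp⟩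

lemma moebiusHigh_apply (U n : ℕ) : moebiusHigh U n = if n ≤ U then 0 else (μ n : ℂ) := rfl

lemma norm_moebiusLow_le (U n : ℕ) : ‖moebiusLow U n‖ ≤ 1 := by
  rw [moebiusLow_apply]
  split_ifs
  · exact norm_moebius_le n
  · simp

lemma norm_moebiusHigh_le (U n : ℕ) : ‖moebiusHigh U n‖ ≤ 1 := by
  rw [moebiusHigh_apply]
  split_ifs
  · simp
  · exact norm_moebius_le n

lemma moebius_eq_low_add_high (U : ℕ) :
    ((μ : ArithmeticFunction ℤ) : ArithmeticFunction ℂ) = moebiusLow U + moebiusHigh U := by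
  ext n
  rw [ArithmeticFunction.add_apply, moebiusLow_apply, moebiusHigh_apply, intCoe_apply]
  split_ifs <;> simp

/-- Vaughan's identity for the Möbius function. -/
lemma moebius_vaughan (U : ℕ) : ((μ : ArithmeticFunction ℤ) : ArithmeticFunction ℂ) +
    (moebiusLow U * moebiusLow U) * (ζ : ArithmeticFunction ℂ) = moebiusLow U + moebiusLow U +
      ((ζ : ArithmeticFunction ℂ) * moebiusHigh U) * moebiusHigh U := by
  have h := coe_moebius_mul_coe_zeta (R := ℂ)
  rw [moebius_eq_low_add_high U] at h ⊢
  linear_combination (moebiusLow U - moebiusHigh U) * h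

lemma norm_convolution_le {f g : ArithmeticFunction ℂ} (hf : ∀ n, ‖f n‖ ≤ 1)
    (hg : ∀ n, ‖g n‖ ≤ 1) (n : ℕ) : ‖(f * g) n‖ ≤ n.divisors.card := by
  rw [mul_apply]
  refine (norm_sum_le _ _).trans ?_
  calc _ ≤ ∑ x ∈ n.divisorsAntidiagonal, (1 : ℝ) := by
        refine Finset.sum_le_sum fun x _ => ?_
        rw [norm_mul]
        exact mul_le_one₀ (hf _) (norm_nonneg _) (hg _)
    _ = _ := by
        rw [Finset.sum_const, nsmul_eq_mul, mul_one, ← Nat.map_div_right_divisors, Finset.card_map]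

lemma norm_zeta_apply_le (n : ℕ) : ‖(ζ : ArithmeticFunction ℂ) n‖ ≤ 1 := by
  rw [natCoe_apply, zeta_apply]
  split_ifs <;> simp

lemma moebiusLow_mul_self_apply_eq_zero {U n : ℕ} (h : U ^ 2 < n) :
    (moebiusLow U * moebiusLow U) n = 0 := by
  rw [mul_apply]
  refine Finset.sum_eq_zero fun x hx => ?_
  have hx := (Nat.mem_divisorsAntidiagonal.1 hx).1
  rw [moebiusLow_apply, moebiusLow_apply]
  by_cases h1 : x.1 ≤ U
  · have h2 : ¬ x.2 ≤ U := fun h2 => by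
      have := Nat.mul_le_mul h1 h2
      nlinarith
    simp [h2]
  · simp [h1]

lemma zeta_mul_moebiusHigh_apply_eq_zero {U n : ℕ} (h : n ≤ U) :
    ((ζ : ArithmeticFunction ℂ) * moebiusHigh U) n = 0 := by
  rw [mul_apply]
  refine Finset.sum_eq_zero fun x hx => ?_
  obtain ⟨hx, hn⟩ := Nat.mem_divisorsAntidiagonal.1 hx
  rw [moebiusHigh_apply, if_pos, mul_zero]
  exact (Nat.le_of_dvd (Nat.pos_of_ne_zero hn) ⟨x.1, by rw [mul_comm, hx]⟩).trans h

end Vaughan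

section Minor

open ArithmeticFunction
open scoped ArithmeticFunction.Moebius ArithmeticFunction.zeta

lemma one_div_le_distInt {α : ℝ} {a : ℤ} {q m : ℕ} (hq : 0 < q) (haq : IsCoprime a (q : ℤ))
    (hm : ¬ q ∣ m) (h : m * |α - a / q| ≤ 1 / (2 * q)) : 1 / (2 * q) ≤ distInt (m * α) := by
  have hq' : (0 : ℝ) < q := by exact_mod_cast hq
  set r := round (m * α) with hr
  have h1 : (1 : ℝ) ≤ |((m * a - r * q : ℤ) : ℝ)| := by
    have : (m * a - r * q : ℤ) ≠ 0 := by
      intro h0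
      have hdvd : (q : ℤ) ∣ m * a := ⟨r, by linarith⟩
      exact hm (by exact_mod_cast haq.symm.dvd_of_dvd_mul_right hdvd)
    rw [← Int.cast_abs]
    exact_mod_cast Int.one_le_abs this
  have h2 : |((m * a - r * q : ℤ) : ℝ)| = q * |m * (a / q : ℝ) - r| := by
    rw [← abs_of_pos hq', ← abs_mul, abs_of_pos hq']
    push_cast
    congr 1
    field_simp
  have h3 : |m * (a / q : ℝ) - r| ≤ distInt (m * α) + m * |α - a / q| := by
    rw [distInt, ← hr]
    calc |m * (a / q : ℝ) - r| = |(m * α - r) + - (m * (α - a / q))| := by ring_nf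
      _ ≤ _ := by
        refine (abs_add_le _ _).trans ?_
        rw [abs_neg, abs_mul, abs_of_nonneg (Nat.cast_nonneg m : (0 : ℝ) ≤ m)]
  have h4 : 1 / (q : ℝ) ≤ |m * (a / q : ℝ) - r| := by
    rw [div_le_iff₀ hq', mul_comm, ← h2]
    exact h1
  have h5 : 1 / (q : ℝ) = 1 / (2 * q) + 1 / (2 * q) := by field_simp; norm_num
  linarith

lemma norm_sum_expi_le_of_not_dvd {α : ℝ} {a : ℤ} {q m : ℕ} (hq : 0 < q)
    (haq : IsCoprime a (q : ℤ)) (hm : ¬ q ∣ m) (h : m * |α - a / q| ≤ 1 / (2 * q)) (K M : ℕ) :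
    ‖∑ k ∈ Finset.Ioc K M, expi (k * (m * α))‖ ≤ q := by
  have hq' : (0 : ℝ) < q := by exact_mod_cast hq
  have h1 := one_div_le_distInt hq haq hm h
  have h2 := norm_sum_expi_mul_distInt_le (m * α) K M
  have h3 : ‖∑ k ∈ Finset.Ioc K M, expi (k * (m * α))‖ * (2 * (1 / (2 * q))) ≤ 1 :=
    le_trans (by gcongr) h2
  have h4 : (2 : ℝ) * (1 / (2 * q)) = 1 / q := by field_simp
  rwa [h4, mul_one_div, div_le_one hq'] at h3

/-- The bound for the linear sums in Vaughan's identity. -/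
lemma norm_typeI_le {α : ℝ} {a : ℤ} {q U N : ℕ} (haq : IsCoprime a (q : ℤ)) (hUq : U ^ 2 < q)
    (h : U ^ 2 * |α - a / q| ≤ 1 / (2 * q)) :
    ‖∑ n ∈ Finset.Ioc 0 N, ((moebiusLow U * moebiusLow U) * (ζ : ArithmeticFunction ℂ)) n *
      expi (n * α)‖ ≤ (U : ℝ) ^ 4 * q := by
  rw [sum_Ioc_convolution_mul]
  have h1 : ∀ k ∈ Finset.Ioc 0 N, ‖(moebiusLow U * moebiusLow U) k *
      ∑ l ∈ Finset.Ioc 0 (N / k), (ζ : ArithmeticFunction ℂ) l * expi ((k * l : ℕ) * α)‖ ≤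
        if k ≤ U ^ 2 then (U : ℝ) ^ 2 * q else 0 := by
    intro k hk
    have hk0 := (Finset.mem_Ioc.1 hk).1
    split_ifs with hkU
    · have e : ∑ l ∈ Finset.Ioc 0 (N / k), (ζ : ArithmeticFunction ℂ) l * expi ((k * l : ℕ) * α) =
          ∑ l ∈ Finset.Ioc 0 (N / k), expi (l * (k * α)) := by
        refine Finset.sum_congr rfl fun l hl => ?_
        rw [natCoe_apply, zeta_apply_ne (Finset.mem_Ioc.1 hl).1.ne', Nat.cast_one, one_mul]
        congr 1
        push_cast
        ring
      have hkU' : (k : ℝ) ≤ U ^ 2 := by exact_mod_cast hkU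
      rw [norm_mul, e]
      refine mul_le_mul ?_ (norm_sum_expi_le_of_not_dvd (by omega) haq ?_ ?_ _ _)
        (norm_nonneg _) (by positivity)
      · refine (norm_convolution_le (norm_moebiusLow_le U) (norm_moebiusLow_le U) k).trans ?_
        refine le_trans ?_ hkU'
        exact_mod_cast Nat.card_divisors_le_self k
      · exact fun hd => absurd (Nat.le_of_dvd hk0 hd) (by omega)
      · exact le_trans (by gcongr) h
    · rw [moebiusLow_mul_self_apply_eq_zero (not_le.1 hkU), zero_mul, norm_zero]
  refine (norm_sum_le _ _).trans ((Finset.sum_le_sum h1).trans ?_)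
  rw [← Finset.sum_filter, Finset.sum_const, nsmul_eq_mul]
  have hc : ((Finset.Ioc 0 N).filter fun k => k ≤ U ^ 2).card ≤ U ^ 2 := by
    calc _ ≤ (Finset.Ioc 0 (U ^ 2)).card := Finset.card_le_card fun k hk => by
          simp only [Finset.mem_filter, Finset.mem_Ioc] at hk ⊢
          exact ⟨hk.1.1, hk.2⟩
      _ = _ := by simp
  calc _ ≤ ((U ^ 2 : ℕ) : ℝ) * (U ^ 2 * q) := by gcongr
    _ = _ := by push_cast; ring

/-- The bound for a dyadic block of the bilinear sums in Vaughan's identity. -/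
lemma sq_norm_typeII_block_le {α : ℝ} {a : ℤ} {q W N K : ℕ} (haq : IsCoprime a (q : ℤ))
    (hα : |α - a / q| ≤ 1 / q ^ 2) (hW : 2 ≤ W) (hWq : W ^ 2 ≤ q) (hqN : q * W ^ 2 ≤ N)
    (hK : 0 < K) :
    ‖∑ k ∈ Finset.Ioc K (2 * K), ((ζ : ArithmeticFunction ℂ) * moebiusHigh (W ^ 2)) k *
      ∑ l ∈ Finset.Ioc 0 (N / k), moebiusHigh (W ^ 2) l * expi (k * (l * α))‖ ^ 2 ≤
      25 * N ^ 2 / W * (1 + Real.log N) ^ 3 := by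
  have hW0 : (0 : ℝ) < W := by positivity
  have hq0 : 0 < q := lt_of_lt_of_le (by positivity) hWq
  have hq0' : (0 : ℝ) < q := by exact_mod_cast hq0
  have hN0 : 0 < N := lt_of_lt_of_le (by positivity) hqN
  have hlogN : 0 ≤ Real.log N := Real.log_natCast_nonneg N
  rcases le_or_gt (2 * K) (W ^ 2) with h1 | h1
  · rw [Finset.sum_eq_zero, norm_zero, zero_pow two_ne_zero]
    · positivity
    · intro k hk
      rw [zeta_mul_moebiusHigh_apply_eq_zero ((Finset.mem_Ioc.1 hk).2.trans h1), zero_mul]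
  rcases le_or_gt (N / K) (W ^ 2) with h2 | h2
  · rw [Finset.sum_eq_zero, norm_zero, zero_pow two_ne_zero]
    · positivity
    · intro k hk
      rw [Finset.sum_eq_zero, mul_zero]
      intro l hl
      have hl' : l ≤ N / K := (Finset.mem_Ioc.1 hl).2.trans
        (Nat.div_le_div_left (Finset.mem_Ioc.1 hk).1.le hK)
      rw [moebiusHigh_apply, if_pos (hl'.trans h2), zero_mul]
  have hKN : K * W ^ 2 ≤ N := by
    have := (Nat.le_div_iff_mul_le hK).1 h2.le
    linarith
  have hK0 : (0 : ℝ) < K := by exact_mod_cast hK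
  have h2KN : 2 * K ≤ N := by nlinarith [Nat.mul_le_mul_left K (by nlinarith : 2 ≤ W ^ 2)]
  have hL : ((N / K : ℕ) : ℝ) ≤ N / K := Nat.cast_div_le
  have hlog : Real.log (2 * K : ℕ) ≤ Real.log N :=
    Real.log_le_log (by positivity) (by exact_mod_cast h2KN)
  have hlog0 : 0 ≤ Real.log (2 * K : ℕ) := Real.log_natCast_nonneg _
  have hsum : ∑ k ∈ Finset.Ioc K (2 * K),
      ‖((ζ : ArithmeticFunction ℂ) * moebiusHigh (W ^ 2)) k‖ ^ 2 ≤
        2 * K * (1 + Real.log N) ^ 3 := by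
    calc _ ≤ ∑ k ∈ Finset.Ioc K (2 * K), (k.divisors.card : ℝ) ^ 2 := by
          refine Finset.sum_le_sum fun k _ => ?_
          gcongr
          exact norm_convolution_le norm_zeta_apply_le (norm_moebiusHigh_le _) k
      _ ≤ ∑ k ∈ Finset.Ioc 0 (2 * K), (k.divisors.card : ℝ) ^ 2 :=
          Finset.sum_le_sum_of_subset_of_nonneg
            (Finset.Ioc_subset_Ioc_left (Nat.zero_le K)) fun _ _ _ => by positivity
      _ ≤ (2 * K : ℕ) * (1 + Real.log (2 * K : ℕ)) ^ 3 := sum_card_divisors_sq_le _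
      _ ≤ (2 * K : ℕ) * (1 + Real.log N) ^ 3 := by gcongr
      _ = _ := by push_cast; ring
  have hδ : (0 : ℝ) < W / K := by positivity
  refine (sq_norm_sum_bilinear_le hq0 haq hα hδ (norm_moebiusHigh_le (W ^ 2)) hK N).trans ?_
  have hqN' : (q : ℝ) * W ^ 2 ≤ N := by exact_mod_cast hqN
  have hKN' : (K : ℝ) * W ^ 2 ≤ N := by exact_mod_cast hKN
  have hWq' : (W : ℝ) ^ 2 ≤ q := by exact_mod_cast hWq
  have hWK' : (W : ℝ) ^ 2 ≤ 2 * K := by exact_mod_cast h1.le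
  have hW1 : (1 : ℝ) ≤ W := by exact_mod_cast (by omega : 1 ≤ W)
  have hN0' : (0 : ℝ) < N := by exact_mod_cast hN0
  have hW2 : (W : ℝ) ≤ W ^ 2 := by nlinarith
  have key : (2 * K : ℝ) * ((N / K : ℕ) * (K * (((N / K : ℕ) / q + 1) * (2 * (W / K) * q + 3)) +
      (N / K : ℕ) / (2 * (W / K)))) ≤ 25 * N ^ 2 / W := by
    calc _ ≤ (2 * K : ℝ) * (N / K * (K * ((N / K / q + 1) * (2 * (W / K) * q + 3)) +
          N / K / (2 * (W / K)))) := by gcongr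
      _ = 4 * N ^ 2 * (W / K) + 6 * N ^ 2 * (1 / q) + 4 * N * (W * q) + 6 * (N * K) +
          N ^ 2 / W := by
          field_simp
          ring
      _ ≤ 4 * N ^ 2 * (2 / W) + 6 * N ^ 2 * (1 / W) + 4 * N * (N / W) + 6 * (N * (N / W)) +
          N ^ 2 / W := by
          gcongr ?_ + ?_ + ?_ + ?_ + _
          · gcongr 4 * N ^ 2 * ?_
            rw [div_le_div_iff₀ hK0 hW0]
            linarith
          · gcongr
            exact_mod_cast hW2.trans hWq'
          · gcongr 4 * N * ?_
            rw [le_div_iff₀ hW0]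
            linarith
          · gcongr 6 * (N * ?_)
            rw [le_div_iff₀ hW0]
            exact le_trans (by gcongr) hKN'
      _ = 25 * N ^ 2 / W := by ring
  calc _ ≤ (2 * K * (1 + Real.log N) ^ 3) * ((N / K : ℕ) * (K * (((N / K : ℕ) / q + 1) *
        (2 * (W / K) * q + 3)) + (N / K : ℕ) / (2 * (W / K)))) := by
        gcongr
    _ = (2 * K : ℝ) * ((N / K : ℕ) * (K * (((N / K : ℕ) / q + 1) * (2 * (W / K) * q + 3)) +
      (N / K : ℕ) / (2 * (W / K)))) * (1 + Real.log N) ^ 3 := by ring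
    _ ≤ _ := by gcongr

end Minor

section Davenport

open ArithmeticFunction
open scoped ArithmeticFunction.Moebius ArithmeticFunction.zeta

lemma sum_Ioc_two_pow (F : ℕ → ℂ) (J : ℕ) : ∑ k ∈ Finset.Ioc 0 (2 ^ J), F k =
    F 1 + ∑ i ∈ Finset.range J, ∑ k ∈ Finset.Ioc (2 ^ i) (2 * 2 ^ i), F k := by
  induction J with
  | zero => simp [show Finset.Ioc 0 1 = {1} from rfl]
  | succ J ih =>
    rw [Finset.sum_range_succ, ← add_assoc, ← ih, pow_succ', Finset.sum_Ioc_consecutive _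
      (Nat.zero_le _) (by omega)]

lemma clog_two_le_three_mul (N : ℕ) : (Nat.clog 2 N : ℝ) ≤ 3 * (1 + Real.log N) := by
  have hlog : 0 ≤ Real.log N := Real.log_natCast_nonneg N
  rcases Nat.eq_zero_or_pos (Nat.clog 2 N) with h | h
  · rw [h]
    simp
    linarith
  · have h1 : 2 ^ (Nat.clog 2 N - 1) < N := by
      rw [← Nat.lt_clog_iff_pow_lt (by norm_num)]
      omega
    have h2 : Real.log ((2 : ℝ) ^ (Nat.clog 2 N - 1)) ≤ Real.log N :=
      Real.log_le_log (by positivity) (by exact_mod_cast h1.le)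
    rw [Real.log_pow, Nat.cast_sub h] at h2
    have h3 := Real.log_two_gt_d9
    have h4 : (1 : ℝ) ≤ Nat.clog 2 N := by exact_mod_cast h
    push_cast at h2
    nlinarith

/-- The bound for the bilinear sums in Vaughan's identity. -/
lemma norm_typeII_le {α : ℝ} {a : ℤ} {q V N : ℕ} (haq : IsCoprime a (q : ℤ))
    (hα : |α - a / q| ≤ 1 / q ^ 2) (hV : 2 ≤ V) (hVq : V ^ 4 ≤ q) (hqN : q * V ^ 4 ≤ N) :
    ‖∑ n ∈ Finset.Ioc 0 N, (((ζ : ArithmeticFunction ℂ) * moebiusHigh (V ^ 4)) *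
      moebiusHigh (V ^ 4)) n * expi (n * α)‖ ≤ 15 * N / V * (1 + Real.log N) ^ 3 := by
  have hV0 : (0 : ℝ) < V := by positivity
  have hN0 : 0 < N := lt_of_lt_of_le
    (Nat.mul_pos (lt_of_lt_of_le (by positivity) hVq) (by positivity)) hqN
  have hlogN : 0 ≤ Real.log N := Real.log_natCast_nonneg N
  set F : ℕ → ℂ := fun k => ((ζ : ArithmeticFunction ℂ) * moebiusHigh (V ^ 4)) k *
    ∑ l ∈ Finset.Ioc 0 (N / k), moebiusHigh (V ^ 4) l * expi (k * (l * α)) with hF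
  have e : ∑ n ∈ Finset.Ioc 0 N, (((ζ : ArithmeticFunction ℂ) * moebiusHigh (V ^ 4)) *
      moebiusHigh (V ^ 4)) n * expi (n * α) = ∑ k ∈ Finset.Ioc 0 (2 ^ Nat.clog 2 N), F k := by
    rw [sum_Ioc_convolution_mul]
    have hsub : Finset.Ioc 0 N ⊆ Finset.Ioc 0 (2 ^ Nat.clog 2 N) :=
      Finset.Ioc_subset_Ioc_right (Nat.le_pow_clog (by norm_num) N)
    rw [← Finset.sum_subset hsub]
    · refine Finset.sum_congr rfl fun k _ => ?_
      simp only [hF]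
      congr 1
      refine Finset.sum_congr rfl fun l _ => ?_
      push_cast
      rw [mul_assoc]
    · intro k hk hk'
      have hkN : N < k := by
        simp only [Finset.mem_Ioc] at hk hk'
        omega
      simp [hF, Nat.div_eq_of_lt hkN]
  have hF1 : F 1 = 0 := by
    simp only [hF]
    rw [zeta_mul_moebiusHigh_apply_eq_zero (Nat.one_le_pow _ _ (by omega)), zero_mul]
  have hblock : ∀ i, ‖∑ k ∈ Finset.Ioc (2 ^ i) (2 * 2 ^ i), F k‖ ≤
      5 * N / V * (1 + Real.log N) ^ 2 := by
    intro i
    have h := sq_norm_typeII_block_le (W := V ^ 2) (N := N) (K := 2 ^ i) haq hα (by nlinarith)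
      (by rwa [← pow_mul]) (by rwa [← pow_mul]) (by positivity)
    rw [← pow_mul] at h
    refine (pow_le_pow_iff_left₀ (norm_nonneg _) (by positivity) two_ne_zero).1 (h.trans ?_)
    push_cast
    rw [show (5 * N / V * (1 + Real.log N) ^ 2) ^ 2 =
      25 * N ^ 2 / (V : ℝ) ^ 2 * (1 + Real.log N) ^ 4 by ring]
    gcongr ?_ * ?_
    exact pow_le_pow_right₀ (by linarith) (by norm_num)
  rw [e, sum_Ioc_two_pow, hF1, zero_add]
  refine (norm_sum_le _ _).trans ((Finset.sum_le_sum fun i _ => hblock i).trans ?_)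
  rw [Finset.sum_const, Finset.card_range, nsmul_eq_mul]
  calc _ ≤ 3 * (1 + Real.log N) * (5 * N / V * (1 + Real.log N) ^ 2) := by
        gcongr
        exact clog_two_le_three_mul N
    _ = _ := by ring

/-- The bound for exponential sums over the Möbius function on minor arcs. -/
theorem norm_sum_moebius_mul_expi_le_of_minor {α : ℝ} {a : ℤ} {q V N : ℕ}
    (haq : IsCoprime a (q : ℤ)) (hV : 2 ≤ V) (hN : 2 * V ^ 26 ≤ N) (hVq : V ^ 18 ≤ q)
    (hqN : q * V ^ 18 ≤ N) (hα : |α - a / q| ≤ V ^ 18 / (N * q)) :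
    ‖∑ n ∈ Finset.Ioc 0 N, (μ n : ℂ) * expi (n * α)‖ ≤ 18 * N / V * (1 + Real.log N) ^ 3 := by
  have hV0 : (0 : ℝ) < V := by positivity
  have hV1 : (1 : ℝ) ≤ V := by exact_mod_cast (by omega : 1 ≤ V)
  have hq0 : 0 < q := lt_of_lt_of_le (by positivity) hVq
  have hN0 : 0 < N := lt_of_lt_of_le (by positivity) hN
  have hq0' : (0 : ℝ) < q := by exact_mod_cast hq0
  have hN0' : (0 : ℝ) < N := by exact_mod_cast hN0
  have hlogN : 0 ≤ Real.log N := Real.log_natCast_nonneg N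
  have hN' : (2 : ℝ) * V ^ 26 ≤ N := by exact_mod_cast hN
  have hqN' : (q : ℝ) * V ^ 18 ≤ N := by exact_mod_cast hqN
  have h1 : ∑ n ∈ Finset.Ioc 0 N, (μ n : ℂ) * expi (n * α) =
      2 * ∑ n ∈ Finset.Ioc 0 N, moebiusLow (V ^ 4) n * expi (n * α) -
        ∑ n ∈ Finset.Ioc 0 N, ((moebiusLow (V ^ 4) * moebiusLow (V ^ 4)) *
          (ζ : ArithmeticFunction ℂ)) n * expi (n * α) +
        ∑ n ∈ Finset.Ioc 0 N, (((ζ : ArithmeticFunction ℂ) * moebiusHigh (V ^ 4)) *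
          moebiusHigh (V ^ 4)) n * expi (n * α) := by
    rw [Finset.mul_sum, ← Finset.sum_sub_distrib, ← Finset.sum_add_distrib]
    refine Finset.sum_congr rfl fun n _ => ?_
    have h := congrArg (fun f : ArithmeticFunction ℂ => f n) (moebius_vaughan (V ^ 4))
    simp only [intCoe_apply, ArithmeticFunction.add_apply] at h
    linear_combination expi (n * α) * h
  have hlow : ‖∑ n ∈ Finset.Ioc 0 N, moebiusLow (V ^ 4) n * expi (n * α)‖ ≤ (V : ℝ) ^ 4 := by
    calc _ ≤ ∑ n ∈ Finset.Ioc 0 N, if n ≤ V ^ 4 then (1 : ℝ) else 0 := by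
          refine (norm_sum_le _ _).trans (Finset.sum_le_sum fun n _ => ?_)
          rw [norm_mul, norm_expi, mul_one]
          split_ifs with h
          · exact norm_moebiusLow_le _ _
          · rw [moebiusLow_apply, if_neg h, norm_zero]
      _ = (((Finset.Ioc 0 N).filter fun n => n ≤ V ^ 4).card : ℝ) := Finset.sum_boole _ _
      _ ≤ ((Finset.Ioc 0 (V ^ 4)).card : ℝ) := by
          gcongr
          intro k hk
          simp only [Finset.mem_filter, Finset.mem_Ioc] at hk ⊢
          exact ⟨hk.1.1, hk.2⟩
      _ = _ := by simp
  have hI : ‖∑ n ∈ Finset.Ioc 0 N, ((moebiusLow (V ^ 4) * moebiusLow (V ^ 4)) *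
      (ζ : ArithmeticFunction ℂ)) n * expi (n * α)‖ ≤ (V : ℝ) ^ 16 * q := by
    have h := norm_typeI_le (α := α) (U := V ^ 4) (N := N) haq ?_ ?_
    · rw [← show ((V ^ 4 : ℕ) : ℝ) ^ 4 = V ^ 16 by push_cast; ring]
      exact h
    · refine lt_of_lt_of_le ?_ hVq
      rw [← pow_mul]
      exact Nat.pow_lt_pow_right (by omega) (by norm_num)
    · push_cast
      calc (((V : ℝ) ^ 4) ^ 2) * |α - a / q| ≤
          ((V : ℝ) ^ 4) ^ 2 * ((V : ℝ) ^ 18 / (N * q)) := by gcongr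
        _ = (2 * (V : ℝ) ^ 26) / N * (1 / (2 * (q : ℝ))) := by
            field_simp
        _ ≤ 1 * (1 / (2 * (q : ℝ))) := by
            gcongr
            exact (div_le_one hN0').2 hN'
        _ = _ := one_mul _
  have hα' : |α - a / q| ≤ 1 / q ^ 2 := by
    refine hα.trans ?_
    rw [div_le_div_iff₀ (by positivity) (by positivity)]
    nlinarith
  have hII := norm_typeII_le haq hα' hV
    ((Nat.pow_le_pow_right (by omega) (by norm_num)).trans hVq)
    ((Nat.mul_le_mul_left q (Nat.pow_le_pow_right (by omega) (by norm_num))).trans hqN)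
  have hlow' : (V : ℝ) ^ 4 ≤ N / V := by
    rw [le_div_iff₀ hV0, ← pow_succ]
    norm_num only
    have := pow_le_pow_right₀ hV1 (by norm_num : 5 ≤ 26)
    have : 0 ≤ (V : ℝ) ^ 26 := by positivity
    linarith
  have hI' : (V : ℝ) ^ 16 * q ≤ N / V := by
    rw [le_div_iff₀ hV0]
    calc (V : ℝ) ^ 16 * q * V = (q : ℝ) * (V : ℝ) ^ 17 := by ring
      _ ≤ (q : ℝ) * (V : ℝ) ^ 18 := by
          gcongr
          norm_num
      _ ≤ N := hqN'
  have hlog1 : 1 ≤ (1 + Real.log N) ^ 3 := one_le_pow₀ (by linarith)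
  have hNV : 0 ≤ (N : ℝ) / V := by positivity
  rw [h1]
  refine (norm_add_le _ _).trans ?_
  have hsub := norm_sub_le (2 * ∑ n ∈ Finset.Ioc 0 N, moebiusLow (V ^ 4) n * expi (n * α))
    (∑ n ∈ Finset.Ioc 0 N, ((moebiusLow (V ^ 4) * moebiusLow (V ^ 4)) *
      (ζ : ArithmeticFunction ℂ)) n * expi (n * α))
  rw [norm_mul, Complex.norm_ofNat] at hsub
  have h3 : 3 * ((N : ℝ) / V) ≤ 3 * (N / V) * (1 + Real.log N) ^ 3 :=
    le_mul_of_one_le_right (by positivity) hlog1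
  calc _ ≤ 3 * ((N : ℝ) / V) + 15 * N / V * (1 + Real.log N) ^ 3 := by linarith
    _ ≤ 3 * (N / V) * (1 + Real.log N) ^ 3 + 15 * N / V * (1 + Real.log N) ^ 3 := by linarith
    _ = _ := by ring

/-- Davenport's bound for exponential sums over the Möbius function. -/
theorem exists_norm_sum_moebius_mul_expi_le (A : ℕ) : ∃ C : ℝ, 0 < C ∧ ∀ (α : ℝ) (N : ℕ),
    ‖∑ n ∈ Finset.Ioc 0 N, (μ n : ℂ) * expi (n * α)‖ ≤ C * decay A N := by
  obtain ⟨b, hb⟩ : ∃ k, k = A + 3 := ⟨_, rfl⟩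
  obtain ⟨A', hA'⟩ : ∃ k, k = A + 90 * b := ⟨_, rfl⟩
  obtain ⟨C₀, hC₀, hmaj⟩ := exists_norm_sum_moebius_mul_expi_le_of_major A'
  obtain ⟨C₁, hC₁⟩ : ∃ x : ℝ, x = (26 * b + A).factorial * (6 * 2 ^ 26) := ⟨_, rfl⟩
  obtain ⟨C₂, hC₂⟩ : ∃ x : ℝ, x = C₀ * 8 * 2 ^ 90 := ⟨_, rfl⟩
  have hC₁0 : 0 ≤ C₁ := by rw [hC₁]; positivity
  have hC₂0 : 0 ≤ C₂ := by rw [hC₂]; positivity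
  refine ⟨(144 + C₁ + C₂) * (1 + 2 * A) ^ A, by positivity, fun α N => ?_⟩
  rcases Nat.eq_zero_or_pos N with rfl | hN
  · simp [decay]
  obtain ⟨l, hl⟩ : ∃ x, x = Real.log (N + 2) := ⟨_, rfl⟩
  have hl1 : 1 < l := hl ▸ one_le_log_add_two hN
  have hN1 : (1 : ℝ) ≤ N := by exact_mod_cast hN
  have hlogN : Real.log N ≤ l := hl ▸ Real.log_le_log (by linarith) (by linarith)
  have hlogN0 : 0 ≤ Real.log N := Real.log_natCast_nonneg N
  have hdecay : (N : ℝ) / l ^ A ≤ (1 + 2 * A) ^ A * decay A N := by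
    have h1 : Real.log (N + Real.exp (2 * A)) ≤ (1 + 2 * A) * l := by
      have h2 : Real.log (N + Real.exp (2 * A)) ≤ Real.log ((N + 2) * Real.exp (2 * A)) := by
        have : (1 : ℝ) ≤ Real.exp (2 * A) := Real.one_le_exp (by positivity)
        refine Real.log_le_log (by positivity) ?_
        nlinarith
      rw [Real.log_mul (by positivity) (Real.exp_pos _).ne', Real.log_exp, ← hl] at h2
      nlinarith [(Nat.cast_nonneg A : (0 : ℝ) ≤ A)]
    have h3 : 0 < Real.log (N + Real.exp (2 * A)) := Real.log_pos (by
      have := Real.exp_pos (2 * A)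
      have := Real.one_le_exp (by positivity : (0 : ℝ) ≤ 2 * A)
      linarith)
    rw [decay, mul_div_assoc', div_le_div_iff₀ (by positivity) (by positivity)]
    calc (N : ℝ) * Real.log (N + Real.exp (2 * A)) ^ A ≤ N * ((1 + 2 * A) * l) ^ A := by gcongr
      _ = _ := by rw [mul_pow]; ring
  suffices h : ‖∑ n ∈ Finset.Ioc 0 N, (μ n : ℂ) * expi (n * α)‖ ≤ (144 + C₁ + C₂) * (N / l ^ A) by
    refine h.trans ?_
    rw [mul_assoc]
    gcongr
  have hNl : 0 ≤ (N : ℝ) / l ^ A := by positivity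
  obtain ⟨V, hV⟩ : ∃ x, x = ⌈l ^ b⌉₊ := ⟨_, rfl⟩
  have hlb : 1 < l ^ b := one_lt_pow₀ hl1 (by omega)
  have hVl : l ^ b ≤ V := hV ▸ Nat.le_ceil _
  have hV2 : 2 ≤ V := by
    have : (1 : ℝ) < V := hlb.trans_le hVl
    exact_mod_cast this
  have hVu : (V : ℝ) ≤ 2 * l ^ b := by
    have := Nat.ceil_lt_add_one (by positivity : 0 ≤ l ^ b)
    rw [← hV] at this
    linarith
  rcases lt_or_ge N (2 * V ^ 26) with hsmall | hbig
  · have htriv : ‖∑ n ∈ Finset.Ioc 0 N, (μ n : ℂ) * expi (n * α)‖ ≤ N := by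
      refine (norm_sum_le _ _).trans ?_
      calc _ ≤ ∑ n ∈ Finset.Ioc 0 N, (1 : ℝ) := Finset.sum_le_sum fun n _ => by
            rw [norm_mul, norm_expi, mul_one]
            exact norm_moebius_le n
        _ = N := by simp
    have h1 : (N : ℝ) + 2 ≤ 6 * 2 ^ 26 * l ^ (26 * b) := by
      have h2 : (N : ℝ) ≤ 2 * V ^ 26 := by exact_mod_cast hsmall.le
      have h3 : (V : ℝ) ^ 26 ≤ (2 * l ^ b) ^ 26 := by gcongr
      rw [mul_pow, ← pow_mul, mul_comm b] at h3
      linarith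
    have h2 : l ^ (26 * b + A) ≤ (26 * b + A).factorial * (6 * 2 ^ 26 * l ^ (26 * b)) :=
      (hl ▸ log_pow_le_factorial_mul _ (by linarith)).trans (by gcongr)
    have h3 : l ^ A ≤ C₁ := by
      rw [pow_add, hC₁] at *
      have : 0 < l ^ (26 * b) := by positivity
      refine le_of_mul_le_mul_left ?_ this
      linarith
    have h4 : (N : ℝ) ≤ C₁ * (N / l ^ A) := by
      rw [mul_div_assoc', le_div_iff₀ (by positivity), mul_comm C₁]
      gcongr
    refine htriv.trans (h4.trans ?_)
    gcongr
    linarith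
  obtain ⟨P, hP⟩ : ∃ x, x = V ^ 18 := ⟨_, rfl⟩
  have hP0 : 0 < P := by rw [hP]; positivity
  have hPN : P ≤ N := by
    have := Nat.pow_le_pow_right (by omega : 0 < V) (by norm_num : 18 ≤ 26)
    omega
  obtain ⟨r, hr, hrq⟩ := Real.exists_rat_abs_sub_le_and_den_le α (Nat.div_pos hPN hP0)
  have hq0 : 0 < r.den := r.den_pos
  have hq0' : (0 : ℝ) < r.den := by exact_mod_cast hq0
  have hqN : r.den * P ≤ N := (Nat.le_div_iff_mul_le hP0).1 hrq
  have hr' : |α - (r.num : ℝ) / r.den| ≤ P / (N * r.den) := by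
    rw [← Rat.cast_def]
    refine hr.trans ?_
    have h1 : (N : ℝ) ≤ ((N / P : ℕ) + 1) * P := by
      exact_mod_cast (Nat.lt_div_mul_add (a := N) hP0).le.trans (by rw [add_mul, one_mul])
    rw [div_le_div_iff₀ (by positivity) (by positivity)]
    nlinarith
  rcases le_or_gt P r.den with hmin | hmaj'
  · have h := norm_sum_moebius_mul_expi_le_of_minor (V := V) (N := N)
      (Rat.isCoprime_num_den r) hV2 hbig (hP ▸ hmin) (hP ▸ hqN)
      (by rw [hP] at hr'; exact_mod_cast hr')
    refine h.trans ?_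
    calc 18 * N / V * (1 + Real.log N) ^ 3 ≤ 18 * N / l ^ b * (2 * l) ^ 3 := by
          gcongr
          linarith
      _ = 144 * (N / l ^ A) := by
          rw [hb, pow_add]
          field_simp
          ring
      _ ≤ _ := by
          gcongr
          linarith
  · have : NeZero r.den := ⟨hq0.ne'⟩
    refine (hmaj r.den r.num α N).trans ?_
    have h1 : |α - (r.num : ℝ) / r.den| * N ≤ P := by
      calc |α - (r.num : ℝ) / r.den| * N ≤ P / (N * r.den) * N := by gcongr
        _ = P / r.den := by field_simp
        _ ≤ P := div_le_self (by positivity) (by exact_mod_cast hq0)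
    have h2 : 1 + 2 * Real.pi * |α - (r.num : ℝ) / r.den| * N ≤ 8 * P := by
      have hP1 : (1 : ℝ) ≤ P := by exact_mod_cast hP0
      have := Real.pi_lt_d2
      have := Real.pi_pos
      nlinarith [abs_nonneg (α - (r.num : ℝ) / r.den)]
    have h3 : (r.den : ℝ) ≤ P := by exact_mod_cast hmaj'.le
    have h4 : decay A' N ≤ N / l ^ A' := by
      have h5 : (2 : ℝ) ≤ Real.exp (2 * A') := by
        have h6 : (1 : ℝ) ≤ A' := by exact_mod_cast (by omega : 1 ≤ A')
        have := Real.add_one_le_exp (2 * A' : ℝ)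
        linarith
      have h6 : l ≤ Real.log (N + Real.exp (2 * A')) := by
        rw [hl]
        exact Real.log_le_log (by linarith) (by linarith)
      rw [decay]
      gcongr
    have h5 : (P : ℝ) ^ 5 ≤ 2 ^ 90 * l ^ (90 * b) := by
      rw [hP]
      push_cast
      rw [← pow_mul]
      calc (V : ℝ) ^ (18 * 5) ≤ (2 * l ^ b) ^ (18 * 5) := by gcongr
        _ = _ := by rw [mul_pow, ← pow_mul, mul_comm b]
    have h6 := decay_nonneg A' (x := N) (by positivity)
    calc _ ≤ C₀ * P ^ 4 * (N / l ^ A') * (8 * P) := by gcongr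
      _ = C₀ * 8 * P ^ 5 * (N / l ^ A') := by ring
      _ ≤ C₀ * 8 * (2 ^ 90 * l ^ (90 * b)) * (N / l ^ A') := by gcongr
      _ = C₂ * (N / l ^ A) := by
          rw [hC₂, hA', pow_add]
          field_simp
      _ ≤ _ := by
          gcongr
          linarith

end Davenport

section Parseval

lemma expi_ne_one {x : ℝ} (h : ∀ n : ℤ, x ≠ n) : expi x ≠ 1 := by
  intro h1
  have h2 := four_mul_distInt_le x
  rw [h1, sub_self, norm_zero] at h2
  have h3 : |x - round x| = 0 := le_antisymm (by rw [distInt] at h2; linarith) (abs_nonneg _)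
  exact h (round x) (sub_eq_zero.1 (abs_eq_zero.1 h3))

lemma sum_range_expi_eq_ite {M : ℕ} (hM : 0 < M) {m n : ℕ} (hm : m < M) (hn : n < M) :
    ∑ j ∈ Finset.range M, expi (n * (j / M) - m * (j / M)) = if m = n then (M : ℂ) else 0 := by
  have hM' : (M : ℝ) ≠ 0 := by positivity
  split_ifs with h
  · subst h
    simp [expi_zero]
  · set x : ℝ := ((n : ℝ) - m) / M with hx
    have e : ∀ j ∈ Finset.range M, expi (n * (j / M) - m * (j / M)) = expi x ^ j := by
      intro j _
      rw [← expi_nat_mul, hx]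
      congr 1
      ring
    rw [Finset.sum_congr rfl e]
    have hne : expi x ≠ 1 := by
      refine expi_ne_one fun k hk => ?_
      rw [hx, div_eq_iff hM'] at hk
      have hk' : (n : ℤ) - m = k * M := by exact_mod_cast hk
      have hd : (M : ℤ) ∣ (n : ℤ) - m := ⟨k, by rw [hk', mul_comm]⟩
      have := Int.eq_zero_of_abs_lt_dvd hd (by rw [abs_lt]; constructor <;> omega)
      omega
    rw [geom_sum_eq hne, ← expi_nat_mul, hx, mul_div_cancel₀ _ hM']
    have : expi ((n : ℝ) - m) = 1 := by
      have h1 := expi_intCast ((n : ℤ) - m)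
      push_cast at h1
      exact h1
    rw [this, sub_self, zero_div]

/-- Parseval's identity for finite exponential sums. -/
theorem sum_sq_norm_expi_eq {M : ℕ} (hM : 0 < M) (u : ℕ → ℂ) :
    ∑ j ∈ Finset.range M, ‖∑ n ∈ Finset.range M, u n * expi (n * (j / M))‖ ^ 2 =
      M * ∑ n ∈ Finset.range M, ‖u n‖ ^ 2 := by
  rw [← Complex.ofReal_inj]
  push_cast
  have h1 : ∀ j ∈ Finset.range M,
      ((‖∑ n ∈ Finset.range M, u n * expi (n * (j / M))‖ : ℂ) ^ 2) =
        ∑ m ∈ Finset.range M, ∑ n ∈ Finset.range M,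
          (starRingEnd ℂ) (u m) * u n * expi (n * (j / M) - m * (j / M)) := by
    intro j _
    rw [← Complex.conj_mul', map_sum, Finset.sum_mul_sum]
    refine Finset.sum_congr rfl fun m _ => Finset.sum_congr rfl fun n _ => ?_
    rw [map_mul, ← expi_neg, mul_mul_mul_comm, ← expi_add]
    congr 2
    ring
  rw [Finset.sum_congr rfl h1, Finset.sum_comm, Finset.mul_sum]
  refine Finset.sum_congr rfl fun m hm => ?_
  rw [Finset.sum_comm]
  have h2 : ∀ n ∈ Finset.range M, ∑ j ∈ Finset.range M,
      (starRingEnd ℂ) (u m) * u n * expi (n * (j / M) - m * (j / M)) =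
        if m = n then (starRingEnd ℂ) (u m) * u n * M else 0 := by
    intro n hn
    rw [← Finset.mul_sum, sum_range_expi_eq_ite hM (Finset.mem_range.1 hm) (Finset.mem_range.1 hn),
      mul_ite, mul_zero]
  rw [Finset.sum_congr rfl h2, Finset.sum_ite_eq, if_pos hm, Complex.conj_mul', mul_comm]

/-- The second moment of a convolution is controlled by the sup norm of a Fourier transform. -/
theorem sum_sq_convolution_le {u v : ℕ → ℝ} {N : ℕ} {B : ℝ}
    (hB : ∀ α : ℝ, ‖∑ n ∈ Finset.range (N + 1), (v n : ℂ) * expi (n * α)‖ ≤ B) :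
    ∑ n ∈ Finset.range (N + 1), (∑ x ∈ Finset.HasAntidiagonal.antidiagonal n, u x.1 * v x.2) ^ 2 ≤
      B ^ 2 * ∑ n ∈ Finset.range (N + 1), u n ^ 2 := by
  set M := 2 * N + 1 with hM
  have hM0 : 0 < M := by omega
  have hM0' : (0 : ℝ) < M := by exact_mod_cast hM0
  have hsub : Finset.range (N + 1) ⊆ Finset.range M := Finset.range_subset_range.2 (by omega)
  set s := Finset.range (N + 1) ×ˢ Finset.range (N + 1) with hs
  set c : ℕ → ℝ := fun k => ∑ x ∈ s with x.1 + x.2 = k, u x.1 * v x.2 with hc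
  have hck : ∀ k ∈ Finset.range (N + 1), c k = ∑ x ∈ Finset.HasAntidiagonal.antidiagonal k, u x.1 * v x.2 := by
    intro k hk
    refine Finset.sum_congr ?_ fun _ _ => rfl
    ext x
    simp only [hs, Finset.mem_filter, Finset.mem_product, Finset.mem_range,
      Finset.HasAntidiagonal.mem_antidiagonal] at hk ⊢
    constructor
    · exact fun h => h.2
    · intro h
      omega
  have hprod : ∀ α : ℝ, ∑ k ∈ Finset.range M, (c k : ℂ) * expi (k * α) =
      (∑ n ∈ Finset.range (N + 1), (u n : ℂ) * expi (n * α)) *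
        ∑ n ∈ Finset.range (N + 1), (v n : ℂ) * expi (n * α) := by
    intro α
    rw [Finset.sum_mul_sum, ← Finset.sum_product', ← hs,
      ← Finset.sum_fiberwise_of_maps_to (g := fun x : ℕ × ℕ => x.1 + x.2) (t := Finset.range M)]
    · refine Finset.sum_congr rfl fun k _ => ?_
      simp only [hc]
      push_cast
      rw [Finset.sum_mul]
      refine Finset.sum_congr rfl fun x hx => ?_
      rw [← (Finset.mem_filter.1 hx).2, mul_mul_mul_comm, ← expi_add]
      congr 2
      push_cast
      ring
    · intro x hx
      simp only [hs, Finset.mem_product, Finset.mem_range] at hx ⊢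
      omega
  have hPu : ∑ j ∈ Finset.range M, ‖∑ n ∈ Finset.range (N + 1), (u n : ℂ) * expi (n * (j / M))‖ ^ 2
      = M * ∑ n ∈ Finset.range (N + 1), u n ^ 2 := by
    have h := sum_sq_norm_expi_eq hM0 (fun n => if n < N + 1 then (u n : ℂ) else 0)
    have e1 : ∀ F : ℕ → ℂ, ∑ n ∈ Finset.range M, (if n < N + 1 then (u n : ℂ) else 0) * F n =
        ∑ n ∈ Finset.range (N + 1), (u n : ℂ) * F n := by
      intro F
      rw [← Finset.sum_subset hsub]
      · refine Finset.sum_congr rfl fun n hn => ?_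
        rw [if_pos (Finset.mem_range.1 hn)]
      · intro n _ hn
        rw [if_neg (by simpa using hn), zero_mul]
    simp only [e1] at h
    rw [h, ← Finset.sum_subset hsub]
    · congr 1
      refine Finset.sum_congr rfl fun n hn => ?_
      rw [if_pos (Finset.mem_range.1 hn), norm_real, Real.norm_eq_abs, sq_abs]
    · intro n _ hn
      rw [if_neg (by simpa using hn), norm_zero, zero_pow two_ne_zero]
  have hPc := sum_sq_norm_expi_eq hM0 (fun k => (c k : ℂ))
  simp only [hprod, norm_mul, mul_pow] at hPc
  have h1 : (M : ℝ) * ∑ k ∈ Finset.range M, ‖(c k : ℂ)‖ ^ 2 ≤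
      B ^ 2 * (M * ∑ n ∈ Finset.range (N + 1), u n ^ 2) := by
    rw [← hPc, ← hPu, Finset.mul_sum]
    refine Finset.sum_le_sum fun j _ => ?_
    rw [mul_comm]
    gcongr
    exact hB _
  have h2 : ∑ k ∈ Finset.range M, ‖(c k : ℂ)‖ ^ 2 ≤
      B ^ 2 * ∑ n ∈ Finset.range (N + 1), u n ^ 2 := by
    refine le_of_mul_le_mul_left ?_ hM0'
    linarith
  refine le_trans ?_ h2
  calc _ = ∑ n ∈ Finset.range (N + 1), ‖(c n : ℂ)‖ ^ 2 := by
        refine Finset.sum_congr rfl fun n hn => ?_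
        rw [norm_real, Real.norm_eq_abs, sq_abs, hck n hn]
    _ ≤ _ := Finset.sum_le_sum_of_subset_of_nonneg hsub fun _ _ _ => by positivity

end Parseval

section SieveModel

open ArithmeticFunction
open scoped ArithmeticFunction.Moebius ArithmeticFunction.zeta

/-- The logarithm restricted to the primes. -/
noncomputable def primeLog (n : ℕ) : ℝ := if n.Prime then Real.log n else 0

/-- The weights `μ(d) log (R / d)` for `d ≤ R`. -/
noncomputable def sieveWeight (R d : ℕ) : ℝ := if d ≤ R then μ d * Real.log (R / d) else 0

/-- The divisor sum `∑ μ(d) log (R / d)` over divisors `d ≤ R` of `n`, a model of the von Mangoldt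
function. -/
noncomputable def sieveModel (R n : ℕ) : ℝ := ∑ d ∈ n.divisors, sieveWeight R d

/-- The weights `μ(d) log (d / R)` for `d > R`. -/
noncomputable def sieveTail (R : ℕ) : ArithmeticFunction ℂ :=
  ⟨fun d => if d ≤ R then 0 else ((Real.log (d / R) : ℝ) : ℂ) * (μ d : ℂ), by simp⟩

lemma sieveTail_apply (R d : ℕ) : sieveTail R d =
    if d ≤ R then 0 else ((Real.log (d / R) : ℝ) : ℂ) * (μ d : ℂ) := rfl

lemma primeLog_nonneg (n : ℕ) : 0 ≤ primeLog n := by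
  rw [primeLog]; split_ifs
  · exact Real.log_natCast_nonneg n
  · exact le_rfl

lemma primeLog_le_log (n : ℕ) : primeLog n ≤ Real.log n := by
  rw [primeLog]; split_ifs
  · exact le_rfl
  · exact Real.log_natCast_nonneg n

lemma primeLog_le_vonMangoldt (n : ℕ) : primeLog n ≤ Λ n := by
  rw [primeLog]; split_ifs with h
  · rw [vonMangoldt_apply_prime h]
  · exact vonMangoldt_nonneg

lemma vonMangoldt_add_eq_sieveModel_sub {R n : ℕ} (hR : 0 < R) :
    ((Λ n : ℝ) : ℂ) + (if n = 1 then ((Real.log R : ℝ) : ℂ) else 0) =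
      (sieveModel R n : ℂ) - ∑ d ∈ n.divisors, sieveTail R d := by
  have h1 : ∀ d ∈ n.divisors, (sieveWeight R d : ℂ) - sieveTail R d =
      ((Real.log R : ℝ) : ℂ) * (μ d : ℂ) - (((μ d : ℝ) * Real.log d : ℝ) : ℂ) := by
    intro d hd
    have hd' : (d : ℝ) ≠ 0 := by
      have := Nat.pos_of_mem_divisors hd
      positivity
    have hR' : (R : ℝ) ≠ 0 := by positivity
    rw [sieveWeight, sieveTail_apply]
    split_ifs
    · rw [Real.log_div hR' hd', sub_zero]
      push_cast
      ring
    · rw [Real.log_div hd' hR', Complex.ofReal_sub, Complex.ofReal_mul]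
      push_cast
      ring
  rw [sieveModel, Complex.ofReal_sum, ← Finset.sum_sub_distrib, Finset.sum_congr rfl h1,
    Finset.sum_sub_distrib, ← Finset.mul_sum, ← Complex.ofReal_sum]
  have h2 : ∑ d ∈ n.divisors, (μ d : ℝ) * Real.log d = - Λ n := by
    have := sum_moebius_mul_log_eq (n := n)
    simpa [log_apply] using this
  have h3 : ∑ d ∈ n.divisors, (μ d : ℂ) = if n = 1 then 1 else 0 := by
    have := congrArg (fun f : ArithmeticFunction ℤ => f n) moebius_mul_coe_zeta
    simp only [coe_mul_zeta_apply, one_apply] at this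
    have h := congrArg (fun z : ℤ => (z : ℂ)) this
    push_cast at h
    simpa using h
  rw [h2, h3]
  split_ifs <;> push_cast <;> ring

lemma norm_sum_sieveTail_le {A : ℕ} {C : ℝ} (hC : 0 ≤ C)
    (hD : ∀ (α : ℝ) (N : ℕ), ‖∑ n ∈ Finset.Ioc 0 N, (μ n : ℂ) * expi (n * α)‖ ≤ C * decay A N)
    {R : ℕ} (hR : 0 < R) (M : ℕ) (β : ℝ) :
    ‖∑ d ∈ Finset.Ioc 0 M, sieveTail R d * expi (d * β)‖ ≤
      4 * C * Real.log (M + 1) * (if M ≤ R then 0 else decay A M) := by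
  split_ifs with hM
  · rw [Finset.sum_eq_zero, norm_zero, mul_zero]
    intro d hd
    rw [sieveTail_apply, if_pos ((Finset.mem_Ioc.1 hd).2.trans hM), zero_mul]
  · push Not at hM
    have hR' : (0 : ℝ) < R := by exact_mod_cast hR
    have hR1 : (1 : ℝ) ≤ R := by exact_mod_cast hR
    rw [← Finset.sum_Ioc_consecutive _ (Nat.zero_le R) hM.le, Finset.sum_eq_zero (s := Finset.Ioc 0 R),
      zero_add]
    · have h1 : ∑ d ∈ Finset.Ioc R M, sieveTail R d * expi (d * β) =
          ∑ d ∈ Finset.Ioc R M, ((Real.log (d / R) : ℝ) : ℂ) * ((μ d : ℂ) * expi (d * β)) := by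
        refine Finset.sum_congr rfl fun d hd => ?_
        rw [sieveTail_apply, if_neg (not_le.2 (Finset.mem_Ioc.1 hd).1), mul_assoc]
      rw [h1]
      have h2 := norm_sum_Ioc_monotone_mul_le (fun d : ℕ => Real.log (d / R))
        (fun d => (μ d : ℂ) * expi (d * β)) hM.le (B := 2 * C * decay A M) ?_ ?_ ?_
      · refine h2.trans ?_
        have h3 : Real.log (((M + 1 : ℕ) : ℝ) / R) ≤ Real.log (M + 1) := by
          refine Real.log_le_log (by positivity) ?_
          push_cast
          exact div_le_self (by positivity) hR1
        have h4 : 0 ≤ decay A M := decay_nonneg A (Nat.cast_nonneg M)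
        calc _ ≤ 2 * C * decay A M * (2 * Real.log (M + 1)) := by gcongr
          _ = _ := by ring
      · intro i hi
        refine Real.log_le_log ?_ ?_
        · have : (0 : ℝ) < i := by exact_mod_cast hR.trans hi
          positivity
        · push_cast
          gcongr
          linarith
      · refine Real.log_nonneg ?_
        rw [le_div_iff₀ hR']
        push_cast
        linarith
      · intro k hk
        have hk := Finset.mem_Icc.1 hk
        have h3 := Finset.sum_Ioc_consecutive (fun d => (μ d : ℂ) * expi (d * β)) (Nat.zero_le R) hk.1
        rw [← eq_sub_iff_add_eq'] at h3
        rw [h3]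
        refine (norm_sub_le _ _).trans ?_
        have h4 := hD β k
        have h5 := hD β R
        have h6 : decay A k ≤ decay A M := decay_mono A (Nat.cast_nonneg k) (by exact_mod_cast hk.2)
        have h7 : decay A R ≤ decay A M :=
          decay_mono A (Nat.cast_nonneg R) (by exact_mod_cast hM.le)
        have h8 := mul_le_mul_of_nonneg_left h6 hC
        have h9 := mul_le_mul_of_nonneg_left h7 hC
        linarith
    · intro d hd
      rw [sieveTail_apply, if_pos (Finset.mem_Ioc.1 hd).2, zero_mul]

lemma norm_sum_conv_sieveTail_le {A : ℕ} {C : ℝ} (hC : 0 ≤ C)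
    (hD : ∀ (α : ℝ) (N : ℕ), ‖∑ n ∈ Finset.Ioc 0 N, (μ n : ℂ) * expi (n * α)‖ ≤ C * decay A N)
    {R : ℕ} (hR : 2 ≤ R) (N : ℕ) (α : ℝ) :
    ‖∑ n ∈ Finset.Ioc 0 N, (∑ d ∈ n.divisors, sieveTail R d) * expi (n * α)‖ ≤
      4 * C * Real.log (N + 1) * (1 + Real.log N) * (N / Real.log R ^ A) := by
  have hlR : 0 < Real.log R := Real.log_pos (by exact_mod_cast hR)
  have h1 : ∀ n ∈ Finset.Ioc 0 N, (∑ d ∈ n.divisors, sieveTail R d) * expi (n * α) =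
      ((ζ : ArithmeticFunction ℂ) * sieveTail R) n * expi (n * α) := fun n _ => by
    rw [coe_zeta_mul_apply]
  rw [Finset.sum_congr rfl h1, sum_Ioc_convolution_mul _ _ (fun n => expi (n * α))]
  refine (norm_sum_le _ _).trans ?_
  calc _ ≤ ∑ k ∈ Finset.Ioc 0 N, 4 * C * Real.log (N + 1) * (N / Real.log R ^ A) * ((1 : ℝ) / k) := by
        refine Finset.sum_le_sum fun k hk => ?_
        have hk := Finset.mem_Ioc.1 hk
        have hk' : (0 : ℝ) < k := by exact_mod_cast hk.1
        rw [norm_mul]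
        have h2 := norm_sum_sieveTail_le hC hD (show 0 < R by omega) (N / k) (k * α)
        have h3 : ∀ l ∈ Finset.Ioc 0 (N / k), sieveTail R l * expi ((k * l : ℕ) * α) =
            sieveTail R l * expi (l * (k * α)) := fun l _ => by
          congr 2; push_cast; ring
        rw [Finset.sum_congr rfl h3]
        have hq : ((N / k : ℕ) : ℝ) ≤ N := by exact_mod_cast Nat.div_le_self N k
        have h4 : Real.log ((N / k : ℕ) + 1) ≤ Real.log (N + 1) :=
          Real.log_le_log (by positivity) (by linarith)
        have h5 : (if N / k ≤ R then 0 else decay A (N / k : ℕ)) ≤ N / Real.log R ^ A * (1 / k) := by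
          split_ifs with h
          · positivity
          · push Not at h
            rw [decay]
            have h6 : ((N / k : ℕ) : ℝ) ≤ N / k := Nat.cast_div_le
            have h7 : Real.log R ≤ Real.log ((N / k : ℕ) + Real.exp (2 * A)) := by
              refine Real.log_le_log (by positivity) ?_
              have : (R : ℝ) ≤ (N / k : ℕ) := by exact_mod_cast h.le
              have := Real.exp_pos (2 * A)
              linarith
            calc _ ≤ (N / k : ℝ) / Real.log R ^ A := by gcongr
              _ = _ := by ring
        have h8 : (0 : ℝ) ≤ if N / k ≤ R then 0 else decay A (N / k : ℕ) := by
          split_ifs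
          · exact le_rfl
          · exact decay_nonneg A (Nat.cast_nonneg _)
        have h9 : 0 ≤ Real.log ((N : ℝ) + 1) := Real.log_nonneg (by
          have : (0 : ℝ) ≤ N := Nat.cast_nonneg N
          linarith)
        calc _ ≤ 1 * (4 * C * Real.log ((N / k : ℕ) + 1) *
              (if N / k ≤ R then 0 else decay A (N / k : ℕ))) := by
              gcongr
              exact norm_zeta_apply_le k
          _ ≤ 1 * (4 * C * Real.log (N + 1) * (N / Real.log R ^ A * (1 / k))) := by gcongr
          _ = _ := by ring
    _ ≤ 4 * C * Real.log (N + 1) * (N / Real.log R ^ A) * (1 + Real.log N) := by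
        rw [← Finset.mul_sum]
        have h9 : 0 ≤ Real.log ((N : ℝ) + 1) := Real.log_nonneg (by
          have : (0 : ℝ) ≤ N := Nat.cast_nonneg N
          linarith)
        gcongr
        exact sum_Ioc_one_div_le N
    _ = _ := by ring

lemma sum_vonMangoldt_sub_primeLog_le {N : ℕ} (hN : 1 ≤ N) :
    ∑ n ∈ Finset.Ioc 0 N, (Λ n - primeLog n) ≤ 2 * √N * Real.log N := by
  have h := Chebyshev.psi_sub_theta_le (x := N) (by exact_mod_cast hN)
  rw [Chebyshev.psi, Chebyshev.theta, Nat.floor_natCast, Finset.sum_filter] at h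
  rw [Finset.sum_sub_distrib]
  exact h

lemma pow_log_mul_sqrt_le (D : ℕ) {x : ℝ} (hx : 1 ≤ x) :
    √x * Real.log x ^ D ≤ 2 ^ D * D.factorial * x := by
  have h1 : 1 ≤ √x := Real.one_le_sqrt.2 hx
  have h2 := log_pow_le_factorial_mul D h1
  have h3 : Real.log x = 2 * Real.log √x := by rw [Real.log_sqrt (by linarith)]; ring
  rw [h3, mul_pow]
  have h4 : √x * √x = x := Real.mul_self_sqrt (by linarith)
  calc √x * (2 ^ D * Real.log √x ^ D) ≤ √x * (2 ^ D * (D.factorial * √x)) := by gcongr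
    _ = 2 ^ D * D.factorial * (√x * √x) := by ring
    _ = _ := by rw [h4]

theorem exists_norm_sum_primeLog_sub_sieveModel_le (D : ℕ) : ∃ C : ℝ, 0 < C ∧ ∀ (N R : ℕ), 2 ≤ R →
    R ≤ N → N ≤ R ^ 8 → ∀ α : ℝ,
    ‖∑ n ∈ Finset.range (N + 1), ((primeLog n - sieveModel R n : ℝ) : ℂ) * expi (n * α)‖ ≤
      C * (N / Real.log N ^ D) := by
  obtain ⟨C, hC, hD⟩ := exists_norm_sum_moebius_mul_expi_le (D + 2)
  obtain ⟨K, hK⟩ : ∃ K : ℝ, K = 2 ^ (D + 1) * (D + 1).factorial := ⟨_, rfl⟩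
  have hK0 : 0 < K := by rw [hK]; positivity
  refine ⟨3 * K + 24 * C * 8 ^ (D + 2), by positivity, fun N R hR hRN hNR α => ?_⟩
  have hN2 : (2 : ℝ) ≤ N := by exact_mod_cast hR.trans hRN
  have hR2 : (2 : ℝ) ≤ R := by exact_mod_cast hR
  have hL : 0 < Real.log N := Real.log_pos (by linarith)
  have hLR : Real.log N ≤ 8 * Real.log R := by
    have h := Real.log_le_log (by linarith) (show (N : ℝ) ≤ (R : ℝ) ^ 8 by exact_mod_cast hNR)
    rw [Real.log_pow] at h
    exact_mod_cast h
  have hlogR : Real.log R ≤ Real.log N := Real.log_le_log (by linarith) (by exact_mod_cast hRN)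
  have h0 : ∑ n ∈ Finset.range (N + 1), ((primeLog n - sieveModel R n : ℝ) : ℂ) * expi (n * α) =
      ∑ n ∈ Finset.Ioc 0 N, ((primeLog n - sieveModel R n : ℝ) : ℂ) * expi (n * α) := by
    rw [Finset.range_eq_Ico, Finset.sum_eq_sum_Ico_succ_bot (Nat.succ_pos N)]
    have : Finset.Ico (0 + 1) (N + 1) = Finset.Ioc 0 N := by
      ext; simp only [Finset.mem_Ico, Finset.mem_Ioc]; omega
    rw [this]
    simp [primeLog, sieveModel]
  have h1 : ∀ n ∈ Finset.Ioc 0 N, ((primeLog n - sieveModel R n : ℝ) : ℂ) * expi (n * α) =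
      -(((Λ n - primeLog n : ℝ) : ℂ) * expi (n * α)) -
        (if n = 1 then ((Real.log R : ℝ) : ℂ) else 0) * expi (n * α) -
        (∑ d ∈ n.divisors, sieveTail R d) * expi (n * α) := by
    intro n hn
    have h := vonMangoldt_add_eq_sieveModel_sub (n := n) (show 0 < R by omega)
    push_cast at h ⊢
    linear_combination expi (n * α) * h
  rw [h0, Finset.sum_congr rfl h1, Finset.sum_sub_distrib, Finset.sum_sub_distrib,
    Finset.sum_neg_distrib]
  have e1 : ‖∑ n ∈ Finset.Ioc 0 N, ((Λ n - primeLog n : ℝ) : ℂ) * expi (n * α)‖ ≤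
      2 * √N * Real.log N := by
    refine (norm_sum_le _ _).trans (le_trans (Finset.sum_le_sum fun n _ => ?_)
      (sum_vonMangoldt_sub_primeLog_le (by omega)))
    rw [norm_mul, norm_expi, mul_one, Complex.norm_real, Real.norm_eq_abs,
      abs_of_nonneg (sub_nonneg.2 (primeLog_le_vonMangoldt n))]
  have e2 : ‖∑ n ∈ Finset.Ioc 0 N, (if n = 1 then ((Real.log R : ℝ) : ℂ) else 0) * expi (n * α)‖ ≤
      √N * Real.log N := by
    simp only [ite_mul, zero_mul]
    rw [Finset.sum_ite_eq' (Finset.Ioc 0 N) 1, if_pos (Finset.mem_Ioc.2 ⟨one_pos, by omega⟩), norm_mul,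
      norm_expi, mul_one, Complex.norm_real, Real.norm_eq_abs,
      abs_of_nonneg (Real.log_natCast_nonneg R)]
    have : 1 ≤ √(N : ℝ) := Real.one_le_sqrt.2 (by linarith)
    nlinarith
  have e3 := norm_sum_conv_sieveTail_le hC.le hD hR N α
  have e4 : √N * Real.log N ≤ K * (N / Real.log N ^ D) := by
    have h := pow_log_mul_sqrt_le (D + 1) (x := N) (by linarith)
    rw [← hK] at h
    rw [mul_div_assoc', le_div_iff₀ (by positivity)]
    calc _ = √N * Real.log N ^ (D + 1) := by ring
      _ ≤ _ := h
  have e5 : 4 * C * Real.log (N + 1) * (1 + Real.log N) * (N / Real.log R ^ (D + 2)) ≤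
      24 * C * 8 ^ (D + 2) * (N / Real.log N ^ D) := by
    have hlog2 : (1 : ℝ) / 2 ≤ Real.log N := by
      have := Real.log_le_log (by norm_num) hN2
      have := Real.log_two_gt_d9
      linarith
    have h2 : Real.log (N + 1) ≤ 2 * Real.log N := by
      have := Real.log_le_log (by positivity) (show (N : ℝ) + 1 ≤ N ^ 2 by nlinarith)
      rw [Real.log_pow] at this
      exact_mod_cast this
    have h3 : (N : ℝ) / Real.log R ^ (D + 2) ≤ 8 ^ (D + 2) * (N / Real.log N ^ (D + 2)) := by
      have h4 : Real.log N ^ (D + 2) ≤ 8 ^ (D + 2) * Real.log R ^ (D + 2) := by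
        rw [← mul_pow]; gcongr
      have : 0 < Real.log R := by linarith
      rw [mul_div_assoc', div_le_div_iff₀ (by positivity) (by positivity)]
      nlinarith
    calc _ ≤ 4 * C * (2 * Real.log N) * (3 * Real.log N) *
          (8 ^ (D + 2) * (N / Real.log N ^ (D + 2))) := by
          gcongr
          linarith
      _ = _ := by field_simp; ring
  refine (norm_sub_le _ _).trans ?_
  refine (add_le_add_left (norm_sub_le _ _) _).trans ?_
  rw [norm_neg]
  calc _ ≤ 2 * √N * Real.log N + √N * Real.log N +
        4 * C * Real.log (N + 1) * (1 + Real.log N) * (N / Real.log R ^ (D + 2)) := by gcongr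
    _ ≤ 3 * (√N * Real.log N) + 24 * C * 8 ^ (D + 2) * (N / Real.log N ^ D) := by linarith
    _ ≤ 3 * (K * (N / Real.log N ^ D)) + 24 * C * 8 ^ (D + 2) * (N / Real.log N ^ D) := by gcongr
    _ = _ := by ring

end SieveModel

section RamanujanSum

open scoped ArithmeticFunction.Moebius

/-- Ramanujan's sum `c_q(n)`, written as a sum over the common divisors of `q` and `n`. -/
noncomputable def ramanujan (q n : ℕ) : ℝ :=
  ∑ d ∈ q.divisors, (if d ∣ n then (d : ℝ) else 0) * μ (q / d)

lemma abs_moebius_le (n : ℕ) : |((μ n : ℤ) : ℝ)| ≤ 1 := by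
  have := ArithmeticFunction.abs_moebius_le_one (n := n)
  exact_mod_cast this

lemma sum_divisors_ramanujan {g : ℕ} (hg : 0 < g) (n : ℕ) :
    ∑ q ∈ g.divisors, ramanujan q n = if g ∣ n then (g : ℝ) else 0 := by
  refine (ArithmeticFunction.sum_eq_iff_sum_mul_moebius_eq (R := ℝ) (f := fun q => ramanujan q n)
    (g := fun g => if g ∣ n then (g : ℝ) else 0)).2 (fun q _ => ?_) g hg
  rw [ramanujan, Nat.sum_divisorsAntidiagonal' (f := fun i j => (μ i : ℝ) * if j ∣ n then (j : ℝ) else 0)]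
  exact Finset.sum_congr rfl fun d _ => mul_comm _ _

lemma sum_divisors_gcd_mul_moebius {q d : ℕ} (hq : 0 < q) :
    ∑ e ∈ q.divisors, (d.gcd e : ℝ) * μ (q / e) = if q ∣ d then (q.totient : ℝ) else 0 := by
  have h := (ArithmeticFunction.sum_eq_iff_sum_mul_moebius_eq (R := ℝ)
    (f := fun q => if q ∣ d then (q.totient : ℝ) else 0) (g := fun e => (d.gcd e : ℝ))).1
    (fun n hn => ?_) q hq
  · rw [Nat.sum_divisorsAntidiagonal' (f := fun i j => (μ i : ℝ) * (d.gcd j : ℝ))] at h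
    rw [← h]
    exact Finset.sum_congr rfl fun d _ => mul_comm _ _
  · rw [← Finset.sum_filter, ← Nat.cast_sum]
    congr 1
    rw [← Nat.sum_totient (d.gcd n)]
    refine Finset.sum_congr ?_ fun _ _ => rfl
    ext k
    simp only [Finset.mem_filter, Nat.mem_divisors, Nat.dvd_gcd_iff]
    have : d.gcd n ≠ 0 := (Nat.gcd_pos_of_pos_right d hn).ne'
    have hn' : n ≠ 0 := hn.ne'
    tauto

lemma sum_divisors_le_sq (q : ℕ) : ∑ d ∈ q.divisors, (d : ℝ) ≤ (q : ℝ) ^ 2 := by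
  calc _ ≤ ∑ d ∈ q.divisors, (q : ℝ) :=
        Finset.sum_le_sum fun d hd => by exact_mod_cast Nat.divisor_le hd
    _ = q.divisors.card * q := by rw [Finset.sum_const, nsmul_eq_mul]
    _ ≤ q * q := by
        gcongr
        exact_mod_cast Nat.card_divisors_le_self q
    _ = _ := by ring

lemma abs_ramanujan_le (q n : ℕ) : |ramanujan q n| ≤ (q : ℝ) ^ 2 := by
  refine (Finset.abs_sum_le_sum_abs _ _).trans (le_trans (Finset.sum_le_sum fun d _ => ?_)
    (sum_divisors_le_sq q))
  rw [abs_mul]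
  calc _ ≤ (d : ℝ) * 1 := by
        gcongr
        · split_ifs <;> simp
        · exact abs_moebius_le _
    _ = _ := mul_one _

lemma sum_mul_ramanujan (F : ℕ → ℝ) (q N : ℕ) : ∑ n ∈ Finset.Ioc 0 N, F n * ramanujan q n =
    ∑ e ∈ q.divisors, e * μ (q / e) * ∑ n ∈ Finset.Ioc 0 N with e ∣ n, F n := by
  simp only [ramanujan, Finset.mul_sum]
  rw [Finset.sum_comm]
  refine Finset.sum_congr rfl fun e _ => ?_
  rw [Finset.sum_filter]
  refine Finset.sum_congr rfl fun n _ => ?_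
  split_ifs <;> ring

lemma abs_sum_divisors_le {q : ℕ} {G : ℕ → ℝ} {B : ℝ} (hB : 0 ≤ B)
    (hG : ∀ e ∈ q.divisors, |G e| ≤ e * B) : |∑ e ∈ q.divisors, μ (q / e) * G e| ≤ q ^ 2 * B := by
  refine (Finset.abs_sum_le_sum_abs _ _).trans ?_
  calc _ ≤ ∑ e ∈ q.divisors, (e : ℝ) * B := by
        refine Finset.sum_le_sum fun e he => ?_
        rw [abs_mul]
        calc _ ≤ 1 * (e * B) := by
              gcongr
              · exact abs_moebius_le _
              · exact hG e he
          _ = _ := one_mul _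
    _ = (∑ e ∈ q.divisors, (e : ℝ)) * B := by rw [Finset.sum_mul]
    _ ≤ _ := by
        gcongr
        exact sum_divisors_le_sq q

lemma sum_range_expi_div (d n : ℕ) (hd : 0 < d) :
    ∑ j ∈ Finset.range d, expi (n * (j / d)) = if d ∣ n then (d : ℂ) else 0 := by
  have h := sum_range_expi_eq_ite hd (Nat.mod_lt n hd) hd
  have hd' : (d : ℝ) ≠ 0 := by positivity
  have h1 : ∀ j ∈ Finset.range d, expi (n * (j / d)) = expi ((n % d : ℕ) * (j / d) - (0 : ℕ) * (j / d)) := by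
    intro j _
    have h2 : (n : ℝ) = d * (n / d : ℕ) + (n % d : ℕ) := by exact_mod_cast (Nat.div_add_mod n d).symm
    have h3 : (n : ℝ) * (j / d) = ((n % d : ℕ) * (j / d) - (0 : ℕ) * (j / d)) + (((n / d * j : ℕ) : ℤ) : ℝ) := by
      rw [Int.cast_natCast, Nat.cast_mul, Nat.cast_zero, zero_mul, sub_zero, h2]
      field_simp
      ring
    rw [h3, expi_add_intCast]
  rw [Finset.sum_congr rfl h1, sum_range_expi_eq_ite hd hd (Nat.mod_lt n hd)]
  simp [Nat.dvd_iff_mod_eq_zero, eq_comm]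

lemma abs_sum_mul_ramanujan_le {F : ℕ → ℝ} {N : ℕ} {B : ℝ}
    (hB : ∀ α : ℝ, ‖∑ n ∈ Finset.Ioc 0 N, (F n : ℂ) * expi (n * α)‖ ≤ B) (q : ℕ) :
    |∑ n ∈ Finset.Ioc 0 N, F n * ramanujan q n| ≤ q ^ 2 * B := by
  have hB0 : 0 ≤ B := (norm_nonneg _).trans (hB 0)
  have h : ∀ e ∈ q.divisors, |(e : ℝ) * ∑ n ∈ Finset.Ioc 0 N with e ∣ n, F n| ≤ e * B := by
    intro e he
    have he' := Nat.pos_of_mem_divisors he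
    have h1 : (((e : ℝ) * ∑ n ∈ Finset.Ioc 0 N with e ∣ n, F n : ℝ) : ℂ) =
        ∑ j ∈ Finset.range e, ∑ n ∈ Finset.Ioc 0 N, (F n : ℂ) * expi (n * (j / e)) := by
      rw [Finset.sum_comm, Finset.sum_filter, Finset.mul_sum, Complex.ofReal_sum]
      refine Finset.sum_congr rfl fun n _ => ?_
      rw [← Finset.mul_sum, sum_range_expi_div e n he']
      split_ifs <;> simp [mul_comm]
    rw [← Real.norm_eq_abs, ← Complex.norm_real, h1]
    calc _ ≤ ∑ j ∈ Finset.range e, B :=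
          (norm_sum_le _ _).trans (Finset.sum_le_sum fun (j : ℕ) _ => hB (j / e))
      _ = _ := by simp
  rw [sum_mul_ramanujan]
  refine le_trans (le_of_eq ?_) (abs_sum_divisors_le hB0 h)
  congr 1
  exact Finset.sum_congr rfl fun e _ => by ring

lemma abs_sum_primeLog_mul_ramanujan_sub_le {q N : ℕ} (hq : 0 < q) :
    |∑ n ∈ Finset.Ioc 0 N, primeLog n * ramanujan q n - μ q * Chebyshev.theta N| ≤
      q ^ 2 * Real.log N := by
  have hθ : Chebyshev.theta N = ∑ n ∈ Finset.Ioc 0 N, primeLog n := by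
    rw [Chebyshev.theta, Nat.floor_natCast, Finset.sum_filter]; rfl
  have hL : 0 ≤ Real.log N := Real.log_natCast_nonneg N
  rw [sum_mul_ramanujan]
  have h1 : ∑ e ∈ q.divisors, (e : ℝ) * μ (q / e) * ∑ n ∈ Finset.Ioc 0 N with e ∣ n, primeLog n -
      μ q * Chebyshev.theta N = ∑ e ∈ q.divisors, (μ (q / e) : ℝ) *
        (if e = 1 then 0 else e * ∑ n ∈ Finset.Ioc 0 N with e ∣ n, primeLog n) := by
    rw [sub_eq_iff_eq_add, ← Finset.sum_erase_add _ _ (Nat.one_mem_divisors.2 hq.ne'),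
      ← Finset.sum_erase_add (s := q.divisors) (a := 1) (f := fun e => (μ (q / e) : ℝ) *
        (if e = 1 then 0 else e * ∑ n ∈ Finset.Ioc 0 N with e ∣ n, primeLog n))
        (Nat.one_mem_divisors.2 hq.ne')]
    simp only [if_true, mul_zero, add_zero, hθ, one_dvd, Finset.filter_true, Nat.div_one, Nat.cast_one,
      one_mul]
    congr 1
    refine Finset.sum_congr rfl fun e he => ?_
    rw [if_neg (Finset.mem_erase.1 he).1]
    ring
  rw [h1]
  refine abs_sum_divisors_le hL fun e he => ?_
  split_ifs with h
  · rw [abs_zero]; positivity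
  · rw [abs_mul, Nat.abs_cast]
    gcongr
    rw [abs_of_nonneg (Finset.sum_nonneg fun n _ => primeLog_nonneg n)]
    calc _ ≤ ∑ n ∈ Finset.Ioc 0 N with e ∣ n, (if n = e then Real.log N else 0) := by
          refine Finset.sum_le_sum fun n hn => ?_
          have hn := Finset.mem_filter.1 hn
          have hn1 := Finset.mem_Ioc.1 hn.1
          rw [primeLog]
          by_cases hp : n.Prime
          · rw [if_pos hp, if_pos (((Nat.dvd_prime hp).1 hn.2).resolve_left h).symm]
            exact Real.log_le_log (by exact_mod_cast hn1.1) (by exact_mod_cast hn1.2)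
          · rw [if_neg hp]; split_ifs <;> simp [hL]
      _ ≤ _ := by
          rw [Finset.sum_ite_eq' _ e]
          split_ifs <;> simp [hL]

end RamanujanSum

section SieveCorrelation

open scoped ArithmeticFunction.Moebius

/-- The coefficient of the Ramanujan sum `c_q` in the expansion of `sieveModel R`. -/
noncomputable def sieveCoeff (R q : ℕ) : ℝ :=
  ∑ d ∈ Finset.Ioc 0 R with q ∣ d, sieveWeight R d / d

lemma abs_sieveWeight_le {R d : ℕ} (hd : 0 < d) : |sieveWeight R d| ≤ Real.log R := by
  have hd' : (1 : ℝ) ≤ d := by exact_mod_cast hd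
  rw [sieveWeight]
  split_ifs with h
  · have hdR : (d : ℝ) ≤ R := by exact_mod_cast h
    have h0 : 0 ≤ Real.log ((R : ℝ) / d) := Real.log_nonneg (by rw [le_div_iff₀] <;> linarith)
    rw [abs_mul, abs_of_nonneg h0]
    calc _ ≤ 1 * Real.log R := by
          gcongr
          · exact abs_moebius_le d
          · exact div_pos (by linarith) (by linarith)
          · exact div_le_self (by positivity) hd'
      _ = _ := one_mul _
  · rw [abs_zero]
    exact Real.log_natCast_nonneg R

lemma sieveModel_eq_sum {R n : ℕ} (hn : 0 < n) :
    sieveModel R n = ∑ d ∈ Finset.Ioc 0 R, if d ∣ n then sieveWeight R d else 0 := by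
  rw [sieveModel, ← Finset.sum_filter]
  refine (Finset.sum_subset_zero_on_sdiff (fun d hd => ?_) (fun d hd => ?_) fun _ _ => rfl).symm
  · have hd := Finset.mem_filter.1 hd
    exact Nat.mem_divisors.2 ⟨hd.2, hn.ne'⟩
  · have hd := Finset.mem_sdiff.1 hd
    have h1 := Nat.pos_of_mem_divisors hd.1
    have h2 := (Nat.mem_divisors.1 hd.1).1
    rw [sieveWeight, if_neg]
    intro h
    exact hd.2 (Finset.mem_filter.2 ⟨Finset.mem_Ioc.2 ⟨h1, h⟩, h2⟩)

lemma abs_sieveModel_le (R n : ℕ) : |sieveModel R n| ≤ n.divisors.card * Real.log R := by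
  rw [sieveModel]
  refine (Finset.abs_sum_le_sum_abs _ _).trans ?_
  calc _ ≤ ∑ d ∈ n.divisors, Real.log R :=
        Finset.sum_le_sum fun d hd => abs_sieveWeight_le (Nat.pos_of_mem_divisors hd)
    _ = _ := by rw [Finset.sum_const, nsmul_eq_mul]

lemma sum_sieveModel_of_dvd (R N e : ℕ) : ∑ n ∈ Finset.Ioc 0 N with e ∣ n, sieveModel R n =
    ∑ d ∈ Finset.Ioc 0 R, sieveWeight R d * (N / d.lcm e : ℕ) := by
  rw [Finset.sum_congr rfl fun n hn => sieveModel_eq_sum (R := R)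
    (Finset.mem_Ioc.1 (Finset.mem_filter.1 hn).1).1, Finset.sum_comm]
  refine Finset.sum_congr rfl fun d _ => ?_
  rw [← Finset.sum_filter, Finset.sum_const, nsmul_eq_mul, mul_comm, Finset.filter_filter,
    ← Nat.Ioc_filter_dvd_card_eq_div]
  congr 4
  ext n
  rw [Nat.lcm_dvd_iff, and_comm]

lemma abs_sum_sieveModel_mul_ramanujan_sub_le {q : ℕ} (hq : 0 < q) (R N : ℕ) :
    |∑ n ∈ Finset.Ioc 0 N, sieveModel R n * ramanujan q n - N * (q.totient * sieveCoeff R q)| ≤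
      q ^ 2 * (R * Real.log R) := by
  have hR : 0 ≤ Real.log R := Real.log_natCast_nonneg R
  rw [sum_mul_ramanujan]
  have h1 : (N : ℝ) * (q.totient * sieveCoeff R q) = ∑ e ∈ q.divisors, (μ (q / e) : ℝ) *
      (e * ∑ d ∈ Finset.Ioc 0 R, sieveWeight R d * ((N : ℝ) / (d.lcm e : ℕ))) := by
    have h2 : ∀ e ∈ q.divisors, (μ (q / e) : ℝ) *
        (e * ∑ d ∈ Finset.Ioc 0 R, sieveWeight R d * ((N : ℝ) / (d.lcm e : ℕ))) =
        ∑ d ∈ Finset.Ioc 0 R, N * (sieveWeight R d / d) * ((d.gcd e : ℝ) * μ (q / e)) := by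
      intro e he
      rw [Finset.mul_sum, Finset.mul_sum]
      refine Finset.sum_congr rfl fun d hd => ?_
      have he' : (e : ℝ) ≠ 0 := by have := Nat.pos_of_mem_divisors he; positivity
      have hd' : (d : ℝ) ≠ 0 := by have := (Finset.mem_Ioc.1 hd).1; positivity
      have h3 : (d.gcd e : ℝ) * (d.lcm e : ℕ) = d * e := by exact_mod_cast Nat.gcd_mul_lcm d e
      have h4 : ((d.lcm e : ℕ) : ℝ) ≠ 0 := by
        intro h; rw [h, mul_zero] at h3; exact mul_ne_zero hd' he' h3.symm
      field_simp
      linear_combination (-((N : ℝ) * (μ (q / e) : ℝ) * sieveWeight R d)) * h3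
    rw [Finset.sum_congr rfl h2, Finset.sum_comm, sieveCoeff, Finset.sum_filter, Finset.mul_sum,
      Finset.mul_sum]
    refine Finset.sum_congr rfl fun d _ => ?_
    rw [← Finset.mul_sum, sum_divisors_gcd_mul_moebius hq]
    split_ifs <;> ring
  rw [h1, ← Finset.sum_sub_distrib]
  have h5 : ∀ e ∈ q.divisors, (e : ℝ) * μ (q / e) * ∑ n ∈ Finset.Ioc 0 N with e ∣ n, sieveModel R n -
      (μ (q / e) : ℝ) * (e * ∑ d ∈ Finset.Ioc 0 R, sieveWeight R d * ((N : ℝ) / (d.lcm e : ℕ))) =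
      μ (q / e) * (e * ∑ d ∈ Finset.Ioc 0 R,
        sieveWeight R d * ((N / d.lcm e : ℕ) - (N : ℝ) / (d.lcm e : ℕ))) := by
    intro e _
    rw [sum_sieveModel_of_dvd]
    simp only [mul_sub, Finset.sum_sub_distrib]
    ring
  rw [Finset.sum_congr rfl h5]
  refine abs_sum_divisors_le (by positivity) fun e he => ?_
  rw [abs_mul, Nat.abs_cast]
  gcongr
  refine (Finset.abs_sum_le_sum_abs _ _).trans ?_
  calc _ ≤ ∑ d ∈ Finset.Ioc 0 R, Real.log R * 1 := by
        refine Finset.sum_le_sum fun d hd => ?_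
        rw [abs_mul]
        gcongr
        · exact abs_sieveWeight_le (Finset.mem_Ioc.1 hd).1
        · have h6 : ((N / d.lcm e : ℕ) : ℝ) ≤ N / (d.lcm e : ℕ) := Nat.cast_div_le
          have hpos : 0 < d.lcm e :=
            Nat.lcm_pos (Finset.mem_Ioc.1 hd).1 (Nat.pos_of_mem_divisors he)
          have h7 : (N : ℝ) / (d.lcm e : ℕ) ≤ (N / d.lcm e : ℕ) + 1 := by
            rw [div_le_iff₀ (by exact_mod_cast hpos)]
            have := Nat.lt_div_mul_add (a := N) hpos
            have h8 : (N : ℝ) ≤ (N / d.lcm e : ℕ) * (d.lcm e : ℕ) + (d.lcm e : ℕ) := by exact_mod_cast this.le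
            linarith
          rw [abs_le]
          constructor <;> linarith
    _ = _ := by simp

lemma abs_mul_sieveCoeff_sub_le {q R N : ℕ} (hq : 0 < q) {B : ℝ}
    (hB : ∀ α : ℝ, ‖∑ n ∈ Finset.range (N + 1), ((primeLog n - sieveModel R n : ℝ) : ℂ) *
      expi (n * α)‖ ≤ B) :
    |N * (q.totient * sieveCoeff R q) - μ q * Chebyshev.theta N| ≤
      q ^ 2 * (B + R * Real.log R + Real.log N) := by
  have hB' : ∀ α : ℝ, ‖∑ n ∈ Finset.Ioc 0 N, ((primeLog n - sieveModel R n : ℝ) : ℂ) *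
      expi (n * α)‖ ≤ B := by
    intro α
    have h := hB α
    rw [Finset.range_eq_Ico, Finset.sum_eq_sum_Ico_succ_bot (Nat.succ_pos N)] at h
    have h' : Finset.Ico (0 + 1) (N + 1) = Finset.Ioc 0 N := by
      ext; simp only [Finset.mem_Ico, Finset.mem_Ioc]; omega
    rw [h'] at h
    simpa [primeLog, sieveModel] using h
  have h1 := abs_sum_mul_ramanujan_le hB' q
  have h2 := abs_sum_primeLog_mul_ramanujan_sub_le (N := N) hq
  have h3 := abs_sum_sieveModel_mul_ramanujan_sub_le hq R N
  simp only [sub_mul, Finset.sum_sub_distrib] at h1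
  rw [abs_le] at *
  constructor <;> linarith [h1.1, h1.2, h2.1, h2.2, h3.1, h3.2]

lemma sum_Ioc_dvd_one_div_le {q : ℕ} (hq : 0 < q) (R : ℕ) :
    ∑ d ∈ Finset.Ioc 0 R with q ∣ d, (1 : ℝ) / d ≤ 1 / q * (1 + Real.log R) := by
  have hq' : (0 : ℝ) < q := by exact_mod_cast hq
  calc _ ≤ ∑ d ∈ (Finset.Ioc 0 R).image (q * ·), (1 : ℝ) / d := by
        refine Finset.sum_le_sum_of_subset_of_nonneg (fun d hd => ?_) fun d _ _ => by positivity
        obtain ⟨h1, k, rfl⟩ := Finset.mem_filter.1 hd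
        have h1 := Finset.mem_Ioc.1 h1
        refine Finset.mem_image.2 ⟨k, Finset.mem_Ioc.2 ⟨Nat.pos_of_mul_pos_left h1.1, ?_⟩, rfl⟩
        exact (Nat.le_mul_of_pos_left k hq).trans h1.2
    _ = ∑ k ∈ Finset.Ioc 0 R, 1 / q * ((1 : ℝ) / k) := by
        rw [Finset.sum_image fun a _ b _ h => Nat.eq_of_mul_eq_mul_left hq h]
        refine Finset.sum_congr rfl fun k _ => ?_
        push_cast
        field_simp
    _ ≤ _ := by
        rw [← Finset.mul_sum]
        gcongr
        exact sum_Ioc_one_div_le R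

lemma abs_sieveCoeff_le {q : ℕ} (hq : 0 < q) (R : ℕ) :
    |sieveCoeff R q| ≤ Real.log R * (1 + Real.log R) / q := by
  have hR : 0 ≤ Real.log R := Real.log_natCast_nonneg R
  rw [sieveCoeff]
  refine (Finset.abs_sum_le_sum_abs _ _).trans ?_
  calc _ ≤ ∑ d ∈ Finset.Ioc 0 R with q ∣ d, Real.log R * ((1 : ℝ) / d) := by
        refine Finset.sum_le_sum fun d hd => ?_
        rw [abs_div, Nat.abs_cast, mul_one_div]
        gcongr
        exact abs_sieveWeight_le (Finset.mem_Ioc.1 (Finset.mem_filter.1 hd).1).1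
    _ ≤ Real.log R * (1 / q * (1 + Real.log R)) := by
        rw [← Finset.mul_sum]
        gcongr
        exact sum_Ioc_dvd_one_div_le hq R
    _ = _ := by ring

end SieveCorrelation

section Correlation

open scoped ArithmeticFunction.Moebius

lemma abs_card_modEq_sub_le {n r : ℕ} (hn : 0 < n) (hr : 0 < r) (v : ℕ) :
    |(((Finset.Ioc 0 (n - 1)).filter (· ≡ v [MOD r])).card : ℝ) - n / r| ≤ 2 := by
  have h := Nat.Ioc_filter_modEq_card 0 (n - 1) hr v
  obtain ⟨c, hc⟩ : ∃ c, c = ((Finset.Ioc 0 (n - 1)).filter (· ≡ v [MOD r])).card := ⟨_, rfl⟩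
  rw [← hc] at h ⊢
  have hr' : (0 : ℚ) < r := by exact_mod_cast hr
  have hr1 : (1 : ℚ) ≤ r := by exact_mod_cast hr
  have hn1 : ((n - 1 : ℕ) : ℚ) = n - 1 := by push_cast [Nat.one_le_iff_ne_zero.2 hn.ne']; ring
  have hn2 : (1 : ℚ) ≤ n := by exact_mod_cast hn
  have h1 := Int.floor_le ((((n - 1 : ℕ) : ℚ) - v) / r)
  have h2 := Int.lt_floor_add_one ((((n - 1 : ℕ) : ℚ) - v) / r)
  have h3 := Int.floor_le ((((0 : ℕ) : ℚ) - v) / r)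
  have h4 := Int.lt_floor_add_one ((((0 : ℕ) : ℚ) - v) / r)
  have h5 : ⌊(((0 : ℕ) : ℚ) - v) / r⌋ ≤ ⌊(((n - 1 : ℕ) : ℚ) - v) / r⌋ := by
    apply Int.floor_le_floor
    gcongr
    simp
  rw [max_eq_left (by linarith)] at h
  have h6 : (c : ℚ) = (⌊(((n - 1 : ℕ) : ℚ) - v) / r⌋ : ℚ) - (⌊(((0 : ℕ) : ℚ) - v) / r⌋ : ℚ) := by
    exact_mod_cast h
  have h7 : (((n - 1 : ℕ) : ℚ) - v) / r - (((0 : ℕ) : ℚ) - v) / r = n / r - 1 / r := by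
    rw [hn1]; push_cast; field_simp; ring
  have h8 : (1 : ℚ) / r ≤ 1 := by rw [div_le_one hr']; exact hr1
  have h9 : (0 : ℚ) < 1 / r := by positivity
  have h10 : |(c : ℚ) - n / r| ≤ 2 := by
    rw [abs_le]
    constructor <;> linarith
  have h11 : ((|(c : ℚ) - n / r| : ℚ) : ℝ) ≤ 2 := by exact_mod_cast h10
  push_cast at h11
  exact h11

lemma abs_card_dvd_dvd_sub_le {n d e : ℕ} (hn : 0 < n) (hd : 0 < d) (he : 0 < e) :
    |(((Finset.Ioc 0 (n - 1)).filter (fun a => d ∣ a ∧ e ∣ n - a)).card : ℝ) -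
      n * ((if d.gcd e ∣ n then (d.gcd e : ℝ) else 0) / (d * e))| ≤ 2 := by
  split_ifs with h
  · have h1 : 0 ≡ n [MOD d.gcd e] := ((Nat.modEq_zero_iff_dvd).2 h).symm
    obtain ⟨v, hv1, hv2⟩ := Nat.chineseRemainder' h1
    have h2 : (Finset.Ioc 0 (n - 1)).filter (fun a => d ∣ a ∧ e ∣ n - a) =
        (Finset.Ioc 0 (n - 1)).filter (· ≡ v [MOD d.lcm e]) := by
      refine Finset.filter_congr fun a ha => ?_
      have ha := Finset.mem_Ioc.1 ha
      rw [← Nat.modEq_zero_iff_dvd, ← Nat.modEq_iff_dvd' (show a ≤ n by omega)]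
      constructor
      · rintro ⟨h3, h4⟩
        exact Nat.mod_lcm (h3.trans hv1.symm) (h4.trans hv2.symm)
      · intro h3
        exact ⟨(h3.of_dvd (Nat.dvd_lcm_left d e)).trans hv1,
          (h3.of_dvd (Nat.dvd_lcm_right d e)).trans hv2⟩
    rw [h2]
    have h3 := abs_card_modEq_sub_le hn (Nat.lcm_pos hd he) v
    have h4 : (d.gcd e : ℝ) * (d.lcm e : ℕ) = d * e := by exact_mod_cast Nat.gcd_mul_lcm d e
    have h5 : ((d.lcm e : ℕ) : ℝ) ≠ 0 := by
      have := Nat.lcm_pos hd he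
      positivity
    have h6 : (n : ℝ) / (d.lcm e : ℕ) = n * ((d.gcd e : ℝ) / (d * e)) := by
      have : (d : ℝ) * e ≠ 0 := by positivity
      rw [div_eq_iff h5, mul_assoc, div_mul_eq_mul_div, h4, div_self this, mul_one]
    rwa [h6] at h3
  · rw [Finset.filter_false_of_mem]
    · simp
    · rintro a ha ⟨h1, h2⟩
      have ha := Finset.mem_Ioc.1 ha
      refine h ?_
      have h3 := Nat.dvd_add ((Nat.gcd_dvd_left d e).trans h1) ((Nat.gcd_dvd_right d e).trans h2)
      rwa [Nat.add_sub_cancel' (by omega)] at h3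

lemma sum_antidiagonal_sieveModel {n : ℕ} (hn : 0 < n) (R : ℕ) :
    ∑ x ∈ Finset.HasAntidiagonal.antidiagonal n, sieveModel R x.1 * sieveModel R x.2 =
      ∑ d ∈ Finset.Ioc 0 R, ∑ e ∈ Finset.Ioc 0 R, sieveWeight R d * sieveWeight R e *
        ((Finset.Ioc 0 (n - 1)).filter (fun a => d ∣ a ∧ e ∣ n - a)).card := by
  have h0 : sieveModel R 0 = 0 := by simp [sieveModel]
  have h1 : ∑ x ∈ Finset.HasAntidiagonal.antidiagonal n, sieveModel R x.1 * sieveModel R x.2 =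
      ∑ a ∈ Finset.Ioc 0 (n - 1), sieveModel R a * sieveModel R (n - a) := by
    rw [Finset.Nat.sum_antidiagonal_eq_sum_range_succ (fun a b => sieveModel R a * sieveModel R b)]
    refine (Finset.sum_subset (fun a ha => ?_) fun a ha ha' => ?_).symm
    · have := Finset.mem_Ioc.1 ha
      exact Finset.mem_range.2 (by omega)
    · have h1 := Finset.mem_range.1 ha
      rw [Finset.mem_Ioc] at ha'
      have : a = 0 ∨ a = n := by omega
      rcases this with rfl | rfl
      · rw [h0, zero_mul]
      · rw [Nat.sub_self, h0, mul_zero]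
  have h2 : ∀ a ∈ Finset.Ioc 0 (n - 1), sieveModel R a * sieveModel R (n - a) =
      ∑ d ∈ Finset.Ioc 0 R, ∑ e ∈ Finset.Ioc 0 R,
        if d ∣ a ∧ e ∣ n - a then sieveWeight R d * sieveWeight R e else 0 := by
    intro a ha
    have ha := Finset.mem_Ioc.1 ha
    rw [sieveModel_eq_sum ha.1, sieveModel_eq_sum (show 0 < n - a by omega), Finset.sum_mul_sum]
    refine Finset.sum_congr rfl fun d _ => Finset.sum_congr rfl fun e _ => ?_
    by_cases hd : d ∣ a <;> by_cases he : e ∣ n - a <;> simp [hd, he]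
  rw [h1, Finset.sum_congr rfl h2, Finset.sum_comm]
  refine Finset.sum_congr rfl fun d _ => ?_
  rw [Finset.sum_comm]
  refine Finset.sum_congr rfl fun e _ => ?_
  rw [← Finset.sum_filter, Finset.sum_const, nsmul_eq_mul, mul_comm]

lemma sum_sieveCoeff_sq_mul_ramanujan (R n : ℕ) :
    ∑ q ∈ Finset.Ioc 0 R, sieveCoeff R q ^ 2 * ramanujan q n =
      ∑ d ∈ Finset.Ioc 0 R, ∑ e ∈ Finset.Ioc 0 R, sieveWeight R d * sieveWeight R e *
        ((if d.gcd e ∣ n then (d.gcd e : ℝ) else 0) / (d * e)) := by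
  have h1 : ∀ q ∈ Finset.Ioc 0 R, sieveCoeff R q ^ 2 * ramanujan q n =
      ∑ d ∈ Finset.Ioc 0 R, ∑ e ∈ Finset.Ioc 0 R,
        if q ∣ d.gcd e then sieveWeight R d * sieveWeight R e / (d * e) * ramanujan q n else 0 := by
    intro q _
    rw [sieveCoeff, Finset.sum_filter, sq, Finset.sum_mul_sum, Finset.sum_mul]
    refine Finset.sum_congr rfl fun d _ => ?_
    rw [Finset.sum_mul]
    refine Finset.sum_congr rfl fun e _ => ?_
    simp only [Nat.dvd_gcd_iff]
    by_cases hd : q ∣ d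
    · by_cases he : q ∣ e
      · simp only [hd, he, if_true, and_self]
        ring
      · simp [hd, he]
    · simp [hd]
  rw [Finset.sum_congr rfl h1, Finset.sum_comm]
  refine Finset.sum_congr rfl fun d hd => ?_
  rw [Finset.sum_comm]
  refine Finset.sum_congr rfl fun e _ => ?_
  have hd := Finset.mem_Ioc.1 hd
  have hg : 0 < d.gcd e := Nat.gcd_pos_of_pos_left e hd.1
  have hg' : d.gcd e ≤ R := (Nat.gcd_le_left e hd.1).trans hd.2
  rw [← Finset.sum_filter, ← Finset.mul_sum, ← sum_divisors_ramanujan hg n]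
  have : (Finset.Ioc 0 R).filter (· ∣ d.gcd e) = (d.gcd e).divisors := by
    ext q
    simp only [Finset.mem_filter, Finset.mem_Ioc, Nat.mem_divisors]
    constructor
    · rintro ⟨-, h⟩
      exact ⟨h, hg.ne'⟩
    · rintro ⟨h, -⟩
      exact ⟨⟨Nat.pos_of_dvd_of_pos h hg, (Nat.le_of_dvd hg h).trans hg'⟩, h⟩
  rw [this]
  ring

theorem abs_sum_antidiagonal_sieveModel_sub_le {n : ℕ} (hn : 0 < n) (R : ℕ) :
    |∑ x ∈ Finset.HasAntidiagonal.antidiagonal n, sieveModel R x.1 * sieveModel R x.2 -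
      n * ∑ q ∈ Finset.Ioc 0 R, sieveCoeff R q ^ 2 * ramanujan q n| ≤
      2 * (R * Real.log R) ^ 2 := by
  have hR : 0 ≤ Real.log R := Real.log_natCast_nonneg R
  rw [sum_antidiagonal_sieveModel hn, sum_sieveCoeff_sq_mul_ramanujan, Finset.mul_sum,
    ← Finset.sum_sub_distrib]
  simp only [Finset.mul_sum, ← Finset.sum_sub_distrib]
  refine (Finset.abs_sum_le_sum_abs _ _).trans ?_
  calc _ ≤ ∑ d ∈ Finset.Ioc 0 R, ∑ e ∈ Finset.Ioc 0 R, Real.log R * Real.log R * 2 := by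
        refine Finset.sum_le_sum fun d hd => ?_
        refine (Finset.abs_sum_le_sum_abs _ _).trans (Finset.sum_le_sum fun e he => ?_)
        have hd := (Finset.mem_Ioc.1 hd).1
        have he := (Finset.mem_Ioc.1 he).1
        rw [mul_left_comm (n : ℝ), ← mul_sub, abs_mul, abs_mul]
        gcongr
        · exact abs_sieveWeight_le hd
        · exact abs_sieveWeight_le he
        · exact abs_card_dvd_dvd_sub_le hn hd he
    _ = _ := by
        simp only [Finset.sum_const, Nat.card_Ioc, nsmul_eq_mul, Nat.sub_zero]
        ring

end Correlation

section SingularSeries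

open scoped ArithmeticFunction.Moebius ArithmeticFunction.sigma

lemma sum_card_divisors_div_le (R : ℕ) :
    ∑ q ∈ Finset.Ioc 0 R, (q.divisors.card : ℝ) / q ≤ (1 + Real.log R) ^ 2 := by
  have hR : 0 ≤ Real.log R := Real.log_natCast_nonneg R
  have h1 : ∀ q ∈ Finset.Ioc 0 R, (q.divisors.card : ℝ) / q =
      ∑ d ∈ Finset.Ioc 0 R, if d ∣ q then (1 : ℝ) / q else 0 := by
    intro q hq
    have hq := Finset.mem_Ioc.1 hq
    rw [← Finset.sum_filter, Finset.sum_const, nsmul_eq_mul, mul_one_div]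
    congr 3
    ext d
    simp only [Finset.mem_filter, Finset.mem_Ioc, Nat.mem_divisors]
    constructor
    · rintro ⟨h, -⟩
      exact ⟨⟨Nat.pos_of_dvd_of_pos h hq.1, (Nat.le_of_dvd hq.1 h).trans hq.2⟩, h⟩
    · rintro ⟨-, h⟩
      exact ⟨h, hq.1.ne'⟩
  rw [Finset.sum_congr rfl h1, Finset.sum_comm]
  calc _ ≤ ∑ d ∈ Finset.Ioc 0 R, (1 : ℝ) / d * (1 + Real.log R) := by
        refine Finset.sum_le_sum fun d hd => ?_
        rw [← Finset.sum_filter]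
        exact sum_Ioc_dvd_one_div_le (Finset.mem_Ioc.1 hd).1 R
    _ ≤ (1 + Real.log R) * (1 + Real.log R) := by
        rw [← Finset.sum_mul]
        gcongr
        exact sum_Ioc_one_div_le R
    _ = _ := by ring

lemma sum_abs_ramanujan_le (q N : ℕ) :
    ∑ n ∈ Finset.Ioc 0 N, |ramanujan q n| ≤ N * q.divisors.card := by
  calc _ ≤ ∑ n ∈ Finset.Ioc 0 N, ∑ d ∈ q.divisors, (if d ∣ n then (d : ℝ) else 0) := by
        refine Finset.sum_le_sum fun n _ => ?_
        rw [ramanujan]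
        refine (Finset.abs_sum_le_sum_abs _ _).trans (Finset.sum_le_sum fun d _ => ?_)
        have h0 : (0 : ℝ) ≤ if d ∣ n then (d : ℝ) else 0 := by split_ifs <;> simp
        rw [abs_mul, abs_of_nonneg h0]
        exact mul_le_of_le_one_right h0 (abs_moebius_le _)
    _ = ∑ d ∈ q.divisors, ((N / d : ℕ) : ℝ) * d := by
        rw [Finset.sum_comm]
        refine Finset.sum_congr rfl fun d _ => ?_
        rw [← Finset.sum_filter, Finset.sum_const, nsmul_eq_mul, Nat.Ioc_filter_dvd_card_eq_div]
    _ ≤ ∑ d ∈ q.divisors, (N : ℝ) :=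
        Finset.sum_le_sum fun d _ => by exact_mod_cast Nat.div_mul_le_self N d
    _ = _ := by rw [Finset.sum_const, nsmul_eq_mul, mul_comm]

lemma sum_abs_tail_sieveCoeff_le {Q : ℕ} (hQ : 0 < Q) (R N : ℕ) :
    ∑ n ∈ Finset.Ioc 0 N, |∑ q ∈ Finset.Ioc Q R, sieveCoeff R q ^ 2 * ramanujan q n| ≤
      N * ((Real.log R * (1 + Real.log R)) ^ 2 * (1 + Real.log R) ^ 2 / Q) := by
  have hR : 0 ≤ Real.log R := Real.log_natCast_nonneg R
  have hQ' : (0 : ℝ) < Q := by exact_mod_cast hQ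
  obtain ⟨K, hK⟩ : ∃ K, K = Real.log R * (1 + Real.log R) := ⟨_, rfl⟩
  have hK0 : 0 ≤ K := by rw [hK]; positivity
  rw [← hK]
  calc _ ≤ ∑ n ∈ Finset.Ioc 0 N, ∑ q ∈ Finset.Ioc Q R, (K / q) ^ 2 * |ramanujan q n| := by
        refine Finset.sum_le_sum fun n _ => ?_
        refine (Finset.abs_sum_le_sum_abs _ _).trans (Finset.sum_le_sum fun q hq => ?_)
        rw [abs_mul, abs_pow]
        gcongr
        rw [hK]
        exact abs_sieveCoeff_le (by have := Finset.mem_Ioc.1 hq; omega) R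
    _ = ∑ q ∈ Finset.Ioc Q R, (K / q) ^ 2 * ∑ n ∈ Finset.Ioc 0 N, |ramanujan q n| := by
        rw [Finset.sum_comm]
        simp only [Finset.mul_sum]
    _ ≤ ∑ q ∈ Finset.Ioc Q R, N * K ^ 2 / Q * ((q.divisors.card : ℝ) / q) := by
        refine Finset.sum_le_sum fun q hq => ?_
        have hq := (Finset.mem_Ioc.1 hq).1
        have hqQ : (Q : ℝ) ≤ q := by exact_mod_cast hq.le
        calc _ ≤ (K / q) ^ 2 * (N * q.divisors.card) := by
              gcongr
              exact sum_abs_ramanujan_le q N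
          _ = N * K ^ 2 / q * ((q.divisors.card : ℝ) / q) := by field_simp
          _ ≤ _ := by gcongr
    _ ≤ ∑ q ∈ Finset.Ioc 0 R, N * K ^ 2 / Q * ((q.divisors.card : ℝ) / q) := by
        refine Finset.sum_le_sum_of_subset_of_nonneg (fun q hq => ?_) fun q _ _ => by positivity
        have := Finset.mem_Ioc.1 hq
        exact Finset.mem_Ioc.2 ⟨by omega, this.2⟩
    _ ≤ N * K ^ 2 / Q * (1 + Real.log R) ^ 2 := by
        rw [← Finset.mul_sum]
        gcongr
        exact sum_card_divisors_div_le R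
    _ = _ := by ring

/-- The function `q ↦ c_q(n) / φ(q) ^ 2`. -/
noncomputable def singularTerm (n : ℕ) : ArithmeticFunction ℝ :=
  ⟨fun q => ramanujan q n / (q.totient : ℝ) ^ 2, by simp [ramanujan]⟩

lemma singularTerm_apply (n q : ℕ) :
    singularTerm n q = ramanujan q n / (q.totient : ℝ) ^ 2 := rfl

lemma ramanujan_mul {m k : ℕ} (n : ℕ) (h : m.Coprime k) :
    ramanujan (m * k) n = ramanujan m n * ramanujan k n := by
  let f : ArithmeticFunction ℝ := ⟨fun d => if d ∣ n ∧ d ≠ 0 then (d : ℝ) else 0, by simp⟩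
  have hf : ∀ d, f d = if d ∣ n ∧ d ≠ 0 then (d : ℝ) else 0 := fun d => rfl
  have hfm : f.IsMultiplicative := by
    refine ArithmeticFunction.IsMultiplicative.iff_ne_zero.2 ⟨by simp [hf], fun {a b} ha hb hab => ?_⟩
    rw [hf, hf, hf]
    have h1 : a * b ∣ n ↔ a ∣ n ∧ b ∣ n :=
      ⟨fun h => ⟨(Nat.dvd_mul_right a b).trans h, (Nat.dvd_mul_left b a).trans h⟩,
        fun h => hab.mul_dvd_of_dvd_of_dvd h.1 h.2⟩
    by_cases h2 : a ∣ n <;> by_cases h3 : b ∣ n <;> simp [h1, h2, h3, ha, hb]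
  have hr : ∀ q, ramanujan q n = (f * (μ : ArithmeticFunction ℝ)) q := by
    intro q
    rw [ArithmeticFunction.mul_apply,
      Nat.sum_divisorsAntidiagonal (f := fun i j => f i * (μ : ArithmeticFunction ℝ) j), ramanujan]
    refine Finset.sum_congr rfl fun d hd => ?_
    have := (Nat.pos_of_mem_divisors hd).ne'
    rw [hf, ArithmeticFunction.intCoe_apply]
    simp [this]
  rw [hr, hr, hr]
  exact (hfm.mul ArithmeticFunction.isMultiplicative_moebius.intCast).map_mul_of_coprime h

lemma singularTerm_isMultiplicative (n : ℕ) : (singularTerm n).IsMultiplicative := by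
  refine ⟨by simp [singularTerm_apply, ramanujan], fun {a b} hab => ?_⟩
  rw [singularTerm_apply, singularTerm_apply, singularTerm_apply, ramanujan_mul n hab,
    Nat.totient_mul hab]
  push_cast
  ring

lemma ramanujan_prime {p : ℕ} (hp : p.Prime) (n : ℕ) :
    ramanujan p n = (if p ∣ n then (p : ℝ) else 0) - 1 := by
  rw [ramanujan, hp.divisors, Finset.sum_pair hp.one_lt.ne, Nat.div_self hp.pos, Nat.div_one,
    ArithmeticFunction.moebius_apply_prime hp]
  simp
  ring

lemma le_prod_of_le {c : ℕ → ℝ} (hc : ∀ m : ℕ, 3 ≤ m → 1 - 1 / ((m : ℝ) - 1) ^ 2 ≤ c m) {M : ℕ}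
    (hM : 2 ≤ M) : (M : ℝ) / (2 * (M - 1)) ≤ ∏ m ∈ Finset.Ioc 2 M, c m := by
  induction M, hM using Nat.le_induction with
  | base => norm_num
  | succ M hM ih =>
    have hM' : (2 : ℝ) ≤ M := by exact_mod_cast hM
    rw [Finset.prod_Ioc_succ_top hM]
    have h1 := hc (M + 1) (by omega)
    push_cast at h1 ⊢
    have h2 : 0 ≤ 1 - 1 / ((M : ℝ) + 1 - 1) ^ 2 := by
      rw [sub_nonneg, div_le_one (by nlinarith)]
      nlinarith
    have hM1 : (M : ℝ) - 1 ≠ 0 := by linarith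
    have hM0 : 0 ≤ (M : ℝ) - 1 := by linarith
    calc ((M : ℝ) + 1) / (2 * (M + 1 - 1)) =
          (M : ℝ) / (2 * (M - 1)) * (1 - 1 / ((M : ℝ) + 1 - 1) ^ 2) := by
            rw [add_sub_cancel_right]
            field_simp
            ring
      _ ≤ _ := by
        refine mul_le_mul ih h1 h2 (le_trans ?_ ih)
        positivity

lemma one_le_sum_singularTerm {n Q : ℕ} (hn : Even n) (hQ : 2 ≤ Q) :
    1 ≤ ∑ q ∈ (primorial Q).divisors, singularTerm n q := by
  rw [← (singularTerm_isMultiplicative n).prodPrimeFactors_one_add_of_squarefree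
    (squarefree_primorial Q), primeFactors_primorial]
  have h1 : ∏ p ∈ Nat.primesLE Q, (1 + singularTerm n p) =
      2 * ∏ p ∈ Finset.Ioc 2 Q, if p.Prime then 1 + singularTerm n p else 1 := by
    have h2 : Nat.primesLE Q = insert 2 ((Finset.Ioc 2 Q).filter Nat.Prime) := by
      ext p
      rw [Nat.mem_primesLE, Finset.mem_insert, Finset.mem_filter, Finset.mem_Ioc]
      constructor
      · rintro ⟨h, hp⟩
        have := hp.two_le
        rcases eq_or_ne p 2 with h' | h'
        · exact Or.inl h'
        · exact Or.inr ⟨⟨by omega, h⟩, hp⟩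
      · rintro (rfl | ⟨⟨-, h⟩, hp⟩)
        · exact ⟨hQ, Nat.prime_two⟩
        · exact ⟨h, hp⟩
    rw [h2, Finset.prod_insert (by simp), Finset.prod_filter, singularTerm_apply,
      ramanujan_prime Nat.prime_two, if_pos hn.two_dvd]
    norm_num
  rw [h1]
  have h3 := le_prod_of_le (c := fun p => if p.Prime then 1 + singularTerm n p else 1) ?_ hQ
  · have hQ' : (2 : ℝ) ≤ Q := by exact_mod_cast hQ
    have h4 : (1 : ℝ) / 2 ≤ Q / (2 * (Q - 1)) := by
      rw [div_le_div_iff₀] <;> linarith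
    linarith
  · intro m hm
    split_ifs with hp
    · rw [singularTerm_apply, ramanujan_prime hp, Nat.totient_prime hp, Nat.cast_sub hp.one_le,
        Nat.cast_one]
      have h5 : (-1 : ℝ) ≤ (if m ∣ n then (m : ℝ) else 0) - 1 := by
        split_ifs <;> simp
      have h6 : (-1 : ℝ) / ((m : ℝ) - 1) ^ 2 ≤
          ((if m ∣ n then (m : ℝ) else 0) - 1) / ((m : ℝ) - 1) ^ 2 := by gcongr
      have h7 : (-1 : ℝ) / ((m : ℝ) - 1) ^ 2 = -(1 / ((m : ℝ) - 1) ^ 2) := by ring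
      linarith
    · have : (0 : ℝ) ≤ 1 / ((m : ℝ) - 1) ^ 2 := by positivity
      linarith

/-- The function `q ↦ √q τ(q) / φ(q) ^ 2`. -/
noncomputable def rankinTerm : ArithmeticFunction ℝ :=
  ⟨fun q => √q * q.divisors.card / (q.totient : ℝ) ^ 2, by simp⟩

lemma rankinTerm_apply (q : ℕ) :
    rankinTerm q = √q * q.divisors.card / (q.totient : ℝ) ^ 2 := rfl

lemma rankinTerm_isMultiplicative : rankinTerm.IsMultiplicative := by
  refine ⟨by simp [rankinTerm_apply], fun {a b} hab => ?_⟩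
  rw [rankinTerm_apply, rankinTerm_apply, rankinTerm_apply, hab.card_divisors_mul,
    Nat.totient_mul hab]
  push_cast
  rw [Real.sqrt_mul (Nat.cast_nonneg a)]
  ring

lemma exists_sum_rankinTerm_le : ∃ C : ℝ, 0 < C ∧ ∀ Q : ℕ,
    ∑ q ∈ (primorial Q).divisors, rankinTerm q ≤ C := by
  have hs : Summable fun n : ℕ => 8 * (1 / (n : ℝ) ^ (3 / 2 : ℝ)) :=
    (Real.summable_one_div_nat_rpow.2 (by norm_num)).mul_left 8
  refine ⟨Real.exp (∑' n : ℕ, 8 * (1 / (n : ℝ) ^ (3 / 2 : ℝ))), Real.exp_pos _, fun Q => ?_⟩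
  rw [← rankinTerm_isMultiplicative.prodPrimeFactors_one_add_of_squarefree
    (squarefree_primorial Q), primeFactors_primorial]
  calc _ ≤ ∏ p ∈ Nat.primesLE Q, Real.exp (8 * (1 / (p : ℝ) ^ (3 / 2 : ℝ))) := by
        refine Finset.prod_le_prod (fun p _ => ?_) fun p hp => ?_
        · rw [rankinTerm_apply]; positivity
        · have hp := (Nat.mem_primesLE.1 hp).2
          have hp2 : (2 : ℝ) ≤ p := by exact_mod_cast hp.two_le
          have h1 : (p : ℝ) ^ (3 / 2 : ℝ) = p * √p := by
            rw [Real.sqrt_eq_rpow, show (3 / 2 : ℝ) = 1 + 1 / 2 by norm_num,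
              Real.rpow_add (by linarith), Real.rpow_one]
          have h2 : rankinTerm p ≤ 8 * (1 / (p : ℝ) ^ (3 / 2 : ℝ)) := by
            rw [rankinTerm_apply, hp.divisors, Finset.card_pair hp.one_lt.ne, Nat.totient_prime hp,
              Nat.cast_sub hp.one_le, h1, mul_one_div]
            have h3 : 0 < √(p : ℝ) := Real.sqrt_pos.2 (by linarith)
            have h4 : √(p : ℝ) * √p = p := Real.mul_self_sqrt (by linarith)
            have h5 : (0 : ℝ) < (p : ℝ) - 1 := by linarith
            rw [Nat.cast_one, div_le_div_iff₀ (by positivity) (by positivity)]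
            calc √(p : ℝ) * (2 : ℕ) * (p * √p) = 2 * p * (√p * √p) := by push_cast; ring
              _ = 2 * p ^ 2 := by rw [h4]; ring
              _ ≤ 8 * ((p : ℝ) - 1) ^ 2 := by nlinarith
          have := Real.add_one_le_exp (8 * (1 / (p : ℝ) ^ (3 / 2 : ℝ)))
          linarith
    _ = Real.exp (∑ p ∈ Nat.primesLE Q, 8 * (1 / (p : ℝ) ^ (3 / 2 : ℝ))) := (Real.exp_sum _ _).symm
    _ ≤ _ := by
        gcongr
        exact hs.sum_le_tsum _ fun n _ => by positivity

lemma sum_abs_tail_singularTerm_le {C : ℝ} {Q : ℕ} (hQ : 0 < Q)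
    (hC : ∑ q ∈ (primorial Q).divisors, rankinTerm q ≤ C) (N : ℕ) :
    ∑ n ∈ Finset.Ioc 0 N, |∑ q ∈ (primorial Q).divisors with Q < q, singularTerm n q| ≤
      N * (C / √Q) := by
  have hQ' : 0 < √(Q : ℝ) := Real.sqrt_pos.2 (by exact_mod_cast hQ)
  calc _ ≤ ∑ n ∈ Finset.Ioc 0 N, ∑ q ∈ (primorial Q).divisors with Q < q,
          1 / (q.totient : ℝ) ^ 2 * |ramanujan q n| := by
        refine Finset.sum_le_sum fun n _ => ?_
        refine (Finset.abs_sum_le_sum_abs _ _).trans (Finset.sum_le_sum fun q _ => ?_)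
        rw [singularTerm_apply, abs_div, abs_pow, Nat.abs_cast]
        exact le_of_eq (by ring)
    _ = ∑ q ∈ (primorial Q).divisors with Q < q,
          1 / (q.totient : ℝ) ^ 2 * ∑ n ∈ Finset.Ioc 0 N, |ramanujan q n| := by
        rw [Finset.sum_comm]
        simp only [Finset.mul_sum]
    _ ≤ ∑ q ∈ (primorial Q).divisors with Q < q, N / √Q * rankinTerm q := by
        refine Finset.sum_le_sum fun q hq => ?_
        have hq := (Finset.mem_filter.1 hq).2
        have h1 : 1 ≤ √(q : ℝ) / √Q := by
          rw [one_le_div hQ']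
          exact Real.sqrt_le_sqrt (by exact_mod_cast hq.le)
        calc _ ≤ 1 / (q.totient : ℝ) ^ 2 * (N * q.divisors.card) := by
              gcongr
              exact sum_abs_ramanujan_le q N
          _ ≤ 1 / (q.totient : ℝ) ^ 2 * (N * q.divisors.card) * (√q / √Q) :=
              le_mul_of_one_le_right (by positivity) h1
          _ = _ := by rw [rankinTerm_apply]; ring
    _ ≤ ∑ q ∈ (primorial Q).divisors, N / √Q * rankinTerm q := by
        refine Finset.sum_le_sum_of_subset_of_nonneg (Finset.filter_subset _ _) fun q _ _ => ?_
        rw [rankinTerm_apply]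
        positivity
    _ ≤ N / √Q * C := by
        rw [← Finset.mul_sum]
        gcongr
    _ = _ := by ring

end SingularSeries

section LowerBound

open scoped ArithmeticFunction.Moebius

lemma theta_le_two_mul (N : ℕ) : Chebyshev.theta N ≤ 2 * N := by
  have h := Chebyshev.theta_le_log4_mul_x (x := N) (Nat.cast_nonneg N)
  have h2 : Real.log 4 ≤ 2 := by
    rw [show (4 : ℝ) = 2 ^ 2 by norm_num, Real.log_pow]
    have := Real.log_two_lt_d9
    push_cast
    linarith
  have h3 : (0 : ℝ) ≤ N := Nat.cast_nonneg N
  nlinarith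

lemma sum_moebius_sq_eq_sum_primorial (Q n : ℕ) :
    ∑ q ∈ Finset.Ioc 0 Q, ((μ q : ℝ) / q.totient) ^ 2 * ramanujan q n =
      ∑ q ∈ (primorial Q).divisors with ¬ Q < q, singularTerm n q := by
  refine (Finset.sum_subset_zero_on_sdiff (fun q hq => ?_) (fun q hq => ?_) fun q hq => ?_).symm
  · have hq := Finset.mem_filter.1 hq
    exact Finset.mem_Ioc.2 ⟨Nat.pos_of_mem_divisors hq.1, not_lt.1 hq.2⟩
  · have hq := Finset.mem_sdiff.1 hq
    have hq1 := Finset.mem_Ioc.1 hq.1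
    rw [ArithmeticFunction.moebius_eq_zero_of_not_squarefree]
    · simp
    · intro hsq
      refine hq.2 (Finset.mem_filter.2 ⟨Nat.mem_divisors.2 ⟨?_, (squarefree_primorial Q).ne_zero⟩,
        not_lt.2 hq1.2⟩)
      rw [← Nat.prod_primeFactors_of_squarefree hsq, primorial_eq_prod_primesLE]
      refine Finset.prod_dvd_prod_of_subset _ _ _ fun p hp => ?_
      exact Nat.mem_primesLE.2 ⟨(Nat.le_of_mem_primeFactors hp).trans hq1.2,
        Nat.prime_of_mem_primeFactors hp⟩
  · have hq := Nat.dvd_of_mem_divisors (Finset.mem_filter.1 hq).1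
    have h : (μ q : ℝ) ^ 2 = 1 := by
      exact_mod_cast ArithmeticFunction.moebius_sq_eq_one_of_squarefree
        ((squarefree_primorial Q).squarefree_of_dvd hq)
    rw [singularTerm_apply, div_pow, h]
    ring

lemma abs_sieveCoeff_sq_sub_le {q R N : ℕ} (hq : 0 < q) (hN : 0 < N) {B : ℝ}
    (hB : ∀ α : ℝ, ‖∑ n ∈ Finset.range (N + 1), ((primeLog n - sieveModel R n : ℝ) : ℂ) *
      expi (n * α)‖ ≤ B) :
    |sieveCoeff R q ^ 2 - (Chebyshev.theta N / N) ^ 2 * ((μ q : ℝ) / q.totient) ^ 2| ≤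
      q ^ 2 * ((B + R * Real.log R + Real.log N) / N) * (Real.log R * (1 + Real.log R) + 2) := by
  have hN' : (0 : ℝ) < N := by exact_mod_cast hN
  have hφ : (1 : ℝ) ≤ q.totient := by exact_mod_cast Nat.totient_pos.2 hq
  have hR : 0 ≤ Real.log R := Real.log_natCast_nonneg R
  have hq1 : (1 : ℝ) ≤ q := by exact_mod_cast hq
  have h1 := abs_mul_sieveCoeff_sub_le hq hB
  obtain ⟨v, hv⟩ : ∃ v, v = Chebyshev.theta N / N * ((μ q : ℝ) / q.totient) := ⟨_, rfl⟩
  have h2 : |sieveCoeff R q - v| ≤ q ^ 2 * ((B + R * Real.log R + Real.log N) / N) := by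
    have h3 : sieveCoeff R q - v = (N * (q.totient * sieveCoeff R q) - μ q * Chebyshev.theta N) /
        (N * q.totient) := by
      rw [hv]; field_simp
    rw [h3, abs_div, abs_of_pos (show (0 : ℝ) < N * q.totient by positivity),
      div_le_iff₀ (by positivity)]
    have h4 : (q : ℝ) ^ 2 * ((B + R * Real.log R + Real.log N) / N) * (N * q.totient) =
        q ^ 2 * (B + R * Real.log R + Real.log N) * q.totient := by field_simp
    rw [h4]
    refine h1.trans (le_mul_of_one_le_right ((abs_nonneg _).trans h1) hφ)
  have h5 : |v| ≤ 2 := by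
    have h6 : 0 ≤ Chebyshev.theta N / N := div_nonneg (Chebyshev.theta_nonneg _) hN'.le
    rw [hv, abs_mul, abs_of_nonneg h6, abs_div, Nat.abs_cast]
    calc _ ≤ (2 : ℝ) * 1 := by
          gcongr
          · rw [div_le_iff₀ hN']
            exact theta_le_two_mul N
          · exact div_le_one_of_le₀ ((abs_moebius_le q).trans hφ) (by linarith)
      _ = _ := by norm_num
  have h7 : |sieveCoeff R q| ≤ Real.log R * (1 + Real.log R) :=
    (abs_sieveCoeff_le hq R).trans (div_le_self (by positivity) hq1)
  have h8 : sieveCoeff R q ^ 2 - (Chebyshev.theta N / N) ^ 2 * ((μ q : ℝ) / q.totient) ^ 2 =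
      (sieveCoeff R q - v) * (sieveCoeff R q + v) := by
    rw [← mul_pow, ← hv]; ring
  rw [h8, abs_mul]
  have h9 : |sieveCoeff R q + v| ≤ Real.log R * (1 + Real.log R) + 2 :=
    (abs_add_le _ _).trans (add_le_add h7 h5)
  exact mul_le_mul h2 h9 (abs_nonneg _) ((abs_nonneg _).trans h2)

theorem le_sum_antidiagonal_sieveModel {n Q R N : ℕ} (hn : 0 < n) (hne : Even n) (hQ : 2 ≤ Q)
    (hQR : Q ≤ R) (hN : 0 < N) {B : ℝ}
    (hB : ∀ α : ℝ, ‖∑ n ∈ Finset.range (N + 1), ((primeLog n - sieveModel R n : ℝ) : ℂ) *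
      expi (n * α)‖ ≤ B) :
    n * ((Chebyshev.theta N / N) ^ 2 - (Chebyshev.theta N / N) ^ 2 *
        |∑ q ∈ (primorial Q).divisors with Q < q, singularTerm n q| -
      |∑ q ∈ Finset.Ioc Q R, sieveCoeff R q ^ 2 * ramanujan q n| -
      Q ^ 5 * ((B + R * Real.log R + Real.log N) / N) * (Real.log R * (1 + Real.log R) + 2)) -
      2 * (R * Real.log R) ^ 2 ≤
    ∑ x ∈ Finset.HasAntidiagonal.antidiagonal n, sieveModel R x.1 * sieveModel R x.2 := by
  have hR : 0 ≤ Real.log R := Real.log_natCast_nonneg R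
  have hB0 : 0 ≤ B := (norm_nonneg _).trans (hB 0)
  have hLN : 0 ≤ Real.log N := Real.log_natCast_nonneg N
  have h1 := abs_sum_antidiagonal_sieveModel_sub_le hn R
  obtain ⟨t, ht⟩ : ∃ t, t = (Chebyshev.theta N / N) ^ 2 := ⟨_, rfl⟩
  obtain ⟨E, hE⟩ : ∃ E, E = ((B + R * Real.log R + Real.log N) / N) *
    (Real.log R * (1 + Real.log R) + 2) := ⟨_, rfl⟩
  have hE0 : 0 ≤ E := by rw [hE]; positivity
  have h2 := Finset.sum_Ioc_consecutive (fun q => sieveCoeff R q ^ 2 * ramanujan q n)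
    (Nat.zero_le Q) hQR
  have h3 : |∑ q ∈ Finset.Ioc 0 Q, sieveCoeff R q ^ 2 * ramanujan q n -
      t * ∑ q ∈ (primorial Q).divisors with ¬ Q < q, singularTerm n q| ≤ Q ^ 5 * E := by
    rw [← sum_moebius_sq_eq_sum_primorial, Finset.mul_sum, ← Finset.sum_sub_distrib]
    refine (Finset.abs_sum_le_sum_abs _ _).trans ?_
    calc _ ≤ ∑ q ∈ Finset.Ioc 0 Q, (Q : ℝ) ^ 2 * E * (Q : ℝ) ^ 2 := by
          refine Finset.sum_le_sum fun q hq => ?_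
          have hq := Finset.mem_Ioc.1 hq
          have hqQ : (q : ℝ) ≤ Q := by exact_mod_cast hq.2
          rw [← mul_assoc, ← sub_mul, abs_mul]
          have h4 := abs_sieveCoeff_sq_sub_le hq.1 hN hB
          rw [← ht, mul_assoc, ← hE] at h4
          gcongr
          · exact h4.trans (by gcongr)
          · exact (abs_ramanujan_le q n).trans (by gcongr)
      _ = _ := by
          simp only [Finset.sum_const, Nat.card_Ioc, nsmul_eq_mul, Nat.sub_zero]
          ring
  have h4 := Finset.sum_filter_add_sum_filter_not (primorial Q).divisors (fun q => Q < q)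
    (singularTerm n)
  have h5 := one_le_sum_singularTerm hne hQ
  have ht0 : 0 ≤ t := by rw [ht]; positivity
  rw [mul_assoc ((Q : ℝ) ^ 5), ← hE, ← ht]
  obtain ⟨S1, hS1⟩ : ∃ S, S = ∑ q ∈ (primorial Q).divisors with ¬ Q < q, singularTerm n q := ⟨_, rfl⟩
  obtain ⟨S2, hS2⟩ : ∃ S, S = ∑ q ∈ (primorial Q).divisors with Q < q, singularTerm n q := ⟨_, rfl⟩
  obtain ⟨T1, hT1⟩ : ∃ S, S = ∑ q ∈ Finset.Ioc Q R, sieveCoeff R q ^ 2 * ramanujan q n := ⟨_, rfl⟩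
  rw [← hS1] at h3 h4
  rw [← hS2] at h4 ⊢
  rw [← hT1] at h2 ⊢
  rw [← h2] at h1
  rw [← h4] at h5
  have h6 : t * (1 - |S2|) ≤ t * S1 := by
    refine mul_le_mul_of_nonneg_left ?_ ht0
    have := le_abs_self S2
    linarith
  have h7 := neg_abs_le T1
  have h8 := (abs_le.1 h3).1
  have h9 := (abs_le.1 h1).1
  have hn0 : (0 : ℝ) ≤ n := Nat.cast_nonneg n
  have h10 : (n : ℝ) * (t - t * |S2| - |T1| - Q ^ 5 * E) ≤
      n * (∑ q ∈ Finset.Ioc 0 Q, sieveCoeff R q ^ 2 * ramanujan q n + T1) :=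
    mul_le_mul_of_nonneg_left (by linarith) hn0
  linarith

end LowerBound

section ExceptionalSet

/-- The positive even integers up to `N` which are not a sum of two primes. -/
noncomputable def exceptionalSet (N : ℕ) : Finset ℕ := by
  classical
  exact (Finset.Ioc 0 N).filter fun n => Even n ∧ ¬ ∃ p₁ p₂ : ℕ, p₁.Prime ∧ p₂.Prime ∧ p₁ + p₂ = n

lemma mem_exceptionalSet {N n : ℕ} : n ∈ exceptionalSet N ↔
    n ∈ Finset.Ioc 0 N ∧ Even n ∧ ¬ ∃ p₁ p₂ : ℕ, p₁.Prime ∧ p₂.Prime ∧ p₁ + p₂ = n := by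
  classical
  simp only [exceptionalSet, Finset.mem_filter]

lemma sum_antidiagonal_primeLog_eq_zero {n : ℕ}
    (h : ¬ ∃ p₁ p₂ : ℕ, p₁.Prime ∧ p₂.Prime ∧ p₁ + p₂ = n) :
    ∑ x ∈ Finset.HasAntidiagonal.antidiagonal n, primeLog x.1 * primeLog x.2 = 0 := by
  refine Finset.sum_eq_zero fun x hx => ?_
  have hx := Finset.HasAntidiagonal.mem_antidiagonal.1 hx
  by_contra hne
  have h1 := left_ne_zero_of_mul hne
  have h2 := right_ne_zero_of_mul hne
  rw [primeLog, ne_eq, ite_eq_right_iff, Classical.not_imp] at h1 h2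
  exact h ⟨x.1, x.2, h1.1, h2.1, hx⟩

lemma sum_antidiagonal_add_mul_sub (u v : ℕ → ℝ) (n : ℕ) :
    ∑ x ∈ Finset.HasAntidiagonal.antidiagonal n, (u x.1 + v x.1) * (u x.2 - v x.2) =
      ∑ x ∈ Finset.HasAntidiagonal.antidiagonal n, u x.1 * u x.2 -
        ∑ x ∈ Finset.HasAntidiagonal.antidiagonal n, v x.1 * v x.2 := by
  have h1 := Finset.Nat.sum_antidiagonal_swap (n := n) (f := fun x : ℕ × ℕ => u x.1 * v x.2)
  simp only [Prod.fst_swap, Prod.snd_swap] at h1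
  have h2 : ∀ x : ℕ × ℕ, (u x.1 + v x.1) * (u x.2 - v x.2) =
      u x.1 * u x.2 - u x.1 * v x.2 + u x.2 * v x.1 - v x.1 * v x.2 := fun x => by ring
  rw [Finset.sum_congr rfl fun x _ => h2 x, Finset.sum_sub_distrib, Finset.sum_add_distrib,
    Finset.sum_sub_distrib, h1]
  ring

lemma sum_sq_primeLog_add_sieveModel_le {R N : ℕ} (hR : 0 < R) (hRN : R ≤ N) :
    ∑ n ∈ Finset.range (N + 1), (primeLog n + sieveModel R n) ^ 2 ≤
      4 * Real.log N ^ 2 * (N * (1 + Real.log N) ^ 3) := by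
  have hL : 0 ≤ Real.log N := Real.log_natCast_nonneg N
  have hR' : Real.log R ≤ Real.log N :=
    Real.log_le_log (by exact_mod_cast hR) (by exact_mod_cast hRN)
  have hR0 : 0 ≤ Real.log R := Real.log_natCast_nonneg R
  rw [Finset.range_eq_Ico, Finset.sum_eq_sum_Ico_succ_bot (Nat.succ_pos N)]
  have h' : Finset.Ico (0 + 1) (N + 1) = Finset.Ioc 0 N := by
    ext; simp only [Finset.mem_Ico, Finset.mem_Ioc]; omega
  have h0 : primeLog 0 + sieveModel R 0 = 0 := by simp [primeLog, sieveModel]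
  rw [h', h0, zero_pow two_ne_zero, zero_add]
  calc _ ≤ ∑ n ∈ Finset.Ioc 0 N, 4 * Real.log N ^ 2 * (n.divisors.card : ℝ) ^ 2 := by
        refine Finset.sum_le_sum fun n hn => ?_
        have hn := Finset.mem_Ioc.1 hn
        have h1 : (1 : ℝ) ≤ n.divisors.card := by
          exact_mod_cast Finset.card_pos.2 ⟨1, Nat.one_mem_divisors.2 hn.1.ne'⟩
        have h2 : primeLog n ≤ Real.log N := (primeLog_le_log n).trans
          (Real.log_le_log (by exact_mod_cast hn.1) (by exact_mod_cast hn.2))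
        have h3 := abs_sieveModel_le R n
        have h4 : |primeLog n + sieveModel R n| ≤ 2 * Real.log N * n.divisors.card := by
          refine (abs_add_le _ _).trans ?_
          rw [abs_of_nonneg (primeLog_nonneg n)]
          have h5 : (n.divisors.card : ℝ) * Real.log R ≤ n.divisors.card * Real.log N := by gcongr
          nlinarith
        rw [← sq_abs]
        calc _ ≤ (2 * Real.log N * n.divisors.card) ^ 2 := by gcongr
          _ = _ := by ring
    _ ≤ _ := by
        rw [← Finset.mul_sum]
        gcongr
        exact sum_card_divisors_sq_le N

lemma card_exceptionalSet_le {N Q R : ℕ} (hQ : 2 ≤ Q) (hQR : Q ≤ R) (hRN : R ≤ N) {B C M : ℝ}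
    (hB : ∀ α : ℝ, ‖∑ n ∈ Finset.range (N + 1), ((primeLog n - sieveModel R n : ℝ) : ℂ) *
      expi (n * α)‖ ≤ B)
    (hC : ∑ q ∈ (primorial Q).divisors, rankinTerm q ≤ C) (hM : 0 < M)
    (hθ : 1 / 2 ≤ Chebyshev.theta N / N)
    (hδ : Q ^ 5 * ((B + R * Real.log R + Real.log N) / N) *
      (Real.log R * (1 + Real.log R) + 2) ≤ 1 / 16)
    (hRM : 2 * (R * Real.log R) ^ 2 ≤ M / 16) :
    ((exceptionalSet N).card : ℝ) ≤ M + 128 * (N * (C / √Q)) +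
      32 * (N * ((Real.log R * (1 + Real.log R)) ^ 2 * (1 + Real.log R) ^ 2 / Q)) +
      (16 / M) ^ 2 * (B ^ 2 * (4 * Real.log N ^ 2 * (N * (1 + Real.log N) ^ 3))) := by
  have hN : 0 < N := by omega
  obtain ⟨T2, hT2⟩ : ∃ T : ℕ → ℝ, T = fun n =>
    |∑ q ∈ (primorial Q).divisors with Q < q, singularTerm n q| := ⟨_, rfl⟩
  obtain ⟨T1, hT1⟩ : ∃ T : ℕ → ℝ, T = fun n =>
    |∑ q ∈ Finset.Ioc Q R, sieveCoeff R q ^ 2 * ramanujan q n| := ⟨_, rfl⟩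
  obtain ⟨H, hH⟩ : ∃ T : ℕ → ℝ, T = fun n => ∑ x ∈ Finset.HasAntidiagonal.antidiagonal n,
    (primeLog x.1 + sieveModel R x.1) * (primeLog x.2 - sieveModel R x.2) := ⟨_, rfl⟩
  have hT1n : ∀ n, 0 ≤ T1 n := fun n => by rw [hT1]; exact abs_nonneg _
  have hT2n : ∀ n, 0 ≤ T2 n := fun n => by rw [hT2]; exact abs_nonneg _
  have h1 : ∑ n ∈ Finset.Ioc 0 N, T1 n ≤
      N * ((Real.log R * (1 + Real.log R)) ^ 2 * (1 + Real.log R) ^ 2 / Q) := by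
    rw [hT1]; exact sum_abs_tail_sieveCoeff_le (show 0 < Q by omega) R N
  have h2 : ∑ n ∈ Finset.Ioc 0 N, T2 n ≤ N * (C / √Q) := by
    rw [hT2]; exact sum_abs_tail_singularTerm_le (show 0 < Q by omega) hC N
  have h3 : ∑ n ∈ Finset.Ioc 0 N, H n ^ 2 ≤
      B ^ 2 * (4 * Real.log N ^ 2 * (N * (1 + Real.log N) ^ 3)) := by
    calc _ ≤ ∑ n ∈ Finset.range (N + 1), H n ^ 2 := by
          refine Finset.sum_le_sum_of_subset_of_nonneg (fun n hn => ?_) fun n _ _ => sq_nonneg _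
          have := Finset.mem_Ioc.1 hn
          exact Finset.mem_range.2 (by omega)
      _ ≤ B ^ 2 * ∑ n ∈ Finset.range (N + 1), (primeLog n + sieveModel R n) ^ 2 := by
          rw [hH]
          exact sum_sq_convolution_le (u := fun n => primeLog n + sieveModel R n)
            (v := fun n => primeLog n - sieveModel R n) hB
      _ ≤ _ := by
          gcongr
          exact sum_sq_primeLog_add_sieveModel_le (by omega) hRN
  have hkey : ∀ n ∈ exceptionalSet N, M < n →
      1 ≤ 128 * T2 n + 32 * T1 n + (16 / M) ^ 2 * H n ^ 2 := by
    intro n hn hMn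
    obtain ⟨hn1, hne, hng⟩ := mem_exceptionalSet.1 hn
    have hn1 := Finset.mem_Ioc.1 hn1
    have h4 := le_sum_antidiagonal_sieveModel hn1.1 hne hQ hQR hN hB
    have h5 : H n = - ∑ x ∈ Finset.HasAntidiagonal.antidiagonal n,
        sieveModel R x.1 * sieveModel R x.2 := by
      rw [hH]
      dsimp only
      rw [sum_antidiagonal_add_mul_sub, sum_antidiagonal_primeLog_eq_zero hng, zero_sub]
    have h6 : T2 n = |∑ q ∈ (primorial Q).divisors with Q < q, singularTerm n q| := by rw [hT2]
    have h7 : T1 n = |∑ q ∈ Finset.Ioc Q R, sieveCoeff R q ^ 2 * ramanujan q n| := by rw [hT1]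
    rw [← h6, ← h7, ← neg_eq_iff_eq_neg.2 h5] at h4
    have ht2 : Chebyshev.theta N / N ≤ 2 := by
      rw [div_le_iff₀ (by exact_mod_cast hN)]
      exact theta_le_two_mul N
    obtain ⟨t, ht⟩ : ∃ t, t = Chebyshev.theta N / N := ⟨_, rfl⟩
    rw [← ht] at h4 hθ ht2
    have ht4 : t ^ 2 ≤ 4 := by nlinarith
    have ht14 : 1 / 4 ≤ t ^ 2 := by nlinarith
    have h8 : t ^ 2 * T2 n ≤ 4 * T2 n := by
      have := hT2n n
      gcongr
    have hn0 : (0 : ℝ) < n := hM.trans hMn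
    have h9 : (n : ℝ) * (1 / 8 - 4 * T2 n - T1 n) ≤ |H n| := by
      have h10 := (mul_le_mul_of_nonneg_left (show 1 / 8 - 4 * T2 n - T1 n + 1 / 16 ≤
        t ^ 2 - t ^ 2 * T2 n - T1 n - Q ^ 5 * ((B + R * Real.log R + Real.log N) / N) *
          (Real.log R * (1 + Real.log R) + 2) by linarith) hn0.le)
      have := neg_le_abs (H n)
      linarith
    by_cases h11 : 1 / 32 ≤ 4 * T2 n
    · have := hT1n n
      have : 0 ≤ (16 / M) ^ 2 * H n ^ 2 := by positivity
      linarith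
    by_cases h12 : 1 / 32 ≤ T1 n
    · have := hT2n n
      have : 0 ≤ (16 / M) ^ 2 * H n ^ 2 := by positivity
      linarith
    push Not at h11 h12
    have h13 : M / 16 ≤ |H n| := by
      have : (n : ℝ) * (1 / 16) ≤ n * (1 / 8 - 4 * T2 n - T1 n) := by
        gcongr
        linarith
      linarith
    have h14 : 1 ≤ 16 / M * |H n| := by
      rw [div_mul_eq_mul_div, one_le_div hM]
      linarith
    have h15 : 1 ≤ (16 / M) ^ 2 * H n ^ 2 := by
      rw [← sq_abs (H n), ← mul_pow]
      exact one_le_pow₀ h14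
    have := hT1n n
    have := hT2n n
    linarith
  have hcard : ((exceptionalSet N).card : ℝ) ≤ (⌊M⌋₊ : ℝ) +
      ∑ n ∈ Finset.Ioc 0 N, (128 * T2 n + 32 * T1 n + (16 / M) ^ 2 * H n ^ 2) := by
    rw [← Finset.card_filter_add_card_filter_not (s := exceptionalSet N) (fun n : ℕ => (n : ℝ) ≤ M),
      Nat.cast_add]
    gcongr
    · have : (exceptionalSet N).filter (fun n : ℕ => (n : ℝ) ≤ M) ⊆ Finset.Ioc 0 ⌊M⌋₊ := by
        intro n hn
        have hn := Finset.mem_filter.1 hn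
        exact Finset.mem_Ioc.2 ⟨(Finset.mem_Ioc.1 (mem_exceptionalSet.1 hn.1).1).1,
          Nat.le_floor hn.2⟩
      simpa using Finset.card_le_card this
    · rw [Finset.card_eq_sum_ones, Nat.cast_sum]
      calc _ ≤ ∑ n ∈ (exceptionalSet N).filter (fun n : ℕ => ¬ (n : ℝ) ≤ M),
            (128 * T2 n + 32 * T1 n + (16 / M) ^ 2 * H n ^ 2) := by
            refine Finset.sum_le_sum fun n hn => ?_
            have hn := Finset.mem_filter.1 hn
            rw [Nat.cast_one]
            exact hkey n hn.1 (not_le.1 hn.2)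
        _ ≤ _ := by
            refine Finset.sum_le_sum_of_subset_of_nonneg (fun n hn => ?_) fun n _ _ => ?_
            · exact (mem_exceptionalSet.1 (Finset.mem_filter.1 hn).1).1
            · have := hT1n n
              have := hT2n n
              positivity
  refine hcard.trans ?_
  rw [Finset.sum_add_distrib, Finset.sum_add_distrib, ← Finset.mul_sum, ← Finset.mul_sum,
    ← Finset.mul_sum]
  have h16 := Nat.floor_le hM.le
  have h17 := mul_le_mul_of_nonneg_left h3 (sq_nonneg (16 / M))
  linarith

end ExceptionalSet

section LogSaving

lemma exists_approx_fourth_root {N : ℕ} (hN : 16 ≤ N) : ∃ R, 2 ≤ R ∧ R ^ 4 ≤ N ∧ N ≤ R ^ 8 := by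
  obtain ⟨s, hs⟩ : ∃ s, s = Nat.sqrt N := ⟨_, rfl⟩
  obtain ⟨R, hR⟩ : ∃ R, R = Nat.sqrt s := ⟨_, rfl⟩
  have h1 : s ^ 2 ≤ N := hs ▸ Nat.sqrt_le' N
  have h2 : N < (s + 1) ^ 2 := hs ▸ Nat.lt_succ_sqrt' N
  have h3 : R ^ 2 ≤ s := hR ▸ Nat.sqrt_le' s
  have h4 : s < (R + 1) ^ 2 := hR ▸ Nat.lt_succ_sqrt' s
  have hs4 : 4 ≤ s := by
    rw [hs]; exact Nat.le_sqrt'.2 (by omega)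
  have hR2 : 2 ≤ R := by
    rw [hR]; exact Nat.le_sqrt'.2 (by omega)
  refine ⟨R, hR2, ?_, ?_⟩
  · calc R ^ 4 = (R ^ 2) ^ 2 := by ring
      _ ≤ s ^ 2 := Nat.pow_le_pow_left h3 2
      _ ≤ N := h1
  · calc N ≤ (s + 1) ^ 2 := h2.le
      _ ≤ ((R + 1) ^ 2) ^ 2 := Nat.pow_le_pow_left h4 2
      _ ≤ ((R ^ 2) ^ 2) ^ 2 := Nat.pow_le_pow_left (Nat.pow_le_pow_left (by nlinarith) 2) 2
      _ = R ^ 8 := by ring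

lemma half_le_theta_div {N : ℕ} (hL : 200 ≤ Real.log N) : 1 / 2 ≤ Chebyshev.theta N / N := by
  have hN : 0 < N := Nat.pos_of_ne_zero fun h => by norm_num [h] at hL
  have hN1 : (1 : ℝ) ≤ N := by exact_mod_cast hN
  rw [le_div_iff₀ (by linarith)]
  have h1 := Chebyshev.theta_ge N
  have h2 := pow_log_mul_sqrt_le 2 hN1
  have h3 : Real.log (N + 1) ≤ 2 * Real.log N := by
    calc _ ≤ Real.log (2 * N) := Real.log_le_log (by linarith) (by linarith)
      _ = Real.log 2 + Real.log N := Real.log_mul (by norm_num) (by linarith)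
      _ ≤ _ := by have := Real.log_two_lt_d9; linarith
  have h4 : Real.log N ≤ √N * Real.log N :=
    le_mul_of_one_le_left (by linarith) (Real.one_le_sqrt.2 hN1)
  have h5 : √N * Real.log N * 200 ≤ 8 * N := by
    calc _ ≤ √N * Real.log N * Real.log N := by gcongr
      _ = √N * Real.log N ^ 2 := by ring
      _ ≤ 2 ^ 2 * Nat.factorial 2 * N := h2
      _ = _ := by norm_num [Nat.factorial]
  have h6 := Real.log_two_gt_d9
  have h7 : (N : ℝ) * 0.69 ≤ N * Real.log 2 := by gcongr; linarith
  linarith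

theorem exists_card_exceptionalSet_le (A : ℕ) : ∃ C L₀ : ℝ, 0 < C ∧ 2 ≤ L₀ ∧
    ∀ N : ℕ, L₀ ≤ Real.log N → ((exceptionalSet N).card : ℝ) ≤ C * (N / Real.log N ^ A) := by
  obtain ⟨b, hb⟩ : ∃ b, b = 2 * A + 6 := ⟨_, rfl⟩
  obtain ⟨D, hD⟩ : ∃ D, D = 5 * b + 3 := ⟨_, rfl⟩
  obtain ⟨C₁, hC₁, hF⟩ := exists_norm_sum_primeLog_sub_sieveModel_le D
  obtain ⟨C, hC, hS⟩ := exists_sum_rankinTerm_le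
  obtain ⟨K, hK⟩ : ∃ K : ℝ, K = 2 ^ (D + 1) * (D + 1).factorial := ⟨_, rfl⟩
  obtain ⟨K₁, hK₁⟩ : ∃ K : ℝ, K = 2 ^ (A + 3) * (A + 3).factorial := ⟨_, rfl⟩
  obtain ⟨K₂, hK₂⟩ : ∃ K : ℝ, K = (b + 1).factorial * 8 ^ (b + 1) := ⟨_, rfl⟩
  have hK0 : 0 ≤ K := by rw [hK]; positivity
  refine ⟨1 + 128 * C + 1024 + 8192 * C₁ ^ 2,
    max 200 (max (32 * K₁) (max K₂ (64 * (C₁ + 2 * K)))), by positivity,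
    le_max_of_le_left (by norm_num), fun N hL => ?_⟩
  obtain ⟨L, hLdef⟩ : ∃ L, L = Real.log N := ⟨_, rfl⟩
  rw [← hLdef] at hL ⊢
  have hL200 : 200 ≤ L := (le_max_left _ _).trans hL
  replace hL := (le_max_right _ _).trans hL
  have hLK₁ : 32 * K₁ ≤ L := (le_max_left _ _).trans hL
  replace hL := (le_max_right _ _).trans hL
  have hLK₂ : K₂ ≤ L := (le_max_left _ _).trans hL
  have hLC : 64 * (C₁ + 2 * K) ≤ L := (le_max_right _ _).trans hL
  clear hL
  have hL0 : 0 < L := by linarith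
  have hN0 : 0 < N := Nat.pos_of_ne_zero fun h => by
    rw [h, Nat.cast_zero, Real.log_zero] at hLdef; linarith
  have hNR : (1 : ℝ) ≤ N := by exact_mod_cast hN0
  have hLN : L ≤ N := by rw [hLdef]; exact Real.log_le_self (by linarith)
  have hN16 : 16 ≤ N := by
    have : (16 : ℝ) ≤ N := by linarith
    exact_mod_cast this
  obtain ⟨R, hR2, hR4, hR8⟩ := exists_approx_fourth_root hN16
  have hR2' : (2 : ℝ) ≤ R := by exact_mod_cast hR2
  have hR4' : (R : ℝ) ^ 4 ≤ N := by exact_mod_cast hR4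
  have hR8' : (N : ℝ) ≤ (R : ℝ) ^ 8 := by exact_mod_cast hR8
  have hRN : R ≤ N := (Nat.le_self_pow (by norm_num) R).trans hR4
  have hRsq : (R : ℝ) ^ 2 ≤ √N := Real.le_sqrt_of_sq_le (by linarith [hR4', pow_mul (R : ℝ) 2 2])
  have hRs : (R : ℝ) ≤ √N := by nlinarith
  have hlR0 : 0 ≤ Real.log R := Real.log_natCast_nonneg R
  have hlR : Real.log R ≤ L := by
    rw [hLdef]
    exact Real.log_le_log (by linarith) (by exact_mod_cast hRN)
  have hlR1 : 1 + Real.log R ≤ 2 * L := by linarith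
  have hL8 : L ≤ 8 * Real.log R := by
    calc L ≤ Real.log ((R : ℝ) ^ 8) := by rw [hLdef]; exact Real.log_le_log (by linarith) hR8'
      _ = _ := by rw [Real.log_pow]; norm_num
  have hs1 : 1 ≤ √(N : ℝ) := Real.one_le_sqrt.2 hNR
  have hLb : L ^ b ≤ R := by
    have h1 : L ^ b * L ≤ R * L := by
      calc L ^ b * L = L ^ (b + 1) := (pow_succ _ _).symm
        _ ≤ (8 * Real.log R) ^ (b + 1) := by gcongr
        _ = 8 ^ (b + 1) * Real.log R ^ (b + 1) := mul_pow _ _ _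
        _ ≤ 8 ^ (b + 1) * ((b + 1).factorial * R) := by
            gcongr
            exact log_pow_le_factorial_mul _ (by linarith)
        _ = R * K₂ := by rw [hK₂]; ring
        _ ≤ R * L := by gcongr
    exact le_of_mul_le_mul_right h1 hL0
  obtain ⟨Q, hQdef⟩ : ∃ Q, Q = ⌊L ^ b⌋₊ := ⟨_, rfl⟩
  have hQle : (Q : ℝ) ≤ L ^ b := by rw [hQdef]; exact Nat.floor_le (by positivity)
  have hLb4 : 4 ≤ L ^ b := by
    calc (4 : ℝ) ≤ L ^ 1 := by linarith
      _ ≤ L ^ b := pow_le_pow_right₀ (by linarith) (by omega)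
  have hQge : L ^ b / 2 ≤ Q := by
    have := Nat.lt_floor_add_one (L ^ b)
    rw [← hQdef] at this
    linarith
  have hQ2 : 2 ≤ Q := by rw [hQdef]; exact Nat.le_floor (by push_cast; linarith)
  have hQR : Q ≤ R := by exact_mod_cast hQle.trans hLb
  have hQ0 : (0 : ℝ) < Q := by positivity
  have hKN : √N * L ≤ K * N / L ^ D := by
    rw [le_div_iff₀ (by positivity)]
    calc _ = √N * L ^ (D + 1) := by ring
      _ ≤ _ := by rw [hLdef, hK]; exact pow_log_mul_sqrt_le (D + 1) hNR
  have hδ : (Q : ℝ) ^ 5 * ((C₁ * (N / L ^ D) + R * Real.log R + L) / N) *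
      (Real.log R * (1 + Real.log R) + 2) ≤ 1 / 16 := by
    have h1 : (C₁ * (N / L ^ D) + R * Real.log R + L) / N ≤ (C₁ + 2 * K) / L ^ D := by
      rw [div_le_iff₀ (by linarith)]
      have h2 : R * Real.log R ≤ √N * L := by gcongr
      have h3 : L ≤ √N * L := le_mul_of_one_le_left hL0.le hs1
      calc _ ≤ C₁ * (N / L ^ D) + K * N / L ^ D + K * N / L ^ D := by linarith
        _ = _ := by ring
    have h2 : Real.log R * (1 + Real.log R) + 2 ≤ 4 * L ^ 2 := by
      have : Real.log R * (1 + Real.log R) ≤ L * (2 * L) := by gcongr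
      nlinarith
    calc _ ≤ (L ^ b) ^ 5 * ((C₁ + 2 * K) / L ^ D) * (4 * L ^ 2) := by gcongr
      _ = 4 * (C₁ + 2 * K) / L := by rw [hD]; field_simp; ring
      _ ≤ 1 / 16 := by rw [div_le_iff₀ hL0]; linarith
  have hRM : 2 * (R * Real.log R) ^ 2 ≤ N / L ^ A / 16 := by
    have h0 : √N * L ^ (A + 3) ≤ K₁ * N := by
      rw [hLdef, hK₁]
      exact pow_log_mul_sqrt_le (A + 3) hNR
    have h1 : 32 * (√N * L ^ 2) * L ^ A * L ≤ N * L := by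
      calc _ = 32 * (√N * L ^ (A + 3)) := by ring
        _ ≤ 32 * (K₁ * N) := by gcongr
        _ = N * (32 * K₁) := by ring
        _ ≤ N * L := by gcongr
    have h2 := le_of_mul_le_mul_right h1 hL0
    rw [div_div, le_div_iff₀ (by positivity)]
    calc _ = 32 * ((R : ℝ) ^ 2 * Real.log R ^ 2) * L ^ A := by ring
      _ ≤ 32 * (√N * L ^ 2) * L ^ A := by gcongr
      _ ≤ N := h2
  have hB := hF N R hR2 hRN hR8
  rw [← hLdef] at hB
  have hmain := card_exceptionalSet_le (M := N / L ^ A) hQ2 hQR hRN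
    hB (hS Q) (by positivity)
    (half_le_theta_div (by rw [← hLdef]; exact hL200)) (by rw [← hLdef]; exact hδ) hRM
  rw [← hLdef] at hmain
  refine hmain.trans ?_
  have hAle : ∀ k, L ^ A ≤ L ^ (A + k) := fun k => pow_le_pow_right₀ (by linarith) (by omega)
  have hsqrt : L ^ A ≤ √Q := by
    refine Real.le_sqrt_of_sq_le (le_trans ?_ hQge)
    rw [le_div_iff₀ two_pos]
    calc (L ^ A) ^ 2 * 2 ≤ (L ^ A) ^ 2 * L := by gcongr; linarith
      _ = L ^ (2 * A + 1) := by ring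
      _ ≤ L ^ b := pow_le_pow_right₀ (by linarith) (by omega)
  have ht2 : 128 * ((N : ℝ) * (C / √Q)) ≤ 128 * C * (N / L ^ A) := by
    calc _ ≤ 128 * ((N : ℝ) * (C / L ^ A)) := by gcongr
      _ = _ := by ring
  have ht3 : 32 * ((N : ℝ) * ((Real.log R * (1 + Real.log R)) ^ 2 * (1 + Real.log R) ^ 2 / Q)) ≤
      1024 * (N / L ^ A) := by
    calc _ ≤ 32 * ((N : ℝ) * ((L * (2 * L)) ^ 2 * (2 * L) ^ 2 / (L ^ b / 2))) := by gcongr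
      _ = 1024 * (N / L ^ (A + A)) := by rw [hb]; field_simp; ring
      _ ≤ _ := by
        gcongr 1024 * (N / ?_)
        exact hAle A
  have ht4 : (16 / ((N : ℝ) / L ^ A)) ^ 2 * ((C₁ * (N / L ^ D)) ^ 2 *
      (4 * L ^ 2 * (N * (1 + L) ^ 3))) ≤ 8192 * C₁ ^ 2 * (N / L ^ A) := by
    calc _ ≤ (16 / ((N : ℝ) / L ^ A)) ^ 2 * ((C₁ * (N / L ^ D)) ^ 2 *
          (4 * L ^ 2 * (N * (2 * L) ^ 3))) := by gcongr; linarith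
      _ = 8192 * C₁ ^ 2 * (N / L ^ (A + (17 * A + 61))) := by rw [hD, hb]; field_simp; ring
      _ ≤ _ := by
        gcongr 8192 * C₁ ^ 2 * (N / ?_)
        exact hAle _
  linarith

end LogSaving

section Final

lemma goldbachExceptions_le_card_exceptionalSet (x : ℝ) :
    goldbachExceptions x ≤ (exceptionalSet ⌊x⌋₊).card := by
  rw [goldbachExceptions, ← Set.ncard_coe_finset]
  refine Set.ncard_le_ncard (fun n hn => ?_) (Finset.finite_toSet _)
  obtain ⟨h1, h2, h3⟩ := hn
  exact mem_exceptionalSet.2 ⟨Finset.mem_Ioc.2 ⟨by omega, Nat.le_floor h2⟩, h3⟩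

lemma log_le_two_mul_log_floor {x : ℝ} (hx : 2 ≤ x) : Real.log x ≤ 2 * Real.log ⌊x⌋₊ := by
  have h1 : (2 : ℝ) ≤ ⌊x⌋₊ := by
    exact_mod_cast Nat.le_floor (show ((2 : ℕ) : ℝ) ≤ x by exact_mod_cast hx)
  have h2 := Nat.lt_floor_add_one x
  calc Real.log x ≤ Real.log ((⌊x⌋₊ : ℝ) ^ 2) := Real.log_le_log (by linarith) (by nlinarith)
    _ = _ := by rw [Real.log_pow]; norm_num

end Final

end GoldbachExceptional

theorem goldbach_exceptional_set_log_saving :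
    ∀ A : ℝ, 0 < A → ∃ C : ℝ, ∀ x : ℝ, 2 ≤ x →
      (goldbachExceptions x : ℝ) ≤ C * x * Real.log x ^ (-A) := by
  intro A hA
  obtain ⟨C, L₀, hC, hL₀, h⟩ := GoldbachExceptional.exists_card_exceptionalSet_le ⌈A⌉₊
  refine ⟨C * 2 ^ ⌈A⌉₊ + (2 * L₀) ^ A, fun x hx => ?_⟩
  have hx0 : 0 < Real.log x := Real.log_pos (by linarith)
  have hfl : (⌊x⌋₊ : ℝ) ≤ x := Nat.floor_le (by linarith)
  have h1 : (goldbachExceptions x : ℝ) ≤ (GoldbachExceptional.exceptionalSet ⌊x⌋₊).card := by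
    exact_mod_cast GoldbachExceptional.goldbachExceptions_le_card_exceptionalSet x
  have h2 := GoldbachExceptional.log_le_two_mul_log_floor hx
  have hp : 0 < Real.log x ^ (-A) := Real.rpow_pos_of_pos hx0 _
  have hP : 0 ≤ C * 2 ^ ⌈A⌉₊ * x * Real.log x ^ (-A) := by positivity
  have hP' : 0 ≤ (2 * L₀) ^ A * x * Real.log x ^ (-A) := by positivity
  rw [add_mul, add_mul]
  rcases le_total L₀ (Real.log ⌊x⌋₊) with hL | hL
  · have h3 : Real.log x ^ ⌈A⌉₊ ≤ 2 ^ ⌈A⌉₊ * Real.log ⌊x⌋₊ ^ ⌈A⌉₊ := by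
      rw [← mul_pow]
      gcongr
    have hf0 : 0 < Real.log (⌊x⌋₊ : ℝ) := by linarith
    have h1x : 1 ≤ Real.log x := by
      have : Real.log (⌊x⌋₊ : ℝ) ≤ Real.log x :=
        Real.log_le_log (by
          have : (0 : ℝ) < ⌊x⌋₊ := by exact_mod_cast Nat.floor_pos.2 (by linarith)
          exact this) hfl
      linarith
    have h4 : Real.log x ^ A ≤ Real.log x ^ ⌈A⌉₊ := by
      rw [← Real.rpow_natCast]
      exact Real.rpow_le_rpow_of_exponent_le h1x (Nat.le_ceil A)
    have h5 : (⌊x⌋₊ : ℝ) / Real.log ⌊x⌋₊ ^ ⌈A⌉₊ ≤ 2 ^ ⌈A⌉₊ * x * Real.log x ^ (-A) := by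
      rw [Real.rpow_neg hx0.le, ← div_eq_mul_inv, div_le_div_iff₀ (by positivity) (by positivity)]
      calc _ ≤ x * (2 ^ ⌈A⌉₊ * Real.log ⌊x⌋₊ ^ ⌈A⌉₊) := by
            gcongr
            exact h4.trans h3
        _ = _ := by ring
    have h6 := mul_le_mul_of_nonneg_left h5 hC.le
    have h7 := h _ hL
    linarith
  · have h3 : (goldbachExceptions x : ℝ) ≤ x := by
      refine (h1.trans ?_).trans hfl
      have : GoldbachExceptional.exceptionalSet ⌊x⌋₊ ⊆ Finset.Ioc 0 ⌊x⌋₊ := fun n hn => (GoldbachExceptional.mem_exceptionalSet.1 hn).1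
      simpa using Finset.card_le_card this
    have h4 : 1 ≤ (2 * L₀) ^ A * Real.log x ^ (-A) := by
      rw [Real.rpow_neg hx0.le, ← div_eq_mul_inv, one_le_div (by positivity)]
      exact Real.rpow_le_rpow hx0.le (by linarith) hA.le
    have h5 := mul_le_mul_of_nonneg_right h4 (show 0 ≤ x by linarith)
    linarith
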